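/- Fix b₀ > 0, θ₀ = arctan b₀, and α, δ, δ₀ ∈ (0, 1). Let Q = {y ∈ ℝ³ : y₁ > 0, y₃ > b₀y₁} and for L ≥ 4 let Q_L = Q ∩ {r < L} where r = √(y₁² + y₃²). Let f ∈ H^{(1−δ,2−δ₀)}_{4,α}(Q) be 2π-periodic in y₂, let f_L be its restriction to Q_L, and set c_L = (1/(2πL(π/2 − θ₀)))·∫_{Q_L ∩ {0<y₂<2π}} f_L dy. Then there exists a unique function v_L ∈ C²(Q̄_L ∖ {(0, y₂, 0) : y₂ ∈ ℝ}) with finite norm ‖v_L‖^{(−1−δ,−δ₀)}_{0,0;Q_L} such that: Δv_L = f_L in Q_L; the normal derivative of v_L vanishes on the two lateral faces {y₃ = b₀y₁, y₁ > 0, r < L} and {y₁ = 0, y₃ > 0, r < L}; the radial derivative ∂_r v_L equals the constant c_L on {r = L} ∩ Q̄; v_L(y₁, y₂ + 2π, y₃) = v_L(y₁, y₂, y₃); and v_L(y) → 0 as y → (0,0,0) within Q̄_L. Moreover, there is a constant C depending only on b₀, α, δ, δ₀ (in particular independent of L and f) such that ‖v_L‖^{(−1−δ,−δ₀)}_{0,0;Q_L}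 ≤ C·‖f_L‖^{(1−δ,2−δ₀)}_{4,α;Q_L}. -/

import Mathlib

noncomputable section

open Real Set Filter MeasureTheory Topology

/-- Points of `ℝ³` (Euclidean). -/
abbrev V3 : Type := EuclideanSpace ℝ (Fin 3)

/-- `r_x = √(x₁² + x₃²)`, the distance of `x` to the `x₂`-axis. -/
def rx (x : V3) : ℝ := Real.sqrt (x 0 ^ 2 + x 2 ^ 2)

/-- The edge `{x₁ = x₃ = 0}` (the `x₂`-axis). -/
def edge : Set V3 := {x : V3 | x 0 = 0 ∧ x 2 = 0}

/-- The infinite wedge `Q = {y₁ > 0, y₃ > b₀y₁}`. -/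
def wedgeQ (b₀ : ℝ) : Set V3 := {y : V3 | 0 < y 0 ∧ b₀ * y 0 < y 2}

/-- The truncated wedge `Q_L = Q ∩ {r < L}`. -/
def wedgeQL (b₀ L : ℝ) : Set V3 := {y ∈ wedgeQ b₀ | rx y < L}

/-- `Q̄ ∖ edge`, the natural regularity set for functions on the wedge. -/
def SQ (b₀ : ℝ) : Set V3 := closure (wedgeQ b₀) \ edge

/-- `Q̄_L ∖ edge`. -/
def SL (b₀ L : ℝ) : Set V3 := closure (wedgeQL b₀ L) \ edge

/-- Partial derivative within `S` in the `i`-th coordinate direction. -/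
def pdW (S : Set V3) (i : Fin 3) (u : V3 → ℝ) (x : V3) : ℝ :=
  fderivWithin ℝ u S x (EuclideanSpace.single i 1)

/-- Laplacian of `u` at `x` (derivatives taken within `S`). -/
def lapW (S : Set V3) (u : V3 → ℝ) (x : V3) : ℝ :=
  ∑ i : Fin 3, pdW S i (pdW S i u) x

/-- `2π`-periodicity in `y₂`, on the set `D`. -/
def Per2On (D : Set V3) (u : V3 → ℝ) : Prop :=
  ∀ y ∈ D, u (y + EuclideanSpace.single 1 (2 * Real.pi)) = u y

/-- All weighted sup quantities entering `Σ_{j≤m}[u]^{(k,l)}_{j,0;D}` are `≤ M`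
(derivatives taken within `S`). -/
def wsupLE (S : Set V3) (m : ℕ) (k l : ℝ) (D : Set V3) (u : V3 → ℝ) (M : ℝ) : Prop :=
  (∀ j : ℕ, j ≤ m → ∀ x ∈ D, 0 < rx x → rx x < 1 →
      rx x ^ max (k + j) 0 * ‖iteratedFDerivWithin ℝ j u S x‖ ≤ M) ∧
  (∀ j : ℕ, j ≤ m → ∀ x ∈ D, 1 < rx x →
      rx x ^ (l + j) * ‖iteratedFDerivWithin ℝ j u S x‖ ≤ M)

/-- All quantities entering the weighted Hölder norm `‖u‖^{(k,l)}_{m,α;D}` are `≤ M`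
(derivatives taken within `S`). -/
def wnormLE (S : Set V3) (m : ℕ) (α k l : ℝ) (D : Set V3) (u : V3 → ℝ) (M : ℝ) : Prop :=
  wsupLE S m k l D u M ∧
  (∀ x ∈ D, ∀ y ∈ D, 0 < min (rx x) (rx y) → min (rx x) (rx y) < 1 →
      min (rx x) (rx y) ^ max (k + m + α) 0 *
        ‖iteratedFDerivWithin ℝ m u S x - iteratedFDerivWithin ℝ m u S y‖ ≤
        M * ‖x - y‖ ^ α) ∧
  (∀ x ∈ D, ∀ y ∈ D, 1 < min (rx x) (rx y) →
      min (rx x) (rx y) ^ (l + m + α) *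
        ‖iteratedFDerivWithin ℝ m u S x - iteratedFDerivWithin ℝ m u S y‖ ≤
        M * ‖x - y‖ ^ α)

/-- Membership in the weighted Hölder space `H^{(k,l)}_{m,α}(D)`. -/
def memH (S : Set V3) (m : ℕ) (α k l : ℝ) (D : Set V3) (u : V3 → ℝ) : Prop :=
  ContDiffOn ℝ m u S ∧ ∃ M : ℝ, 0 ≤ M ∧ wnormLE S m α k l D u M

/-- The constant `c_L` ensuring solvability of the cut-off Neumann problem (4.6). -/
def cutoffConst (b₀ L : ℝ) (f : V3 → ℝ) : ℝ :=
  (2 * Real.pi * L * (Real.pi / 2 - Real.arctan b₀))⁻¹ *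
    ∫ y in {y ∈ wedgeQL b₀ L | 0 < y 1 ∧ y 1 < 2 * Real.pi}, f y

/-- `v` solves the cut-off problem (4.4) on `Q_L` with right-hand side `f`:
`Δv = f` in `Q_L`, vanishing normal derivatives on the lateral faces `{y₃ = b₀y₁}` and
`{y₁ = 0}`, radial derivative `c_L` on `{r = L}`, `2π`-periodicity in `y₂`, and `v → 0`
at the point `(0,0,0)`. -/
def IsCutoffSolution (b₀ L : ℝ) (f v : V3 → ℝ) : Prop :=
  ContDiffOn ℝ 2 v (SL b₀ L) ∧
  (∀ y ∈ wedgeQL b₀ L, lapW (SL b₀ L) v y = f y) ∧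
  (∀ y ∈ SL b₀ L, y 2 = b₀ * y 0 → rx y < L →
      b₀ * pdW (SL b₀ L) 0 v y - pdW (SL b₀ L) 2 v y = 0) ∧
  (∀ y ∈ SL b₀ L, y 0 = 0 → rx y < L → pdW (SL b₀ L) 0 v y = 0) ∧
  (∀ y ∈ SL b₀ L, rx y = L →
      y 0 / L * pdW (SL b₀ L) 0 v y + y 2 / L * pdW (SL b₀ L) 2 v y = cutoffConst b₀ L f) ∧
  Per2On (closure (wedgeQL b₀ L)) v ∧
  Tendsto v (𝓝[SL b₀ L] (0 : V3)) (𝓝 0)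



/-! ### Homogeneous solutions of the radial ODE -/

/-- coefficients of the modified Bessel series -/
def bak (μ m : ℝ) : ℕ → ℝ
  | 0 => 1
  | k + 1 => m ^ 2 * bak μ m k / ((μ + 2 * (k + 1)) ^ 2 - μ ^ 2)

lemma bak_den {μ : ℝ} (hμ : 0 ≤ μ) (k : ℕ) : (k : ℝ) + 1 ≤ (μ + 2 * (k + 1)) ^ 2 - μ ^ 2 := by
  have : (0 : ℝ) ≤ k := Nat.cast_nonneg k
  nlinarith [mul_nonneg hμ this]

lemma bak_nonneg {μ : ℝ} (hμ : 0 ≤ μ) (m : ℝ) (k : ℕ) : 0 ≤ bak μ m k := by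
  induction k with
  | zero => simp [bak]
  | succ k ih =>
    have h := bak_den hμ k
    have : (0 : ℝ) ≤ k := Nat.cast_nonneg k
    rw [bak]
    apply div_nonneg (by positivity) (by linarith)

lemma bak_le {μ : ℝ} (hμ : 0 ≤ μ) (m : ℝ) (k : ℕ) : bak μ m k ≤ (m ^ 2) ^ k / k.factorial := by
  induction k with
  | zero => simp [bak]
  | succ k ih =>
    have h := bak_den hμ k
    have h0 : (0 : ℝ) ≤ k := Nat.cast_nonneg k
    rw [bak, Nat.factorial_succ, pow_succ (m ^ 2) k, Nat.cast_mul]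
    have e : (m ^ 2) ^ k * m ^ 2 / (((k + 1 : ℕ) : ℝ) * (k.factorial : ℝ))
        = m ^ 2 * ((m ^ 2) ^ k / k.factorial) / (k + 1) := by
      push_cast; field_simp
    rw [e]
    have := bak_nonneg hμ m k
    apply div_le_div₀ (by positivity) _ (by linarith) h
    gcongr

/-- terms of the series -/
def bterm (μ m : ℝ) (p : ℕ) (k : ℕ) (s : ℝ) : ℝ :=
  bak μ m k * (μ + 2 * k) ^ p * exp ((μ + 2 * k) * s)

def bbound (μ m : ℝ) (p : ℕ) (S : ℝ) (k : ℕ) : ℝ :=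
  p.factorial * exp (μ * (S + 1)) * ((m ^ 2 * exp (2 * (S + 1))) ^ k / k.factorial)

lemma bbound_summable (μ m : ℝ) (p : ℕ) (S : ℝ) : Summable (bbound μ m p S) :=
  (Real.summable_pow_div_factorial _).mul_left _

lemma bterm_nonneg {μ : ℝ} (hμ : 0 ≤ μ) (m : ℝ) (p k : ℕ) (s : ℝ) : 0 ≤ bterm μ m p k s := by
  have := bak_nonneg hμ m k
  unfold bterm; positivity

lemma bterm_le {μ : ℝ} (hμ : 0 ≤ μ) (m : ℝ) (p k : ℕ) {s S : ℝ} (hs : s ≤ S) :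
    bterm μ m p k s ≤ bbound μ m p S k := by
  unfold bterm bbound
  have h1 := bak_nonneg hμ m k
  have h2 := bak_le hμ m k
  set x : ℝ := μ + 2 * k with hx
  have hx0 : 0 ≤ x := by positivity
  have h3 : x ^ p ≤ p.factorial * exp x := by
    have := Real.pow_div_factorial_le_exp x hx0 p
    rwa [div_le_iff₀ (by positivity), mul_comm] at this
  have h4 : exp (x * s) ≤ exp (x * S) := by gcongr
  calc bak μ m k * x ^ p * exp (x * s)
      ≤ ((m ^ 2) ^ k / k.factorial) * (p.factorial * exp x) * exp (x * S) := by gcongr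
    _ = _ := by
        have e : exp x * exp (x * S) = exp (μ * (S + 1)) * exp (2 * (S + 1)) ^ k := by
          rw [← Real.exp_nat_mul, ← Real.exp_add, ← Real.exp_add]; congr 1; rw [hx]; ring
        rw [mul_pow]
        linear_combination ((m ^ 2) ^ k / k.factorial) * p.factorial * e

lemma bterm_summable {μ : ℝ} (hμ : 0 ≤ μ) (m : ℝ) (p : ℕ) (s : ℝ) :
    Summable (fun k => bterm μ m p k s) :=
  Summable.of_nonneg_of_le (fun k => bterm_nonneg hμ m p k s)
    (fun k => bterm_le hμ m p k le_rfl) (bbound_summable μ m p s)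

def bsol (μ m : ℝ) (p : ℕ) (s : ℝ) : ℝ := ∑' k, bterm μ m p k s

lemma bsol_hasDerivAt {μ : ℝ} (hμ : 0 ≤ μ) (m : ℝ) (p : ℕ) (s : ℝ) :
    HasDerivAt (bsol μ m p) (bsol μ m (p + 1) s) s := by
  unfold bsol
  refine hasDerivAt_tsum_of_isPreconnected (u := bbound μ m (p + 1) (s + 1)) (t := Iio (s + 1))
    (y₀ := s) (g := fun k y => bterm μ m p k y) (g' := fun k y => bterm μ m (p + 1) k y)
    (bbound_summable _ _ _ _) isOpen_Iio
    isPreconnected_Iio ?_ ?_ (by simp) (bterm_summable hμ m p s) (by simp)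
  · intro k y _
    unfold bterm
    have h : HasDerivAt (fun y => exp ((μ + 2 * k) * y)) (exp ((μ + 2 * k) * y) * ((μ + 2 * k) * 1)) y :=
      ((hasDerivAt_id y).const_mul _).exp
    have := h.const_mul (bak μ m k * (μ + 2 * k) ^ p)
    convert! this using 1
    ring
  · intro k y hy
    rw [Real.norm_of_nonneg (bterm_nonneg hμ _ _ _ _)]
    exact bterm_le hμ m _ k (le_of_lt hy)

lemma bsol_ode {μ : ℝ} (hμ : 0 ≤ μ) (m : ℝ) (s : ℝ) :
    bsol μ m 2 s = (μ ^ 2 + m ^ 2 * exp (2 * s)) * bsol μ m 0 s := by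
  unfold bsol
  have h2 := bterm_summable hμ m 2 s
  have h0 := bterm_summable hμ m 0 s
  rw [h2.tsum_eq_zero_add, add_mul, ← tsum_mul_left, ← tsum_mul_left,
    (h0.mul_left (μ ^ 2)).tsum_eq_zero_add, add_assoc,
    ← ((summable_nat_add_iff 1).2 (h0.mul_left (μ ^ 2))).tsum_add (h0.mul_left _)]
  congr 1
  · simp [bterm]; ring
  · congr 1; ext k
    have h := bak_den hμ k
    have hk : (0 : ℝ) ≤ k := Nat.cast_nonneg k
    have e : bak μ m (k + 1) * ((μ + 2 * (k + 1)) ^ 2 - μ ^ 2) = m ^ 2 * bak μ m k := by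
      rw [bak]; field_simp [show (μ + 2 * ((k : ℝ) + 1)) ^ 2 - μ ^ 2 ≠ 0 by linarith]
    have e2 : exp ((μ + 2 * (k + 1)) * s) = exp (2 * s) * exp ((μ + 2 * k) * s) := by
      rw [← Real.exp_add]; congr 1; ring
    simp only [bterm, pow_zero, mul_one]
    push_cast
    rw [e2]
    linear_combination (exp (2 * s) * exp ((μ + 2 * k) * s)) * e

lemma bsol_lower {μ : ℝ} (hμ : 0 ≤ μ) (m : ℝ) (s : ℝ) :
    exp (μ * s) ≤ bsol μ m 0 s := by
  have := (bterm_summable hμ m 0 s).le_tsum 0 (fun k _ => bterm_nonneg hμ m 0 k s)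
  simpa [bterm, bak, bsol] using this

/-- existence of the growing homogeneous solution -/
lemma exists_phi (μ m ℓ : ℝ) (hμ : 2 ≤ μ ∨ (μ = 0 ∧ 4 ≤ m * exp ℓ)) :
    ∃ φ φ₁ : ℝ → ℝ, (∀ s, HasDerivAt φ (φ₁ s) s) ∧
      (∀ s, HasDerivAt φ₁ ((μ ^ 2 + m ^ 2 * exp (2 * s)) * φ s) s) ∧
      (∀ s, 0 < φ s) ∧ (∀ s, 0 ≤ φ₁ s) ∧ φ ℓ ≤ φ₁ ℓ ∧ Tendsto φ₁ atBot (𝓝 0) := by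
  have hμ0 : 0 ≤ μ := by rcases hμ with h | ⟨h, _⟩ <;> linarith
  refine ⟨bsol μ m 0, bsol μ m 1, bsol_hasDerivAt hμ0 m 0, fun s => ?_, fun s => ?_, fun s => ?_,
    ?_, ?_⟩
  · rw [← bsol_ode hμ0]; exact bsol_hasDerivAt hμ0 m 1 s
  · exact (exp_pos _).trans_le (bsol_lower hμ0 m s)
  · exact tsum_nonneg (fun k => bterm_nonneg hμ0 m 1 k s)
  · rcases hμ with h | ⟨h, h'⟩
    · refine (bterm_summable hμ0 m 0 ℓ).tsum_le_tsum (fun k => ?_) (bterm_summable hμ0 m 1 ℓ)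
      have := bak_nonneg hμ0 m k
      have hk : (0 : ℝ) ≤ k := Nat.cast_nonneg k
      simp only [bterm]
      gcongr
      linarith
      norm_num
    · have h1 : 5 ≤ bsol μ m 0 ℓ := by
        have := (bterm_summable hμ0 m 0 ℓ).sum_le_tsum (Finset.range 2)
          (fun k _ => bterm_nonneg hμ0 m 0 k ℓ)
        refine le_trans ?_ this
        rw [Finset.sum_range_succ, Finset.sum_range_one]
        subst h
        simp [bterm, bak]
        have e : exp (2 * ℓ) = exp ℓ ^ 2 := by rw [← Real.exp_nat_mul]; simp
        rw [e]
        nlinarith [exp_pos ℓ]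
      have h2 : 2 * (bsol μ m 0 ℓ - 1) ≤ bsol μ m 1 ℓ := by
        unfold bsol
        rw [(bterm_summable hμ0 m 0 ℓ).tsum_eq_zero_add, (bterm_summable hμ0 m 1 ℓ).tsum_eq_zero_add]
        subst h
        have e0 : bterm 0 m 0 0 ℓ = 1 := by simp [bterm, bak]
        have e1 : bterm 0 m 1 0 ℓ = 0 := by simp [bterm, bak]
        rw [e0, e1, add_sub_cancel_left, zero_add, ← tsum_mul_left]
        refine Summable.tsum_le_tsum (fun k => ?_)
          (((summable_nat_add_iff 1).2 (bterm_summable hμ0 m 0 ℓ)).mul_left _)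
          ((summable_nat_add_iff 1).2 (bterm_summable hμ0 m 1 ℓ))
        have := bak_nonneg hμ0 m (k + 1)
        have hk : (0 : ℝ) ≤ k := Nat.cast_nonneg k
        simp only [bterm, pow_zero, mul_one, pow_one, zero_add]
        rw [mul_comm (2 : ℝ), mul_right_comm]
        gcongr
        push_cast; linarith
      linarith
  · have hb : ∀ s ≤ 0, bsol μ m 1 s ≤ exp (2 * s) * bsol μ m 1 0 := by
      intro s hs
      unfold bsol
      rw [← tsum_mul_left]
      refine (bterm_summable hμ0 m 1 s).tsum_le_tsum (fun k => ?_) ((bterm_summable hμ0 m 1 0).mul_left _)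
      have hb := bak_nonneg hμ0 m k
      have hk : (0 : ℝ) ≤ k := Nat.cast_nonneg k
      have hx : μ + 2 * k = 0 ∨ 2 ≤ μ + 2 * k := by
        rcases hμ with h | ⟨h, _⟩
        · right; linarith
        · subst h
          rcases Nat.eq_zero_or_pos k with h | h
          · left; simp [h]
          · right
            have : (1 : ℝ) ≤ k := by exact_mod_cast h
            linarith
      simp only [bterm, pow_one, mul_zero, exp_zero, mul_one]
      rcases hx with h | h
      · simp [h]
      · have : exp ((μ + 2 * k) * s) ≤ exp (2 * s) := by
          apply exp_le_exp.2; nlinarith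
        have hp : 0 ≤ bak μ m k * (μ + 2 * k) := by positivity
        nlinarith
    have ht : Tendsto (fun s => exp (2 * s) * bsol μ m 1 0) atBot (𝓝 0) := by
      have : Tendsto (fun s : ℝ => exp (2 * s)) atBot (𝓝 0) :=
        Real.tendsto_exp_atBot.comp (tendsto_id.const_mul_atBot (by norm_num : (0:ℝ) < 2))
      simpa using this.mul_const (bsol μ m 1 0)
    refine tendsto_of_tendsto_of_tendsto_of_le_of_le' tendsto_const_nhds ht
      (Eventually.of_forall fun s => tsum_nonneg (fun k => bterm_nonneg hμ0 m 1 k s)) ?_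
    filter_upwards [eventually_le_atBot 0] with s hs using hb s hs



/-- existence of the second homogeneous solution -/
lemma exists_psi (q φ φ₁ : ℝ → ℝ) (ℓ : ℝ) (hq : ∀ s, 0 ≤ q s)
    (h1 : ∀ s, HasDerivAt φ (φ₁ s) s) (h2 : ∀ s, HasDerivAt φ₁ (q s * φ s) s)
    (hpos : ∀ s, 0 < φ s) (hℓ : φ ℓ ≤ φ₁ ℓ) :
    ∃ ψ ψ₁ : ℝ → ℝ, (∀ s, HasDerivAt ψ (ψ₁ s) s) ∧ (∀ s, HasDerivAt ψ₁ (q s * ψ s) s) ∧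
      ψ₁ ℓ = 0 ∧ (∀ s, φ₁ s * ψ s - φ s * ψ₁ s = 1) ∧ (∀ s ≤ ℓ, 0 < ψ s) ∧ φ ℓ * ψ ℓ ≤ 1 ∧
      (∀ s ≤ ℓ, ψ₁ s ≤ 0) := by
  have hφc : Continuous φ := continuous_iff_continuousAt.2 fun s => (h1 s).continuousAt
  have hic : Continuous fun s => (φ s ^ 2)⁻¹ :=
    (hφc.pow 2).inv₀ fun s => pow_ne_zero 2 (hpos s).ne'
  have hℓ1 : 0 < φ₁ ℓ := (hpos ℓ).trans_le hℓ
  set C : ℝ := (φ ℓ * φ₁ ℓ)⁻¹ with hC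
  set J : ℝ → ℝ := fun s => C - ∫ t in ℓ..s, (φ t ^ 2)⁻¹ with hJ
  have hJd : ∀ s, HasDerivAt J (-(φ s ^ 2)⁻¹) s := fun s => by
    have := (hic.integral_hasStrictDerivAt ℓ s).hasDerivAt
    simpa using this.const_sub C
  have hψ : ∀ s, HasDerivAt (fun s => φ s * J s) (φ₁ s * J s - (φ s)⁻¹) s := fun s => by
    convert! (h1 s).mul (hJd s) using 1
    have := (hpos s).ne'
    field_simp; ring
  have hψ1 : ∀ s, HasDerivAt (fun s => φ₁ s * J s - (φ s)⁻¹) (q s * (φ s * J s)) s := fun s => by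
    convert! ((h2 s).mul (hJd s)).sub ((h1 s).inv (hpos s).ne') using 1
    have := (hpos s).ne'
    field_simp; ring
  have hJℓ : J ℓ = C := by simp [hJ]
  have hψℓ : φ₁ ℓ * J ℓ - (φ ℓ)⁻¹ = 0 := by
    rw [hJℓ, hC]
    have := (hpos ℓ).ne'
    field_simp; ring
  have hCpos : 0 < C := by have := hpos ℓ; positivity
  have hJpos : ∀ s ≤ ℓ, 0 < J s := fun s hs => by
    have : 0 ≤ ∫ t in s..ℓ, (φ t ^ 2)⁻¹ :=
      intervalIntegral.integral_nonneg hs fun t _ => by positivity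
    simp only [hJ]
    rw [intervalIntegral.integral_symm]
    linarith
  have hψpos : ∀ s ≤ ℓ, 0 < φ s * J s := fun s hs => mul_pos (hpos s) (hJpos s hs)
  refine ⟨fun s => φ s * J s, fun s => φ₁ s * J s - (φ s)⁻¹, hψ, hψ1, hψℓ, fun s => ?_, hψpos, ?_, ?_⟩
  · have := (hpos s).ne'
    field_simp; ring
  · show φ ℓ * (φ ℓ * J ℓ) ≤ 1
    rw [hJℓ, hC]
    have := (hpos ℓ)
    rw [mul_inv, ← mul_assoc, ← mul_assoc, mul_assoc (φ ℓ), mul_inv_cancel₀ this.ne', mul_one,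
      ← div_eq_mul_inv]
    exact (div_le_one hℓ1).2 hℓ
  · intro s hs
    have hm : MonotoneOn (fun s => φ₁ s * J s - (φ s)⁻¹) (Iic ℓ) := by
      apply monotoneOn_of_deriv_nonneg (convex_Iic ℓ)
      · exact fun x _ => (hψ1 x).continuousAt.continuousWithinAt
      · exact fun x _ => (hψ1 x).differentiableAt.differentiableWithinAt
      · intro x hx
        rw [interior_Iic] at hx
        rw [(hψ1 x).deriv]
        exact mul_nonneg (hq x) (hψpos x (le_of_lt hx)).le
    have := hm (show s ∈ Iic ℓ from hs) (show ℓ ∈ Iic ℓ from mem_Iic.2 le_rfl) hs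
    simp only at this
    linarith

lemma psi_ratio (q ψ ψ₁ : ℝ → ℝ) (ℓ s₁ : ℝ) (hq : ∀ s, 0 ≤ q s) (hqm : Monotone q)
    (h1 : ∀ s, HasDerivAt ψ (ψ₁ s) s) (h2 : ∀ s, HasDerivAt ψ₁ (q s * ψ s) s)
    (hpos : ∀ s ≤ ℓ, 0 < ψ s) (hneg : ∀ s ≤ ℓ, ψ₁ s ≤ 0) (s : ℝ) (hs : s₁ + 1 ≤ s) (hsℓ : s ≤ ℓ) :
    ψ s * (1 + q s₁ / 2) ≤ ψ s₁ := by
  have hanti : AntitoneOn ψ (Iic ℓ) := by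
    apply antitoneOn_of_deriv_nonpos (convex_Iic ℓ)
    · exact fun x _ => (h1 x).continuousAt.continuousWithinAt
    · exact fun x _ => (h1 x).differentiableAt.differentiableWithinAt
    · intro x hx
      rw [interior_Iic] at hx
      rw [(h1 x).deriv]; exact hneg x (le_of_lt hx)
  set c := s₁ + 1 with hc
  have hcℓ : c ≤ ℓ := hs.trans hsℓ
  have hsc : ψ s ≤ ψ c := hanti (show c ∈ Iic ℓ from hcℓ) hsℓ hs
  set h' : ℝ → ℝ := fun t => ψ₁ t + ψ c * q s₁ * (c - t)
  have hh' : ∀ t, HasDerivAt h' (q t * ψ t - ψ c * q s₁) t := fun t => by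
    have := (h2 t).add (((hasDerivAt_id t).const_sub c).const_mul (ψ c * q s₁))
    convert! this using 1; ring
  have hm : MonotoneOn h' (Icc s₁ c) := by
    apply monotoneOn_of_deriv_nonneg (convex_Icc _ _)
    · exact fun x _ => (hh' x).continuousAt.continuousWithinAt
    · exact fun x _ => (hh' x).differentiableAt.differentiableWithinAt
    · intro x hx
      rw [interior_Icc] at hx
      rw [(hh' x).deriv]
      have e1 : q s₁ ≤ q x := hqm hx.1.le
      have e2 : ψ c ≤ ψ x := hanti (show x ∈ Iic ℓ from hx.2.le.trans hcℓ) hcℓ hx.2.le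
      have := hpos c hcℓ
      have := mul_le_mul e1 e2 this.le (hq x)
      linarith
  set h : ℝ → ℝ := fun t => ψ t - ψ c * q s₁ * ((c - t) ^ 2 / 2)
  have hh : ∀ t, HasDerivAt h (h' t) t := fun t => by
    have := (h1 t).sub (((((hasDerivAt_id t).const_sub c).pow 2).div_const 2).const_mul (ψ c * q s₁))
    convert! this using 1
    simp [h']; ring
  have ha : AntitoneOn h (Icc s₁ c) := by
    apply antitoneOn_of_deriv_nonpos (convex_Icc _ _)
    · exact fun x _ => (hh x).continuousAt.continuousWithinAt
    · exact fun x _ => (hh x).differentiableAt.differentiableWithinAt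
    · intro x hx
      rw [interior_Icc] at hx
      rw [(hh x).deriv]
      have := hm ⟨hx.1.le, hx.2.le⟩ (right_mem_Icc.2 (by linarith)) hx.2.le
      have e : h' c = ψ₁ c := by simp [h']
      have := hneg c hcℓ
      linarith
  have := ha (left_mem_Icc.2 (by linarith)) (right_mem_Icc.2 (by linarith)) (show s₁ ≤ c by linarith)
  have e1 : h c = ψ c := by simp [h]
  have e2 : h s₁ = ψ s₁ - ψ c * (q s₁ / 2) := by simp [h, hc]; ring
  have := mul_le_mul_of_nonneg_right hsc (show 0 ≤ 1 + q s₁ / 2 by linarith [hq s₁])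
  nlinarith

/-- integrate a differential inequality -/
lemma wronsk_le (q χ χ₁ K K₁ K₂ F : ℝ → ℝ) (a b : ℝ) (hab : a ≤ b) (hF : Continuous F)
    (h1 : ∀ s, HasDerivAt χ (χ₁ s) s) (h2 : ∀ s, HasDerivAt χ₁ (q s * χ s) s)
    (k1 : ∀ s, HasDerivAt K (K₁ s) s) (k2 : ∀ s, HasDerivAt K₁ (K₂ s) s)
    (hχ : ∀ s ∈ Icc a b, 0 ≤ χ s) (hK : ∀ s ∈ Icc a b, F s ≤ q s * K s - K₂ s) :
    ∫ t in a..b, χ t * F t ≤ (χ₁ b * K b - χ b * K₁ b) - (χ₁ a * K a - χ a * K₁ a) := by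
  have hχc : Continuous χ := continuous_iff_continuousAt.2 fun s => (h1 s).continuousAt
  set P : ℝ → ℝ := fun s => (χ₁ s * K s - χ s * K₁ s) - ∫ t in a..s, χ t * F t
  have hP : ∀ s, HasDerivAt P ((q s * χ s * K s - χ s * K₂ s) - χ s * F s) s := fun s => by
    have := (((h2 s).mul (k1 s)).sub ((h1 s).mul (k2 s))).sub
      (((hχc.mul hF).integral_hasStrictDerivAt a s).hasDerivAt)
    convert! this using 1
    simp; ring
  have hm : MonotoneOn P (Icc a b) := by
    apply monotoneOn_of_deriv_nonneg (convex_Icc _ _)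
    · exact fun x _ => (hP x).continuousAt.continuousWithinAt
    · exact fun x _ => (hP x).differentiableAt.differentiableWithinAt
    · intro x hx
      rw [interior_Icc] at hx
      have hx' : x ∈ Icc a b := ⟨hx.1.le, hx.2.le⟩
      rw [(hP x).deriv]
      have := mul_le_mul_of_nonneg_left (hK x hx') (hχ x hx')
      nlinarith
  have := hm (left_mem_Icc.2 hab) (right_mem_Icc.2 hab) hab
  simp only [P, intervalIntegral.integral_same] at this
  linarith

lemma exp_integrableOn_Iic {a : ℝ} (ha : 0 < a) (c : ℝ) :
    IntegrableOn (fun s : ℝ => exp (a * s)) (Iic c) := by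
  have := integrableOn_exp_mul_Iic ha c
  simpa using this

lemma integrableOn_of_exp_bound {E : Type*} [NormedAddCommGroup E] {F : ℝ → E} (hF : Continuous F)
    {a N ℓ : ℝ} (ha : 0 < a) (hb : ∀ s ≤ ℓ, ‖F s‖ ≤ N * exp (a * s)) (s : ℝ) :
    IntegrableOn F (Iic s) := by
  have h1 : IntegrableOn F (Iic ℓ) := by
    refine Integrable.mono' ((exp_integrableOn_Iic ha ℓ).const_mul N) hF.aestronglyMeasurable ?_
    filter_upwards [ae_restrict_mem measurableSet_Iic] with t ht using hb t ht
  rcases le_total s ℓ with h | h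
  · exact h1.mono_set (Iic_subset_Iic.2 h)
  · rw [← Iic_union_Icc_eq_Iic h]
    exact h1.union hF.continuousOn.integrableOn_Icc

lemma hasDerivAt_integral_Iic {E : Type*} [NormedAddCommGroup E] [NormedSpace ℝ E]
    [CompleteSpace E] {F : ℝ → E} (hF : Continuous F)
    (hi : ∀ s, IntegrableOn F (Iic s)) (s : ℝ) :
    HasDerivAt (fun s => ∫ t in Iic s, F t) (F s) s := by
  have h : (fun s => ∫ t in Iic s, F t) = fun s => (∫ t in Iic (0:ℝ), F t) + ∫ t in (0:ℝ)..s, F t := by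
    ext x
    rw [intervalIntegral.integral_Iic_sub_Iic (hi 0) (hi x) |>.symm]; abel
  rw [h]
  exact ((hF.integral_hasStrictDerivAt 0 s).hasDerivAt).const_add _

lemma green (q φ φ₁ : ℝ → ℝ) (ℓ δ N : ℝ) (hδ : 0 < δ) (hq : ∀ s, 0 < q s) (hqm : Monotone q)
    (h1 : ∀ s, HasDerivAt φ (φ₁ s) s) (h2 : ∀ s, HasDerivAt φ₁ (q s * φ s) s)
    (hpos : ∀ s, 0 < φ s) (hpos1 : ∀ s, 0 ≤ φ₁ s) (hℓ : φ ℓ ≤ φ₁ ℓ) (hlim : Tendsto φ₁ atBot (𝓝 0))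
    (F : ℝ → ℂ) (hF : Continuous F) (hFb : ∀ s ≤ ℓ, ‖F s‖ ≤ N * exp (δ * s)) :
    ∃ (v v₁ : ℝ → ℂ) (G : ℝ → ℝ), (∀ s, HasDerivAt v (v₁ s) s) ∧
      (∀ s, HasDerivAt v₁ ((q s : ℂ) * v s + F s) s) ∧ v₁ ℓ = 0 ∧
      (∀ s ≤ ℓ, ‖v s‖ ≤ G s) ∧
      (∀ K K₁ K₂ : ℝ → ℝ, (∀ s, HasDerivAt K (K₁ s) s) → (∀ s, HasDerivAt K₁ (K₂ s) s) →
        (∀ s ≤ ℓ, ‖F s‖ ≤ q s * K s - K₂ s) → (∃ B, ∀ s ≤ ℓ, |K s| ≤ B) → Tendsto K₁ atBot (𝓝 0) →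
        ∀ s ≤ ℓ, G s ≤ K s + max (-K₁ ℓ) 0) ∧
      (∀ s₁ N₂ : ℝ, (∀ s ∈ Icc s₁ ℓ, ‖F s‖ ≤ N₂) → ∀ s, s₁ + 1 ≤ s → s ≤ ℓ →
        ‖v s‖ ≤ G s₁ / (1 + q s₁ / 2) + N₂ / q s₁) := by
  obtain ⟨ψ, ψ₁, p1, p2, pℓ, hW, ppos, pφ, pneg⟩ := exists_psi q φ φ₁ ℓ (fun s => (hq s).le) h1 h2 hpos hℓ
  have hφc : Continuous φ := continuous_iff_continuousAt.2 fun s => (h1 s).continuousAt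
  have hψc : Continuous ψ := continuous_iff_continuousAt.2 fun s => (p1 s).continuousAt
  have hφm : Monotone φ := monotone_of_hasDerivAt_nonneg h1 (fun x => hpos1 x)
  have hFn : Continuous fun s => ‖F s‖ := hF.norm
  have hφFc : Continuous fun s => (φ s : ℂ) * F s := by fun_prop
  have hψFc : Continuous fun s => (ψ s : ℂ) * F s := by fun_prop
  have hN : 0 ≤ N := by
    have := (norm_nonneg _).trans (hFb ℓ le_rfl)
    exact nonneg_of_mul_nonneg_left this (exp_pos _)
  have hInt : ∀ s, IntegrableOn (fun s => (φ s : ℂ) * F s) (Iic s) := by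
    refine integrableOn_of_exp_bound hφFc (N := φ ℓ * N) (ℓ := ℓ) hδ fun s hs => ?_
    rw [norm_mul, Complex.norm_real, Real.norm_of_nonneg (hpos s).le, mul_assoc]
    exact mul_le_mul (hφm hs) (hFb s hs) (norm_nonneg _) (hpos ℓ).le
  have hintn : ∀ s, IntegrableOn (fun s => φ s * ‖F s‖) (Iic s) := by
    refine integrableOn_of_exp_bound (by fun_prop) (N := φ ℓ * N) (ℓ := ℓ) hδ fun s hs => ?_
    rw [norm_mul, norm_norm, Real.norm_of_nonneg (hpos s).le, mul_assoc]
    exact mul_le_mul (hφm hs) (hFb s hs) (norm_nonneg _) (hpos ℓ).le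
  set A : ℝ → ℂ := fun s => ∫ t in Iic s, (φ t : ℂ) * F t with hA
  set D : ℝ → ℂ := fun s => ∫ t in ℓ..s, (ψ t : ℂ) * F t with hD
  have hAd : ∀ s, HasDerivAt A ((φ s : ℂ) * F s) s := hasDerivAt_integral_Iic hφFc hInt
  have hDd : ∀ s, HasDerivAt D ((ψ s : ℂ) * F s) s := fun s =>
    (hψFc.integral_hasStrictDerivAt ℓ s).hasDerivAt
  set An : ℝ → ℝ := fun s => ∫ t in Iic s, φ t * ‖F t‖ with hAn
  set Dn : ℝ → ℝ := fun s => ∫ t in s..ℓ, ψ t * ‖F t‖ with hDn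
  have hA_le : ∀ s, ‖A s‖ ≤ An s := fun s => by
    refine (norm_integral_le_integral_norm _).trans (le_of_eq ?_)
    congr 1; ext t
    rw [norm_mul, Complex.norm_real, Real.norm_of_nonneg (hpos t).le]
  have hD_le : ∀ s ≤ ℓ, ‖D s‖ ≤ Dn s := fun s hs => by
    simp only [hD]
    rw [intervalIntegral.integral_symm, norm_neg]
    refine (intervalIntegral.norm_integral_le_integral_norm hs).trans (le_of_eq ?_)
    apply intervalIntegral.integral_congr
    intro t ht
    rw [uIcc_of_le hs] at ht
    simp only [norm_mul, Complex.norm_real, Real.norm_of_nonneg (ppos t ht.2).le]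
  have hAn0 : ∀ s, 0 ≤ An s := fun s =>
    integral_nonneg fun t => mul_nonneg (hpos t).le (norm_nonneg _)
  have hDn0 : ∀ s ≤ ℓ, 0 ≤ Dn s := fun s hs => 
    intervalIntegral.integral_nonneg hs fun t ht => mul_nonneg (ppos t ht.2).le (norm_nonneg _)
  have hφC : ∀ s, HasDerivAt (fun s => (φ s : ℂ)) (φ₁ s : ℂ) s := fun s => (h1 s).ofReal_comp
  have hphiC : ∀ s, HasDerivAt (fun s => (φ₁ s : ℂ)) ((q s * φ s : ℝ) : ℂ) s := fun s => (h2 s).ofReal_comp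
  have hψC : ∀ s, HasDerivAt (fun s => (ψ s : ℂ)) (ψ₁ s : ℂ) s := fun s => (p1 s).ofReal_comp
  have hpsiC : ∀ s, HasDerivAt (fun s => (ψ₁ s : ℂ)) ((q s * ψ s : ℝ) : ℂ) s := fun s => (p2 s).ofReal_comp
  have hWC : ∀ s, (φ₁ s : ℂ) * ψ s - φ s * ψ₁ s = 1 := fun s => by exact_mod_cast hW s
  -- norm of v
  have hvG : ∀ s ≤ ℓ, ‖-((ψ s : ℂ) * A s) + φ s * D s‖ ≤ ψ s * An s + φ s * Dn s := by
    intro s hs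
    refine (norm_add_le _ _).trans ?_
    rw [norm_neg, norm_mul, norm_mul, Complex.norm_real, Complex.norm_real,
      Real.norm_of_nonneg (hpos s).le, Real.norm_of_nonneg (ppos s hs).le]
    exact add_le_add (mul_le_mul_of_nonneg_left (hA_le s) (ppos s hs).le)
      (mul_le_mul_of_nonneg_left (hD_le s hs) (hpos s).le)
  refine ⟨fun s => -((ψ s : ℂ) * A s) + φ s * D s, fun s => -((ψ₁ s : ℂ) * A s) + φ₁ s * D s,
    fun s => ψ s * An s + φ s * Dn s, fun s => ?_, fun s => ?_, ?_, hvG, ?_, ?_⟩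
  · convert! ((hψC s).mul (hAd s)).neg.add ((hφC s).mul (hDd s)) using 1
    ring
  · convert! ((hpsiC s).mul (hAd s)).neg.add ((hphiC s).mul (hDd s)) using 1
    push_cast
    linear_combination -(F s) * hWC s
  · simp [pℓ, hD]
  · intro K K₁ K₂ k1 k2 hK ⟨B, hB⟩ hK0 s hs
    have e1 : An s ≤ φ₁ s * K s - φ s * K₁ s := by
      have hlimA : Tendsto (fun t => ∫ x in t..s, φ x * ‖F x‖) atBot (𝓝 (An s)) :=
        intervalIntegral_tendsto_integral_Iic s (hintn s) tendsto_id
      have hz : Tendsto (fun t => φ₁ t * K t - φ t * K₁ t) atBot (𝓝 0) := by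
        have z1 : Tendsto (fun t => φ₁ t * K t) atBot (𝓝 0) := by
          refine squeeze_zero_norm' (a := fun t => φ₁ t * B) ?_ (by simpa using hlim.mul_const B)
          filter_upwards [eventually_le_atBot ℓ] with t ht
          rw [norm_mul, Real.norm_of_nonneg (hpos1 t)]
          exact mul_le_mul_of_nonneg_left (hB t ht) (hpos1 t)
        have z2 : Tendsto (fun t => φ t * K₁ t) atBot (𝓝 0) := by
          refine squeeze_zero_norm' (a := fun t => φ ℓ * |K₁ t|) ?_ (by simpa using (hK0.abs).const_mul (φ ℓ))
          filter_upwards [eventually_le_atBot ℓ] with t ht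
          rw [norm_mul, Real.norm_of_nonneg (hpos t).le]
          exact mul_le_mul_of_nonneg_right (hφm ht) (abs_nonneg _)
        simpa using z1.sub z2
      have := (tendsto_const_nhds (x := φ₁ s * K s - φ s * K₁ s)).sub hz
      rw [sub_zero] at this
      refine le_of_tendsto_of_tendsto hlimA this ?_
      filter_upwards [eventually_le_atBot s] with t ht
      exact wronsk_le q φ φ₁ K K₁ K₂ _ t s ht hFn h1 h2 k1 k2 (fun x _ => (hpos x).le)
        (fun x hx => hK x (hx.2.trans hs))
    have e2 : Dn s ≤ (- (ψ ℓ * K₁ ℓ)) - (ψ₁ s * K s - ψ s * K₁ s) := by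
      have := wronsk_le q ψ ψ₁ K K₁ K₂ _ s ℓ hs hFn p1 p2 k1 k2 (fun x hx => (ppos x hx.2).le)
        (fun x hx => hK x hx.2)
      rw [pℓ] at this
      simp only [hDn]; linarith
    have e3 := mul_le_mul_of_nonneg_left e1 (ppos s hs).le
    have e4 := mul_le_mul_of_nonneg_left e2 (hpos s).le
    have e5 : φ s * ψ ℓ * (-K₁ ℓ) ≤ max (-K₁ ℓ) 0 := by
      have a1 : φ s * ψ ℓ ≤ 1 := (mul_le_mul_of_nonneg_right (hφm hs) (ppos ℓ le_rfl).le).trans pφ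
      have a2 : 0 ≤ φ s * ψ ℓ := mul_nonneg (hpos s).le (ppos ℓ le_rfl).le
      calc φ s * ψ ℓ * (-K₁ ℓ) ≤ φ s * ψ ℓ * max (-K₁ ℓ) 0 :=
            mul_le_mul_of_nonneg_left (le_max_left _ _) a2
        _ ≤ 1 * max (-K₁ ℓ) 0 := mul_le_mul_of_nonneg_right a1 (le_max_right _ _)
        _ = _ := one_mul _
    have := hW s
    have e6 : ψ s * (φ₁ s * K s - φ s * K₁ s) + φ s * ((- (ψ ℓ * K₁ ℓ)) - (ψ₁ s * K s - ψ s * K₁ s))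
        = K s + φ s * ψ ℓ * (-K₁ ℓ) := by linear_combination K s * this
    linarith
  · intro s₁ N₂ hN₂ s hs hsℓ
    have hs₁ : s₁ ≤ s := by linarith
    refine (hvG s hsℓ).trans ?_
    have hsplit : An s = An s₁ + ∫ t in s₁..s, φ t * ‖F t‖ := by
      rw [← intervalIntegral.integral_Iic_sub_Iic (hintn s₁) (hintn s)]; simp [hAn]
    have hq1 := hq s₁
    have hN₂0 : 0 ≤ N₂ := (norm_nonneg _).trans (hN₂ s ⟨hs₁, hsℓ⟩)
    have hKK : ∀ x ∈ Icc s₁ ℓ, ‖F x‖ ≤ q x * (N₂ / q s₁) - 0 := fun x hx => by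
      refine (hN₂ x hx).trans ?_
      rw [sub_zero, ← mul_div_assoc, le_div_iff₀ hq1, mul_comm]
      exact mul_le_mul_of_nonneg_right (hqm hx.1) hN₂0
    have e1 : ∫ t in s₁..s, φ t * ‖F t‖ ≤ φ₁ s * (N₂ / q s₁) := by
      have := wronsk_le q φ φ₁ (fun _ => N₂ / q s₁) (fun _ => 0) (fun _ => 0) _ s₁ s hs₁ hFn h1 h2
        (fun x => hasDerivAt_const _ _) (fun x => hasDerivAt_const _ _) (fun x _ => (hpos x).le)
        (fun x hx => hKK x ⟨hx.1, hx.2.trans hsℓ⟩)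
      have h0 := mul_nonneg (hpos1 s₁) (div_nonneg hN₂0 hq1.le)
      simp only [mul_zero, sub_zero] at this
      linarith
    have e2 : Dn s ≤ - ψ₁ s * (N₂ / q s₁) := by
      have := wronsk_le q ψ ψ₁ (fun _ => N₂ / q s₁) (fun _ => 0) (fun _ => 0) _ s ℓ hsℓ hFn p1 p2
        (fun x => hasDerivAt_const _ _) (fun x => hasDerivAt_const _ _) (fun x hx => (ppos x hx.2).le)
        (fun x hx => hKK x ⟨hs₁.trans hx.1, hx.2⟩)
      simp only [mul_zero, sub_zero, pℓ, zero_mul] at this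
      simp only [hDn]; linarith
    have e3 : ψ s * An s₁ ≤ (ψ s₁ * An s₁ + φ s₁ * Dn s₁) / (1 + q s₁ / 2) := by
      rw [le_div_iff₀ (by linarith)]
      have r := psi_ratio q ψ ψ₁ ℓ s₁ (fun s => (hq s).le) hqm p1 p2 ppos pneg s hs hsℓ
      have r2 := mul_le_mul_of_nonneg_right r (hAn0 s₁)
      have r3 := mul_nonneg (hpos s₁).le (hDn0 s₁ (hs₁.trans hsℓ))
      nlinarith
    have e4 := mul_le_mul_of_nonneg_left e1 (ppos s hsℓ).le
    have e5 := mul_le_mul_of_nonneg_left e2 (hpos s).le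
    have e6 : ψ s * (φ₁ s * (N₂ / q s₁)) + φ s * (-ψ₁ s * (N₂ / q s₁)) = N₂ / q s₁ := by
      linear_combination (N₂ / q s₁) * hW s
    rw [hsplit, mul_add]
    linarith



/-- one-dimensional summable weight -/
def wm (a : ℝ) (m : ℤ) : ℝ := |(m : ℝ)| ^ (-a) + if m = 0 then 1 else 0

/-- two-dimensional summable weight -/
def wt (a : ℝ) (j m : ℤ) : ℝ := (1 + (j : ℝ) ^ 2)⁻¹ * wm a m

lemma wm_nonneg (a : ℝ) (m : ℤ) : 0 ≤ wm a m := by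
  unfold wm; positivity

lemma wt_nonneg (a : ℝ) (j m : ℤ) : 0 ≤ wt a j m := by
  unfold wt; have := wm_nonneg a m; positivity

lemma summable_inv_one_add_sq : Summable fun j : ℤ => (1 + (j : ℝ) ^ 2)⁻¹ := by
  have h : Summable fun j : ℤ => wm 2 j := by
    apply Summable.add (Real.summable_abs_int_rpow (by norm_num))
    exact summable_of_hasFiniteSupport ((Set.finite_singleton (0:ℤ)).subset (by
      intro x hx; by_contra h; simp at h; simp [h] at hx))
  refine Summable.of_nonneg_of_le (fun j => by positivity) (fun j => ?_) h
  unfold wm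
  by_cases hj : j = 0
  · subst hj; simp
  · have h0 : 0 < |(j : ℝ)| := by positivity
    rw [if_neg hj, add_zero, rpow_neg h0.le, Real.rpow_two, sq_abs]
    gcongr
    linarith

lemma summable_wm {a : ℝ} (ha : 1 < a) : Summable (wm a) := by
  apply Summable.add (Real.summable_abs_int_rpow ha)
  exact summable_of_hasFiniteSupport ((Set.finite_singleton (0:ℤ)).subset (by
      intro x hx; by_contra h; simp at h; simp [h] at hx))

lemma summable_wt {a : ℝ} (ha : 1 < a) : Summable fun n : ℤ × ℤ => wt a n.1 n.2 :=
  summable_inv_one_add_sq.mul_of_nonneg (summable_wm ha) (fun j => by positivity) (wm_nonneg a)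

lemma inv_le_wm {a : ℝ} (ha : a < 2) (m : ℤ) : (1 + (m : ℝ) ^ 2)⁻¹ ≤ wm a m := by
  unfold wm
  by_cases hj : m = 0
  · subst hj; simp; positivity
  · have h1 : 1 ≤ |(m : ℝ)| := by exact_mod_cast Int.one_le_abs hj
    rw [if_neg hj, add_zero, rpow_neg (by linarith)]
    gcongr
    calc |(m : ℝ)| ^ a ≤ |(m : ℝ)| ^ (2 : ℝ) := rpow_le_rpow_of_exponent_le h1 ha.le
      _ = (m : ℝ) ^ 2 := by rw [Real.rpow_two, sq_abs]
      _ ≤ _ := by linarith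

lemma landau {v v₁ v₂ : ℝ → ℂ} (h1 : ∀ s, HasDerivAt v (v₁ s) s) (h2 : ∀ s, HasDerivAt v₁ (v₂ s) s)
    {s h A B : ℝ} (hh : 0 < h) (hA1 : ‖v s‖ ≤ A) (hA2 : ‖v (s - h)‖ ≤ A)
    (hB : ∀ t ∈ Icc (s - h) s, ‖v₂ t‖ ≤ B) : ‖v₁ s‖ ≤ 2 * A / h + h * B := by
  have hs : s ∈ Icc (s - h) s := ⟨by linarith, le_rfl⟩
  have hs' : s - h ∈ Icc (s - h) s := ⟨le_rfl, by linarith⟩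
  have e1 : ∀ t ∈ Icc (s - h) s, ‖v₁ t - v₁ s‖ ≤ B * h := fun t ht => by
    have := (convex_Icc (s - h) s).norm_image_sub_le_of_norm_hasDerivWithin_le (f := v₁)
      (fun x _ => (h2 x).hasDerivWithinAt) hB hs ht
    refine this.trans ?_
    have hB0 : 0 ≤ B := (norm_nonneg _).trans (hB s hs)
    apply mul_le_mul_of_nonneg_left _ hB0
    rw [Real.norm_eq_abs, abs_le]; constructor <;> linarith [ht.1, ht.2]
  have e2 := (convex_Icc (s - h) s).norm_image_sub_le_of_norm_hasDerivWithin_le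
      (f := fun t : ℝ => v t - (t : ℂ) * v₁ s)
      (fun x _ => ((h1 x).sub ((((hasDerivAt_id x).ofReal_comp).mul_const (v₁ s)))).hasDerivWithinAt)
      (C := B * h) (fun t ht => by simpa using e1 t ht) hs hs'
  have e3 : (h : ℂ) * v₁ s = (v s - v (s - h)) + ((v (s - h) - ((s - h : ℝ) : ℂ) * v₁ s) - (v s - (s : ℂ) * v₁ s)) := by
    push_cast; ring
  have e4 : ‖(h : ℂ) * v₁ s‖ ≤ 2 * A + B * h * h := by
    rw [e3]
    refine (norm_add_le _ _).trans (add_le_add ((norm_sub_le _ _).trans (by linarith)) (e2.trans ?_))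
    have hB0 : 0 ≤ B := (norm_nonneg _).trans (hB s hs)
    apply mul_le_mul_of_nonneg_left _ (by positivity)
    rw [Real.norm_eq_abs, abs_le]; constructor <;> linarith
  rw [norm_mul, Complex.norm_real, Real.norm_of_nonneg hh.le] at e4
  rw [show 2 * A / h + h * B = (2 * A + B * h * h) / h by field_simp, le_div_iff₀ hh]
  linarith

lemma exists_lim {v v₁ v₂ : ℝ → ℂ} (h1 : ∀ s, HasDerivAt v (v₁ s) s)
    (h2 : ∀ s, HasDerivAt v₁ (v₂ s) s) (hc : Continuous v₂) {ℓ A B c : ℝ} (hc0 : 0 < c)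
    (hA : ∀ s ≤ ℓ, ‖v s‖ ≤ A) (hB : ∀ s ≤ ℓ, ‖v₂ s‖ ≤ B * exp (c * s)) :
    ∃ l, Tendsto v atBot (𝓝 l) := by
  have i1 := integrableOn_of_exp_bound hc hc0 hB
  set P : ℝ → ℂ := fun s => ∫ t in Iic s, v₂ t with hP
  have P1 : ∀ s, HasDerivAt P (v₂ s) s := hasDerivAt_integral_Iic hc i1
  have Pb : ∀ s ≤ ℓ, ‖P s‖ ≤ B / c * exp (c * s) := fun s hs => by
    have e0 : ∫ t in Iic s, B * exp (c * t) = B / c * exp (c * s) := by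
      rw [MeasureTheory.integral_const_mul, integral_exp_mul_Iic hc0]; ring
    rw [← e0]
    refine norm_integral_le_of_norm_le ((exp_integrableOn_Iic hc0 s).const_mul B) ?_
    filter_upwards [ae_restrict_mem measurableSet_Iic] with t ht using hB t (le_trans ht hs)
  have Pc : Continuous P := continuous_iff_continuousAt.2 fun s => (P1 s).continuousAt
  have i2 := integrableOn_of_exp_bound Pc hc0 Pb
  set R : ℝ → ℂ := fun s => ∫ t in Iic s, P t with hR
  have R1 : ∀ s, HasDerivAt R (P s) s := hasDerivAt_integral_Iic Pc i2
  have Rb : ∀ s ≤ ℓ, ‖R s‖ ≤ B / c / c * exp (c * s) := fun s hs => by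
    have e0 : ∫ t in Iic s, B / c * exp (c * t) = B / c / c * exp (c * s) := by
      rw [MeasureTheory.integral_const_mul, integral_exp_mul_Iic hc0]; ring
    rw [← e0]
    refine norm_integral_le_of_norm_le ((exp_integrableOn_Iic hc0 s).const_mul (B / c)) ?_
    filter_upwards [ae_restrict_mem measurableSet_Iic] with t ht using Pb t (le_trans ht hs)
  have hexp : Tendsto (fun s => exp (c * s)) atBot (𝓝 0) :=
    tendsto_exp_atBot.comp (tendsto_id.const_mul_atBot hc0)
  have Rlim : Tendsto R atBot (𝓝 0) := by
    refine squeeze_zero_norm' (a := fun s => B / c / c * exp (c * s)) ?_ (by simpa using hexp.const_mul (B/c/c))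
    filter_upwards [eventually_le_atBot ℓ] with s hs using Rb s hs
  set d : ℂ := v₁ 0 - P 0 with hd
  have k1 : ∀ s, v₁ s = P s + d := fun s => by
    have hD : ∀ x : ℝ, HasDerivAt (fun s : ℝ => v₁ s - P s) 0 x := fun x => by
      convert! (h2 x).sub (P1 x) using 1
      simp
    have := is_const_of_deriv_eq_zero (f := fun s => v₁ s - P s)
      (fun x => (hD x).differentiableAt) (fun x => (hD x).deriv) s 0
    rw [hd, ← this]; ring
  set e : ℂ := v 0 - R 0 with he
  have k2 : ∀ s : ℝ, v s = R s + s * d + e := fun s => by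
    have hD : ∀ x : ℝ, HasDerivAt (fun s : ℝ => v s - R s - s * d) 0 x := fun x => by
      convert! ((h1 x).sub (R1 x)).sub (((hasDerivAt_id x).ofReal_comp).mul_const d) using 1
      rw [k1]; simp
    have := is_const_of_deriv_eq_zero (f := fun s : ℝ => v s - R s - s * d)
      (fun x => (hD x).differentiableAt) (fun x => (hD x).deriv) s 0
    simp only [Complex.ofReal_zero, zero_mul, sub_zero] at this
    rw [he, ← this]; ring
  have hd0 : d = 0 := by
    by_contra hne
    have hn : 0 < ‖d‖ := norm_pos_iff.2 hne
    have t1 : Tendsto (fun s : ℝ => |s| * ‖d‖) atBot atTop := tendsto_abs_atBot_atTop.atTop_mul_const hn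
    have t2 : ∀ᶠ s : ℝ in atBot, ‖R s‖ < 1 := by
      have := Rlim.norm; rw [norm_zero] at this
      exact this.eventually (gt_mem_nhds one_pos)
    obtain ⟨s, hs1, hs2, hs3⟩ := ((t1.eventually (eventually_gt_atTop (A + 1 + ‖e‖))).and
      (t2.and (eventually_le_atBot ℓ))).exists
    have : (s : ℂ) * d = v s - R s - e := by rw [k2]; ring
    have h3 : |s| * ‖d‖ ≤ ‖v s‖ + ‖R s‖ + ‖e‖ := by
      calc |s| * ‖d‖ = ‖(s : ℂ) * d‖ := by rw [norm_mul, Complex.norm_real, Real.norm_eq_abs]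
        _ = _ := by rw [this]
        _ ≤ _ := (norm_sub_le _ _).trans (add_le_add_left (norm_sub_le _ _) _)
    have := hA s hs3
    linarith
  refine ⟨e, ?_⟩
  have : v = fun s => R s + e := by ext s; rw [k2, hd0]; ring
  rw [this]
  simpa using Rlim.add_const e



/-- algebraic inequality for the barrier -/
lemma barrier_alg (a X P : ℝ) (ha : 1 < a) (ha2 : a < 2) (hX : 0 < X) (hP : 0 < P)
    (h1 : P ≤ 1 → X ^ 2 ≤ P) (h2 : 1 ≤ P → X ≤ P) :
    X / (1 + P) ≤ P * 13 + a ^ 2 * (X * (1 - X) / (1 + X) ^ 3) := by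
  have hX1 : 0 < (1 + X) ^ 3 := by positivity
  have hle : X / (1 + P) ≤ X := div_le_self hX.le (by linarith)
  rcases le_total P 1 with h | h
  · have hX2 := h1 h
    have hXle : X ≤ 1 := by nlinarith
    have e1 : X * (1 - X) * (1 - 3 * X) ≤ X * (1 - X) / (1 + X) ^ 3 := by
      rw [le_div_iff₀ hX1]
      have h0 : 0 ≤ X * (1 - X) := mul_nonneg hX.le (by linarith)
      have : (1 - 3 * X) * (1 + X) ^ 3 ≤ 1 := by nlinarith [pow_pos hX 2, pow_pos hX 3, pow_pos hX 4]
      nlinarith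
    have e2 : X * (1 - X) / (1 + X) ^ 3 ≤ a ^ 2 * (X * (1 - X) / (1 + X) ^ 3) := by
      have h0 : 0 ≤ X * (1 - X) / (1 + X) ^ 3 := div_nonneg (mul_nonneg hX.le (by linarith)) hX1.le
      exact le_mul_of_one_le_left h0 (by nlinarith)
    nlinarith [pow_pos hX 2, pow_pos hX 3]
  · have hXP := h2 h
    have e0 : X / (1 + P) ≤ 1 := by rw [div_le_one (by linarith)]; linarith
    have e1 : -1 ≤ X * (1 - X) / (1 + X) ^ 3 := by
      rw [le_div_iff₀ hX1]; nlinarith [pow_pos hX 2, pow_pos hX 3]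
    have : -4 ≤ a ^ 2 * (X * (1 - X) / (1 + X) ^ 3) := by
      have : a ^ 2 ≤ 4 := by nlinarith
      nlinarith [sq_nonneg a]
    nlinarith

/-- derivative computations for the barrier `g = 13 + 1/(1+X)`, `X = c e^{as}` -/
lemma barrier_deriv (a c : ℝ) (hc : 0 < c) :
    let X : ℝ → ℝ := fun s => c * exp (a * s)
    (∀ s, HasDerivAt (fun s => 13 + (1 + X s)⁻¹) (-(a * X s / (1 + X s) ^ 2)) s) ∧
    (∀ s, HasDerivAt (fun s => -(a * X s / (1 + X s) ^ 2))
      (-(a ^ 2 * (X s * (1 - X s) / (1 + X s) ^ 3))) s) := by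
  intro X
  have hX : ∀ s, 0 < X s := fun s => by positivity
  have hXd : ∀ s, HasDerivAt X (a * X s) s := fun s => by
    have := (((hasDerivAt_id s).const_mul a).exp).const_mul c
    convert! this using 1
    simp [X]; ring
  refine ⟨fun s => ?_, fun s => ?_⟩
  · have h := (((hXd s).const_add 1).fun_inv (by have := hX s; positivity)).const_add 13
    convert! h using 1
    ring
  · have h1 := (((hXd s).const_add 1).fun_pow 2)
    have h := (((hXd s).const_mul a).fun_div h1 (by have := hX s; positivity)).fun_neg
    convert! h using 1
    have := hX s
    field_simp
    ring

/-- the frequency function -/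
def qf (κ : ℝ) (j m : ℤ) (s : ℝ) : ℝ := κ ^ 2 * (j : ℝ) ^ 2 + (m : ℝ) ^ 2 * exp (2 * s)

/-- the assumed decay of the coefficients -/
def fb (a δ₀ N : ℝ) (j m : ℤ) (s : ℝ) : ℝ :=
  N * min (exp (a * s)) (exp (δ₀ * s)) / ((1 + (j : ℝ) ^ 2) * (1 + (m : ℝ) ^ 2 * exp (2 * s)))

lemma fb_le (a δ₀ N : ℝ) (hN : 0 ≤ N) (j m : ℤ) (s : ℝ) :
    fb a δ₀ N j m s ≤ N * exp (δ₀ * s) / (1 + (j : ℝ) ^ 2) := by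
  unfold fb
  have h1 : (1 + (j : ℝ) ^ 2) ≤ (1 + (j : ℝ) ^ 2) * (1 + (m : ℝ) ^ 2 * exp (2 * s)) :=
    le_mul_of_one_le_right (by positivity) (by have : 0 ≤ (m : ℝ) ^ 2 * exp (2 * s) := by positivity
                                               linarith)
  gcongr
  exact min_le_right _ _

lemma qf_mono (κ : ℝ) (j m : ℤ) : Monotone (qf κ j m) := by
  intro s t h
  unfold qf; gcongr

/-- supersolution bound on `G` -/
lemma mode_basic (κ a δ₀ ℓ N : ℝ) (hκ : 2 ≤ κ) (ha : 1 < a) (ha2 : a < 2) (hδ : 0 < δ₀) (hδ1 : δ₀ < 1)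
    (hℓ : 4 ≤ exp ℓ) (hN : 0 ≤ N) (j m : ℤ) (hjm : ¬ (j = 0 ∧ m = 0)) (F : ℝ → ℂ) (hF : Continuous F)
    (hFb : ∀ s ≤ ℓ, ‖F s‖ ≤ fb a δ₀ N j m s) :
    ∃ (v v₁ : ℝ → ℂ) (G : ℝ → ℝ), (∀ s, HasDerivAt v (v₁ s) s) ∧
      (∀ s, HasDerivAt v₁ ((qf κ j m s : ℂ) * v s + F s) s) ∧ v₁ ℓ = 0 ∧
      (∀ s ≤ ℓ, ‖v s‖ ≤ G s) ∧
      (∀ s ≤ ℓ, G s ≤ 15 * (N * wt a j m) * (1 + exp (δ₀ * s))) ∧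
      (j ≠ 0 → ∀ s ≤ ℓ, ‖v s‖ ≤ N * exp (δ₀ * s)) ∧
      (∀ s₁ N₂ : ℝ, (∀ s ∈ Icc s₁ ℓ, ‖F s‖ ≤ N₂) → ∀ s, s₁ + 1 ≤ s → s ≤ ℓ →
        ‖v s‖ ≤ G s₁ / (1 + qf κ j m s₁ / 2) + N₂ / qf κ j m s₁) := by
  have hμ : 2 ≤ κ * |(j : ℝ)| ∨ (κ * |(j : ℝ)| = 0 ∧ 4 ≤ |(m : ℝ)| * exp ℓ) := by
    by_cases hj : j = 0
    · right
      have hm : m ≠ 0 := fun h => hjm ⟨hj, h⟩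
      have h1 : 1 ≤ |(m : ℝ)| := by exact_mod_cast Int.one_le_abs hm
      refine ⟨by simp [hj], hℓ.trans (le_mul_of_one_le_left (exp_pos _).le h1)⟩
    · left
      have h1 : 1 ≤ |(j : ℝ)| := by exact_mod_cast Int.one_le_abs hj
      nlinarith
  obtain ⟨φ, φ₁, p1, p2, p3, p4, p5, p6⟩ := exists_phi (κ * |(j : ℝ)|) |(m : ℝ)| ℓ hμ
  have hqe : ∀ s, (κ * |(j : ℝ)|) ^ 2 + |(m : ℝ)| ^ 2 * exp (2 * s) = qf κ j m s := fun s => by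
    unfold qf; rw [mul_pow, sq_abs, sq_abs]
  simp only [hqe] at p2
  have hq : ∀ s, 0 < qf κ j m s := fun s => by
    unfold qf
    by_cases hj : j = 0
    · have hm : m ≠ 0 := fun h => hjm ⟨hj, h⟩
      have : 0 < (m : ℝ) ^ 2 * exp (2 * s) := by positivity
      positivity
    · have : 0 < κ ^ 2 * (j : ℝ) ^ 2 := by positivity
      positivity
  have hFe : ∀ s ≤ ℓ, ‖F s‖ ≤ N * exp (δ₀ * s) := fun s hs =>
    ((hFb s hs).trans (fb_le a δ₀ N hN j m s)).trans (div_le_self (by positivity) (by nlinarith [sq_nonneg (j:ℝ)]))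
  obtain ⟨v, v₁, G, g1, g2, g3, g4, g5, g6⟩ := green (qf κ j m) φ φ₁ ℓ δ₀ N hδ hq (qf_mono κ j m) p1 p2 p3 p4 p5 p6
    F hF hFe
  have hJ : j ≠ 0 → ∀ s ≤ ℓ, G s ≤ N * exp (δ₀ * s) / (1 + (j : ℝ) ^ 2) := by
    intro hj s hs
    have hj1 : (1 : ℝ) ≤ (j : ℝ) ^ 2 := by
      have h1 : 1 ≤ |(j : ℝ)| := by exact_mod_cast Int.one_le_abs hj
      rw [← sq_abs]; nlinarith
    set A := N / (1 + (j : ℝ) ^ 2) with hA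
    have hA0 : 0 ≤ A := by positivity
    have hd : ∀ c s : ℝ, HasDerivAt (fun s => c * exp (δ₀ * s)) (c * δ₀ * exp (δ₀ * s)) s := fun c s => by
      have := (((hasDerivAt_id s).const_mul δ₀).exp).const_mul c
      convert! this using 1
      simp; ring
    have hexp : Tendsto (fun s => exp (δ₀ * s)) atBot (𝓝 0) :=
      tendsto_exp_atBot.comp (tendsto_id.const_mul_atBot hδ)
    have := g5 (fun s => A * exp (δ₀ * s)) (fun s => A * δ₀ * exp (δ₀ * s))
      (fun s => A * δ₀ * δ₀ * exp (δ₀ * s)) (hd A) (hd (A * δ₀)) ?_ ?_ ?_ s hs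
    · have hneg : -(A * δ₀ * exp (δ₀ * ℓ)) ≤ 0 := by
        have : 0 ≤ A * δ₀ * exp (δ₀ * ℓ) := by positivity
        linarith
      rw [max_eq_right hneg, add_zero] at this
      refine this.trans (le_of_eq ?_)
      rw [hA]; ring
    · intro t ht
      refine ((hFb t ht).trans (fb_le a δ₀ N hN j m t)).trans ?_
      have e : N * exp (δ₀ * t) / (1 + (j : ℝ) ^ 2) = A * exp (δ₀ * t) := by rw [hA]; ring
      rw [e]
      have hq4 : 4 ≤ qf κ j m t := by
        unfold qf
        have : 0 ≤ (m : ℝ) ^ 2 * exp (2 * t) := by positivity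
        nlinarith [sq_nonneg κ]
      have hAe : 0 ≤ A * exp (δ₀ * t) := by positivity
      have : δ₀ * δ₀ ≤ 1 := by nlinarith
      have e2 : A * δ₀ * δ₀ * exp (δ₀ * t) = (A * exp (δ₀ * t)) * (δ₀ * δ₀) := by ring
      rw [e2]
      nlinarith
    · refine ⟨A * exp (δ₀ * ℓ), fun t ht => ?_⟩
      rw [abs_of_nonneg (by positivity)]
      gcongr
    · simpa using hexp.const_mul (A * δ₀)
  have hM : m ≠ 0 → ∀ s ≤ ℓ, G s ≤ 15 * (N * wt a j m) := by
    intro hm s hs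
    have hm1 : 1 ≤ |(m : ℝ)| := by exact_mod_cast Int.one_le_abs hm
    have hm0 : 0 < |(m : ℝ)| := by linarith
    set c : ℝ := |(m : ℝ)| ^ a with hc
    have hc0 : 0 < c := by positivity
    obtain ⟨d1, d2⟩ := barrier_deriv a c hc0
    set X : ℝ → ℝ := fun s => c * exp (a * s) with hX
    have hXpos : ∀ s, 0 < X s := fun s => by simp only [hX]; positivity
    have hwt : wt a j m = (1 + (j : ℝ) ^ 2)⁻¹ * c⁻¹ := by
      unfold wt wm; rw [if_neg hm, add_zero, rpow_neg hm0.le]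
    set A := N * wt a j m with hA
    have hA0 : 0 ≤ A := mul_nonneg hN (wt_nonneg _ _ _)
    have hXρ : ∀ s, X s = (|(m : ℝ)| * exp s) ^ a := fun s => by
      simp only [hX, hc]
      rw [mul_rpow hm0.le (exp_pos _).le, ← exp_mul, mul_comm s a]
    have hPρ : ∀ s, (m : ℝ) ^ 2 * exp (2 * s) = (|(m : ℝ)| * exp s) ^ 2 := fun s => by
      rw [mul_pow, sq_abs, ← exp_nat_mul]; norm_num
    have := g5 (fun s => A * (13 + (1 + X s)⁻¹)) (fun s => A * (-(a * X s / (1 + X s) ^ 2)))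
      (fun s => A * (-(a ^ 2 * (X s * (1 - X s) / (1 + X s) ^ 3)))) (fun s => (d1 s).const_mul A)
      (fun s => (d2 s).const_mul A) ?_ ?_ ?_ s hs
    · refine this.trans ?_
      have e1 : (1 + X s)⁻¹ ≤ 1 := inv_le_one_of_one_le₀ (by linarith [hXpos s])
      have e2 : a * X ℓ / (1 + X ℓ) ^ 2 ≤ 1 := by
        have := hXpos ℓ
        rw [div_le_one (by positivity)]; nlinarith [sq_nonneg (X ℓ)]
      have e3 : max (-(A * (-(a * X ℓ / (1 + X ℓ) ^ 2)))) 0 ≤ A := by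
        apply max_le _ hA0
        nlinarith
      nlinarith
    · intro t ht
      refine (hFb t ht).trans ?_
      have e1 : fb a δ₀ N j m t ≤ A * (X t / (1 + (m : ℝ) ^ 2 * exp (2 * t))) := by
        unfold fb
        have : A * (X t / (1 + (m : ℝ) ^ 2 * exp (2 * t))) =
            N * exp (a * t) / ((1 + (j : ℝ) ^ 2) * (1 + (m : ℝ) ^ 2 * exp (2 * t))) := by
          rw [hA, hwt]; simp only [hX]; field_simp
        rw [this]
        gcongr
        exact min_le_left _ _
      refine e1.trans ?_
      have hP : 0 < (m : ℝ) ^ 2 * exp (2 * t) := by positivity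
      have hρ : 0 < |(m : ℝ)| * exp t := by positivity
      have e2 := barrier_alg a (X t) ((m : ℝ) ^ 2 * exp (2 * t)) ha ha2 (hXpos t) hP
        (by
          rw [hPρ, hXρ]; intro h
          have h1 : |(m : ℝ)| * exp t ≤ 1 := by nlinarith
          have : (|(m : ℝ)| * exp t) ^ a ≤ (|(m : ℝ)| * exp t) ^ (1:ℝ) :=
            rpow_le_rpow_of_exponent_ge hρ h1 ha.le
          rw [rpow_one] at this
          gcongr)
        (by
          rw [hPρ, hXρ]; intro h
          have h1 : 1 ≤ |(m : ℝ)| * exp t := by nlinarith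
          have : (|(m : ℝ)| * exp t) ^ a ≤ (|(m : ℝ)| * exp t) ^ (2:ℝ) :=
            rpow_le_rpow_of_exponent_le h1 ha2.le
          rwa [rpow_two] at this)
      have e3 : (m : ℝ) ^ 2 * exp (2 * t) ≤ qf κ j m t := by
        unfold qf; have : 0 ≤ κ ^ 2 * (j : ℝ) ^ 2 := by positivity
        linarith
      have e4 : (m : ℝ) ^ 2 * exp (2 * t) * 13 ≤ qf κ j m t * (13 + (1 + X t)⁻¹) := by
        have h0 : 0 ≤ (1 + X t)⁻¹ := by have := hXpos t; positivity
        have := hq t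
        nlinarith
      have := mul_le_mul_of_nonneg_left (e2.trans (add_le_add_left e4 _)) hA0
      refine this.trans (le_of_eq ?_)
      ring
    · refine ⟨A * 14, fun t _ => ?_⟩
      have e1 : (1 + X t)⁻¹ ≤ 1 := inv_le_one_of_one_le₀ (by linarith [hXpos t])
      have e0 : 0 ≤ (1 + X t)⁻¹ := by have := hXpos t; positivity
      rw [abs_of_nonneg (by positivity)]
      gcongr; linarith
    · have hXt : Tendsto X atBot (𝓝 0) := by
        have hexp : Tendsto (fun s => exp (a * s)) atBot (𝓝 0) :=
          tendsto_exp_atBot.comp (tendsto_id.const_mul_atBot (by linarith))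
        simpa using hexp.const_mul c
      have := (((hXt.const_mul a).div ((hXt.const_add 1).pow 2) (by norm_num)).neg).const_mul A
      simpa using this
  refine ⟨v, v₁, G, g1, g2, g3, g4, fun s hs => ?_, fun hj s hs => ?_, g6⟩
  · have hw := mul_nonneg hN (wt_nonneg a j m)
    by_cases hm : m = 0
    · have hj : j ≠ 0 := fun h => hjm ⟨h, hm⟩
      refine (hJ hj s hs).trans ?_
      have : wt a j m = (1 + (j : ℝ) ^ 2)⁻¹ := by
        unfold wt wm; rw [if_pos hm, hm]; simp
        rw [zero_rpow (by linarith)]; simp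
      rw [this] at hw ⊢
      rw [show N * exp (δ₀ * s) / (1 + (j : ℝ) ^ 2) = N * (1 + (j : ℝ) ^ 2)⁻¹ * exp (δ₀ * s) by ring]
      nlinarith [exp_pos (δ₀ * s), mul_nonneg hw (exp_pos (δ₀ * s)).le]
    · refine (hM hm s hs).trans ?_
      nlinarith [exp_pos (δ₀ * s), mul_nonneg hw (exp_pos (δ₀ * s)).le]
  · exact ((g4 s hs).trans (hJ hj s hs)).trans (div_le_self (by positivity) (by nlinarith [sq_nonneg (j:ℝ)]))



set_option maxHeartbeats 1000000 in
lemma mode_full (κ a δ₀ ℓ : ℝ) (hκ : 2 ≤ κ) (ha : 1 < a) (ha2 : a < 2) (hδ : 0 < δ₀) (hδ1 : δ₀ < 1)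
    (hℓ : 4 ≤ exp ℓ) : ∃ Cl : ℝ → ℝ, ∀ (N : ℝ), 0 ≤ N → ∀ (j m : ℤ), ¬ (j = 0 ∧ m = 0) →
    ∀ (F : ℝ → ℂ), Continuous F → (∀ s ≤ ℓ, ‖F s‖ ≤ fb a δ₀ N j m s) →
    ∃ (v v₁ : ℝ → ℂ), (∀ s, HasDerivAt v (v₁ s) s) ∧
      (∀ s, HasDerivAt v₁ ((qf κ j m s : ℂ) * v s + F s) s) ∧ v₁ ℓ = 0 ∧
      (∀ s ≤ ℓ, ‖v s‖ ≤ 15 * (N * wt a j m) * (1 + exp (δ₀ * s))) ∧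
      (∃ l, Tendsto v atBot (𝓝 l) ∧ (j ≠ 0 → l = 0)) ∧
      (∀ s₁ s, s₁ ≤ s → s ≤ ℓ → (1 + (j:ℝ) ^ 2 + (m:ℝ) ^ 2) * ‖v s‖ ≤ Cl s₁ * (N * wt a j m) ∧
        (1 + |(j:ℝ)| + |(m:ℝ)|) * ‖v₁ s‖ ≤ Cl s₁ * (N * wt a j m) ∧
        ‖(qf κ j m s : ℂ) * v s + F s‖ ≤ Cl s₁ * (N * wt a j m)) := by
  set L := exp ℓ with hL
  let c : ℝ → ℝ := fun s => min 1 (exp (2 * (s - 2)))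
  let A : ℝ → ℝ := fun s => 60 * (1 + L) / c s + 2 * L / c s ^ 2
  let B : ℝ → ℝ := fun s => (κ ^ 2 + L ^ 2) * A s + L / c s
  refine ⟨fun s => 6 * A s + B s, ?_⟩
  intro N hN j m hjm F hF hFb
  obtain ⟨v, v₁, G, g1, g2, g3, g4, g5, g6, g7⟩ := mode_basic κ a δ₀ ℓ N hκ ha ha2 hδ hδ1 hℓ hN j m hjm F hF hFb
  have hw := wt_nonneg a j m
  set X := N * wt a j m with hX
  have hX0 : 0 ≤ X := mul_nonneg hN hw
  have hvc : Continuous v := continuous_iff_continuousAt.2 fun s => (g1 s).continuousAt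
  have hqc : Continuous (qf κ j m) := by unfold qf; fun_prop
  refine ⟨v, v₁, g1, g2, g3, fun s hs => (g4 s hs).trans (g5 s hs), ?_, ?_⟩
  · by_cases hj : j = 0
    · have hA : ∀ s ≤ ℓ, ‖v s‖ ≤ 15 * X * (1 + exp (δ₀ * ℓ)) := fun s hs =>
        ((g4 s hs).trans (g5 s hs)).trans (by gcongr)
      have hqv : ∀ s ≤ ℓ, ‖(qf κ j m s : ℂ) * v s + F s‖ ≤
          ((m:ℝ) ^ 2 * exp ((2 - δ₀) * ℓ) * (15 * X * (1 + exp (δ₀ * ℓ))) + N) * exp (δ₀ * s) := by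
        intro s hs
        refine (norm_add_le _ _).trans ?_
        have e1 : ‖F s‖ ≤ N * exp (δ₀ * s) :=
          ((hFb s hs).trans (fb_le a δ₀ N hN j m s)).trans
            (div_le_self (by positivity) (by nlinarith [sq_nonneg (j:ℝ)]))
        have e2 : qf κ j m s ≤ (m:ℝ) ^ 2 * exp ((2 - δ₀) * ℓ) * exp (δ₀ * s) := by
          unfold qf
          rw [hj, mul_assoc, ← exp_add]
          simp only [Int.cast_zero, ne_eq, OfNat.ofNat_ne_zero, not_false_eq_true, zero_pow, mul_zero, zero_add]
          gcongr
          nlinarith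
        have e3 : 0 ≤ qf κ j m s := by unfold qf; positivity
        rw [norm_mul, Complex.norm_real, Real.norm_of_nonneg e3]
        have := mul_le_mul e2 (hA s hs) (norm_nonneg _) (by positivity)
        nlinarith
      obtain ⟨l, hl⟩ := exists_lim g1 g2 (by fun_prop) hδ hA hqv
      exact ⟨l, hl, fun h => absurd hj h⟩
    · refine ⟨0, ?_, fun _ => rfl⟩
      have hexp : Tendsto (fun s => exp (δ₀ * s)) atBot (𝓝 0) :=
        tendsto_exp_atBot.comp (tendsto_id.const_mul_atBot hδ)
      refine squeeze_zero_norm' (a := fun s => N * exp (δ₀ * s)) ?_ (by simpa using hexp.const_mul N)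
      filter_upwards [eventually_le_atBot ℓ] with s hs using g6 hj s hs
  -- local bounds
  · intro s₁ s hs₁ hsℓ
    set Z : ℝ := 1 + (j:ℝ) ^ 2 + (m:ℝ) ^ 2 with hZ
    have hZ1 : 1 ≤ Z := by simp only [hZ]; nlinarith [sq_nonneg (j:ℝ), sq_nonneg (m:ℝ)]
    set t := s₁ - 2 with ht
    have hc0 : 0 < c s₁ := lt_min one_pos (exp_pos _)
    have hc1 : c s₁ ≤ 1 := min_le_left _ _
    have hce : c s₁ ≤ exp (2 * t) := min_le_right _ _
    have hLpos : 0 < L := exp_pos _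
    have hexpL : ∀ x ≤ ℓ, exp (δ₀ * x) ≤ L := fun x hx => by
      apply exp_le_exp.2
      have : 0 < ℓ := by
        by_contra h; push Not at h
        have := exp_le_one_iff.2 h; linarith
      nlinarith
    have hjm1 : (1:ℝ) ≤ (j:ℝ) ^ 2 + (m:ℝ) ^ 2 := by
      have : 1 ≤ j ^ 2 + m ^ 2 := by
        by_contra h
        push Not at h
        apply hjm
        constructor <;> nlinarith [sq_nonneg j, sq_nonneg m]
      exact_mod_cast this
    have hq : c s₁ / 2 * Z ≤ qf κ j m t := by
      unfold qf
      have h1 : (m:ℝ) ^ 2 * c s₁ ≤ (m:ℝ) ^ 2 * exp (2 * t) := mul_le_mul_of_nonneg_left hce (sq_nonneg _)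
      have h2 : (j:ℝ) ^ 2 * c s₁ ≤ κ ^ 2 * (j:ℝ) ^ 2 := by
        rw [mul_comm]
        exact mul_le_mul_of_nonneg_right (hc1.trans (by nlinarith)) (sq_nonneg _)
      simp only [hZ]; nlinarith
    have hqpos : 0 < qf κ j m t := lt_of_lt_of_le (by positivity) hq
    have hFloc : ∀ x ∈ Icc t ℓ, ‖F x‖ ≤ L / c s₁ * X := by
      intro x hx
      refine (hFb x hx.2).trans ?_
      unfold fb
      have e1 : (1 + (m:ℝ) ^ 2) * c s₁ ≤ 1 + (m:ℝ) ^ 2 * exp (2 * x) := by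
        have : (m:ℝ) ^ 2 * exp (2 * t) ≤ (m:ℝ) ^ 2 * exp (2 * x) := by gcongr; exact hx.1
        nlinarith [sq_nonneg (m:ℝ)]
      calc N * min (exp (a * x)) (exp (δ₀ * x)) / ((1 + (j:ℝ) ^ 2) * (1 + (m:ℝ) ^ 2 * exp (2 * x)))
          ≤ N * L / ((1 + (j:ℝ) ^ 2) * ((1 + (m:ℝ) ^ 2) * c s₁)) := by
            gcongr; exact (min_le_right _ _).trans (hexpL x hx.2)
        _ = L / c s₁ * (N * ((1 + (j:ℝ) ^ 2)⁻¹ * (1 + (m:ℝ) ^ 2)⁻¹)) := by field_simp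
        _ ≤ _ := by
            rw [hX]; unfold wt
            gcongr
            exact inv_le_wm ha2 m
    have hv : ∀ x, t + 1 ≤ x → x ≤ ℓ → Z * ‖v x‖ ≤ A s₁ * X := by
      intro x hx hxℓ
      have h0 := g7 t _ hFloc x hx hxℓ
      have htℓ : t ≤ ℓ := by linarith
      have h1 : G t ≤ 15 * X * (1 + L) := (g5 t htℓ).trans (by
        have := hexpL t htℓ
        gcongr)
      have hcZ : 0 < c s₁ / 2 * Z := by positivity
      have e1 : G t / (1 + qf κ j m t / 2) ≤ 15 * X * (1 + L) / (c s₁ / 4 * Z) := by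
        apply div_le_div₀ (by positivity) h1 (by positivity); linarith
      have e2 : L / c s₁ * X / qf κ j m t ≤ L / c s₁ * X / (c s₁ / 2 * Z) :=
        div_le_div_of_nonneg_left (by positivity) hcZ hq
      calc Z * ‖v x‖ ≤ Z * (15 * X * (1 + L) / (c s₁ / 4 * Z) + L / c s₁ * X / (c s₁ / 2 * Z)) := by
            gcongr; linarith
        _ = A s₁ * X := by simp only [A]; field_simp; ring
    have hA0 : 0 ≤ A s₁ := by simp only [A]; positivity
    have hB0 : 0 ≤ B s₁ := by simp only [B]; positivity
    have hv2 : ∀ x, t + 1 ≤ x → x ≤ ℓ → ‖(qf κ j m x : ℂ) * v x + F x‖ ≤ B s₁ * X := by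
      intro x hx hxℓ
      refine (norm_add_le _ _).trans ?_
      have e3 : 0 ≤ qf κ j m x := by unfold qf; positivity
      have e4 : qf κ j m x ≤ (κ ^ 2 + L ^ 2) * Z := by
        unfold qf
        have : exp (2 * x) ≤ L ^ 2 := by
          rw [hL, ← exp_nat_mul]; apply exp_le_exp.2; push_cast; linarith
        have h2 : (m:ℝ) ^ 2 * exp (2 * x) ≤ (m:ℝ) ^ 2 * L ^ 2 := by gcongr
        simp only [hZ]
        nlinarith [sq_nonneg κ, sq_nonneg L, mul_nonneg (sq_nonneg κ) (sq_nonneg (m:ℝ)),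
          mul_nonneg (sq_nonneg L) (sq_nonneg (j:ℝ))]
      rw [norm_mul, Complex.norm_real, Real.norm_of_nonneg e3]
      have h5 := hFloc x ⟨by linarith, hxℓ⟩
      have h6 := hv x hx hxℓ
      calc qf κ j m x * ‖v x‖ + ‖F x‖ ≤ (κ ^ 2 + L ^ 2) * Z * ‖v x‖ + L / c s₁ * X := by gcongr
        _ = (κ ^ 2 + L ^ 2) * (Z * ‖v x‖) + L / c s₁ * X := by ring
        _ ≤ (κ ^ 2 + L ^ 2) * (A s₁ * X) + L / c s₁ * X := by gcongr
        _ = _ := by simp only [B]; ring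
    set Y : ℝ := 1 + |(j:ℝ)| + |(m:ℝ)| with hY
    have hY1 : 1 ≤ Y := by simp only [hY]; linarith [abs_nonneg (j:ℝ), abs_nonneg (m:ℝ)]
    have hYZ : Y ^ 2 ≤ 3 * Z := by
      simp only [hY, hZ]
      rw [← sq_abs (j:ℝ), ← sq_abs (m:ℝ)]
      nlinarith [sq_nonneg (1 - |(j:ℝ)|), sq_nonneg (1 - |(m:ℝ)|), sq_nonneg (|(j:ℝ)| - |(m:ℝ)|)]
    have hv1 : Y * ‖v₁ s‖ ≤ (6 * A s₁ + B s₁) * X := by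
      have hh : 0 < 1 / Y := by positivity
      have hh1 : 1 / Y ≤ 1 := by rw [div_le_one (by linarith)]; exact hY1
      have hvZ : ∀ x, t + 1 ≤ x → x ≤ ℓ → ‖v x‖ ≤ A s₁ * X / Z := fun x hx hxl => by
        rw [le_div_iff₀ (by linarith), mul_comm]; exact hv x hx hxl
      have := landau g1 g2 (s := s) hh (hvZ s (by linarith) hsℓ) (hvZ (s - 1 / Y) (by linarith) (by linarith))
        (B := B s₁ * X) (fun x hx => hv2 x (by linarith [hx.1]) (hx.2.trans hsℓ))
      calc Y * ‖v₁ s‖ ≤ Y * (2 * (A s₁ * X / Z) / (1 / Y) + 1 / Y * (B s₁ * X)) := by gcongr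
        _ = Y ^ 2 * (2 * (A s₁ * X / Z)) + B s₁ * X := by field_simp
        _ ≤ 3 * Z * (2 * (A s₁ * X / Z)) + B s₁ * X := by gcongr
        _ = _ := by field_simp; ring
    refine ⟨(hv s (by linarith) hsℓ).trans ?_, hv1, (hv2 s (by linarith) hsℓ).trans ?_⟩
    · gcongr; linarith
    · gcongr; linarith



lemma glue_hasDerivAt {f f' g g' : ℝ → ℂ} (hf : ∀ s, HasDerivAt f (f' s) s)
    (hg : ∀ s, HasDerivAt g (g' s) s) {ℓ : ℝ} (h0 : f ℓ = g ℓ) (h1 : f' ℓ = g' ℓ) (s : ℝ) :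
    HasDerivAt (fun s => if s ≤ ℓ then f s else g s) (if s ≤ ℓ then f' s else g' s) s := by
  rcases lt_trichotomy s ℓ with h | h | h
  · rw [if_pos h.le]
    refine (hf s).congr_of_eventuallyEq ?_
    filter_upwards [gt_mem_nhds h] with x hx
    rw [if_pos (le_of_lt hx)]
  · subst h
    rw [if_pos le_rfl]
    have e1 : HasDerivWithinAt (fun x => if x ≤ s then f x else g x) (f' s) (Iic s) s :=
      (hf s).hasDerivWithinAt.congr (fun x hx => by rw [if_pos (show x ≤ s from hx)]) (by simp)
    have e2 : HasDerivWithinAt (fun x => if x ≤ s then f x else g x) (f' s) (Ici s) s := by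
      rw [h1]
      refine (hg s).hasDerivWithinAt.congr (fun x hx => ?_) (by simp [h0])
      rcases eq_or_lt_of_le (show s ≤ x from hx) with h | h
      · subst h; simp [h0]
      · rw [if_neg (not_le.2 h)]
    have := e1.union e2
    rwa [Iic_union_Ici, hasDerivWithinAt_univ] at this
  · rw [if_neg (not_le.2 h)]
    refine (hg s).congr_of_eventuallyEq ?_
    filter_upwards [lt_mem_nhds h] with x hx
    rw [if_neg (not_le.2 hx)]

lemma reflect {v v₁ v₂ : ℝ → ℂ} {ℓ : ℝ} (h1 : ∀ s, HasDerivAt v (v₁ s) s)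
    (h2 : ∀ s, HasDerivAt v₁ (v₂ s) s) (hc : Continuous v₂) (h0 : v₁ ℓ = 0) :
    ∃ u u₁ u₂ : ℝ → ℂ, (∀ s, HasDerivAt u (u₁ s) s) ∧ (∀ s, HasDerivAt u₁ (u₂ s) s) ∧
      Continuous u₂ ∧ (∀ s ≤ ℓ, u s = v s ∧ u₁ s = v₁ s ∧ u₂ s = v₂ s) ∧
      (∀ s, ‖u s‖ = ‖v (min s (2 * ℓ - s))‖ ∧ ‖u₁ s‖ = ‖v₁ (min s (2 * ℓ - s))‖ ∧
        ‖u₂ s‖ = ‖v₂ (min s (2 * ℓ - s))‖) := by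
  have hr : ∀ s : ℝ, HasDerivAt (fun s => 2 * ℓ - s) (-1) s := fun s => by
    simpa using (hasDerivAt_id s).const_sub (2 * ℓ)
  have e : 2 * ℓ - ℓ = ℓ := by ring
  refine ⟨fun s => if s ≤ ℓ then v s else v (2 * ℓ - s),
    fun s => if s ≤ ℓ then v₁ s else - v₁ (2 * ℓ - s), fun s => if s ≤ ℓ then v₂ s else v₂ (2 * ℓ - s),
    fun s => ?_, fun s => ?_, ?_, fun s hs => ?_, fun s => ?_⟩
  · refine glue_hasDerivAt h1 (g' := fun s => - v₁ (2 * ℓ - s)) (fun s => ?_) (by rw [e]) (by rw [e, h0]; simp) s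
    have := (h1 (2 * ℓ - s)).scomp s (hr s)
    simpa [Function.comp_def] using this
  · refine glue_hasDerivAt h2 (g' := fun s => v₂ (2 * ℓ - s)) (fun s => ?_) (by rw [e, h0]; simp) (by rw [e]) s
    have := ((h2 (2 * ℓ - s)).scomp s (hr s)).neg
    simpa [Function.comp_def, Pi.neg_def] using this
  · refine Continuous.if_le hc (by fun_prop) continuous_id continuous_const ?_
    intro x hx; rw [hx, e]
  · simp [hs]
  · by_cases hs : s ≤ ℓ
    · rw [min_eq_left (by linarith)]; simp [hs]
    · rw [min_eq_right (by linarith)]; simp [hs]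

/-- derivative built from partial derivatives -/
def D3 {E : Type*} [NormedAddCommGroup E] [NormedSpace ℝ E] (A B C : E) : (ℝ × ℝ × ℝ) →L[ℝ] E :=
  (ContinuousLinearMap.fst ℝ ℝ (ℝ × ℝ)).smulRight A +
  (((ContinuousLinearMap.fst ℝ ℝ ℝ).comp (ContinuousLinearMap.snd ℝ ℝ (ℝ × ℝ))).smulRight B +
  ((ContinuousLinearMap.snd ℝ ℝ ℝ).comp (ContinuousLinearMap.snd ℝ ℝ (ℝ × ℝ))).smulRight C)

lemma D3_apply {E : Type*} [NormedAddCommGroup E] [NormedSpace ℝ E] (A B C : E) (p : ℝ × ℝ × ℝ) :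
    D3 A B C p = p.1 • A + (p.2.1 • B + p.2.2 • C) := by
  simp [D3]

lemma D3_norm_le (A B C : ℂ) {w : ℝ} (hA : ‖A‖ ≤ w) (hB : ‖B‖ ≤ w) (hC : ‖C‖ ≤ w) :
    ‖D3 A B C‖ ≤ 3 * w := by
  have hw : 0 ≤ w := (norm_nonneg _).trans hA
  refine ContinuousLinearMap.opNorm_le_bound _ (by positivity) fun p => ?_
  rw [D3_apply]
  have h1 : ‖p.1‖ ≤ ‖p‖ := norm_fst_le p
  have h2 : ‖p.2.1‖ ≤ ‖p‖ := (norm_fst_le p.2).trans (norm_snd_le p)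
  have h3 : ‖p.2.2‖ ≤ ‖p‖ := (norm_snd_le p.2).trans (norm_snd_le p)
  calc ‖p.1 • A + (p.2.1 • B + p.2.2 • C)‖ ≤ ‖p.1 • A‖ + (‖p.2.1 • B‖ + ‖p.2.2 • C‖) :=
        (norm_add_le _ _).trans (add_le_add_right (norm_add_le _ _) _)
    _ = ‖p.1‖ * ‖A‖ + (‖p.2.1‖ * ‖B‖ + ‖p.2.2‖ * ‖C‖) := by rw [norm_smul, norm_smul, norm_smul]
    _ ≤ ‖p‖ * w + (‖p‖ * w + ‖p‖ * w) := by gcongr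
    _ = _ := by ring

/-- three-fold separated sums -/
def Sm (α b c : ℤ × ℤ → ℝ → ℂ) (p : ℝ × ℝ × ℝ) : ℂ := ∑' n, α n p.1 * b n p.2.1 * c n p.2.2

/-- local domination of a separated family -/
def LB (α b c : ℤ × ℤ → ℝ → ℂ) : Prop :=
  ∀ t : ℝ, ∃ w : ℤ × ℤ → ℝ, Summable w ∧ ∀ n s θ y, |s| < t → ‖α n s * b n θ * c n y‖ ≤ w n

lemma LB.summable {α b c : ℤ × ℤ → ℝ → ℂ} (h : LB α b c) (p : ℝ × ℝ × ℝ) :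
    Summable fun n => α n p.1 * b n p.2.1 * c n p.2.2 := by
  obtain ⟨w, hw, hb⟩ := h (|p.1| + 1)
  exact Summable.of_norm_bounded hw fun n => hb n _ _ _ (by linarith)

lemma LB.continuous {α b c : ℤ × ℤ → ℝ → ℂ} (h : LB α b c) (h1 : ∀ n, Continuous (α n))
    (h2 : ∀ n, Continuous (b n)) (h3 : ∀ n, Continuous (c n)) : Continuous (Sm α b c) := by
  rw [continuous_iff_continuousAt]
  intro p
  obtain ⟨w, hw, hb⟩ := h (|p.1| + 1)
  have hopen : IsOpen {p' : ℝ × ℝ × ℝ | |p'.1| < |p.1| + 1} := isOpen_lt (by fun_prop) (by fun_prop)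
  have : ContinuousOn (Sm α b c) {p' : ℝ × ℝ × ℝ | |p'.1| < |p.1| + 1} := by
    refine continuousOn_tsum (fun n => ?_) hw (fun n x hx => hb n _ _ _ hx)
    have := h1 n; have := h2 n; have := h3 n
    exact Continuous.continuousOn (by fun_prop)
  exact this.continuousAt (hopen.mem_nhds (by simp))

lemma LB.hasFDerivAt {α b c α₁ b₁ c₁ : ℤ × ℤ → ℝ → ℂ} (h : LB α b c) (hα : LB α₁ b c)
    (hb : LB α b₁ c) (hc : LB α b c₁) (h1 : ∀ n s, HasDerivAt (α n) (α₁ n s) s)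
    (h2 : ∀ n s, HasDerivAt (b n) (b₁ n s) s) (h3 : ∀ n s, HasDerivAt (c n) (c₁ n s) s)
    (p : ℝ × ℝ × ℝ) :
    HasFDerivAt (Sm α b c) (D3 (Sm α₁ b c p) (Sm α b₁ c p) (Sm α b c₁ p)) p := by
  obtain ⟨w1, hw1, hb1⟩ := hα (|p.1| + 1)
  obtain ⟨w2, hw2, hb2⟩ := hb (|p.1| + 1)
  obtain ⟨w3, hw3, hb3⟩ := hc (|p.1| + 1)
  set V := {p' : ℝ × ℝ × ℝ | |p'.1| < |p.1| + 1} with hV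
  have hopen : IsOpen V := isOpen_lt (by fun_prop) (by fun_prop)
  have hVe : V = (Ioo (-(|p.1| + 1)) (|p.1| + 1)) ×ˢ univ := by
    ext x; simp [hV, abs_lt]
  have hpre : IsPreconnected V := by
    rw [hVe]; exact (isPreconnected_Ioo).prod isPreconnected_univ
  have hp : p ∈ V := by simp [hV]
  have key := hasFDerivAt_tsum_of_isPreconnected (u := fun n => 3 * (w1 n + w2 n + w3 n))
    (f := fun n (q : ℝ × ℝ × ℝ) => α n q.1 * b n q.2.1 * c n q.2.2)
    (f' := fun n q => D3 (α₁ n q.1 * b n q.2.1 * c n q.2.2) (α n q.1 * b₁ n q.2.1 * c n q.2.2)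
      (α n q.1 * b n q.2.1 * c₁ n q.2.2)) (s := V) (x₀ := p) (x := p)
    (((hw1.add hw2).add hw3).mul_left 3) hopen hpre ?_ ?_ hp (h.summable p) hp
  · convert! key using 1
    have s1 := hα.summable p
    have s2 := hb.summable p
    have s3 := hc.summable p
    have hs : HasSum (fun n => D3 (α₁ n p.1 * b n p.2.1 * c n p.2.2) (α n p.1 * b₁ n p.2.1 * c n p.2.2)
      (α n p.1 * b n p.2.1 * c₁ n p.2.2)) (D3 (Sm α₁ b c p) (Sm α b₁ c p) (Sm α b c₁ p)) := by
      let T1 : ℂ →L[ℝ] ((ℝ × ℝ × ℝ) →L[ℝ] ℂ) :=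
        ContinuousLinearMap.smulRightL ℝ (ℝ × ℝ × ℝ) ℂ (ContinuousLinearMap.fst ℝ ℝ (ℝ × ℝ))
      let T2 : ℂ →L[ℝ] ((ℝ × ℝ × ℝ) →L[ℝ] ℂ) :=
        ContinuousLinearMap.smulRightL ℝ (ℝ × ℝ × ℝ) ℂ
          ((ContinuousLinearMap.fst ℝ ℝ ℝ).comp (ContinuousLinearMap.snd ℝ ℝ (ℝ × ℝ)))
      let T3 : ℂ →L[ℝ] ((ℝ × ℝ × ℝ) →L[ℝ] ℂ) :=
        ContinuousLinearMap.smulRightL ℝ (ℝ × ℝ × ℝ) ℂ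
          ((ContinuousLinearMap.snd ℝ ℝ ℝ).comp (ContinuousLinearMap.snd ℝ ℝ (ℝ × ℝ)))
      have e := (s1.hasSum.mapL T1).add ((s2.hasSum.mapL T2).add (s3.hasSum.mapL T3))
      exact e
    exact hs.tsum_eq.symm
  · intro n q hq
    have d1 := (h1 n q.1).hasFDerivAt.comp q (hasFDerivAt_fst (𝕜 := ℝ) (E := ℝ) (F := ℝ × ℝ))
    have d2 := (h2 n q.2.1).hasFDerivAt.comp q ((hasFDerivAt_fst (𝕜 := ℝ) (E := ℝ) (F := ℝ)).comp q
      (hasFDerivAt_snd (𝕜 := ℝ) (E := ℝ) (F := ℝ × ℝ)))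
    have d3 := (h3 n q.2.2).hasFDerivAt.comp q ((hasFDerivAt_snd (𝕜 := ℝ) (E := ℝ) (F := ℝ)).comp q
      (hasFDerivAt_snd (𝕜 := ℝ) (E := ℝ) (F := ℝ × ℝ)))
    have := (d1.mul d2).mul d3
    convert! this using 1
    ext <;> simp [D3_apply] <;> ring
  · intro n q hq
    have n1 := hb1 n q.1 q.2.1 q.2.2 hq
    have n2 := hb2 n q.1 q.2.1 q.2.2 hq
    have n3 := hb3 n q.1 q.2.1 q.2.2 hq
    have p1 := (norm_nonneg _).trans n1
    have p2 := (norm_nonneg _).trans n2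
    have p3 := (norm_nonneg _).trans n3
    exact D3_norm_le _ _ _ (by linarith) (by linarith) (by linarith)



/-- a `C²` function on `ℝ³` with its partial derivatives -/
structure Pk where
  (u us ut uy uss ust usy uts utt uty uys uyt uyy : ℝ × ℝ × ℝ → ℝ)
  h0 : ∀ p, HasFDerivAt u (D3 (us p) (ut p) (uy p)) p
  hs : ∀ p, HasFDerivAt us (D3 (uss p) (ust p) (usy p)) p
  ht : ∀ p, HasFDerivAt ut (D3 (uts p) (utt p) (uty p)) p
  hy : ∀ p, HasFDerivAt uy (D3 (uys p) (uyt p) (uyy p)) p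
  css : Continuous uss
  cst : Continuous ust
  csy : Continuous usy
  cts : Continuous uts
  ctt : Continuous utt
  cty : Continuous uty
  cys : Continuous uys
  cyt : Continuous uyt
  cyy : Continuous uyy

lemma D3_contDiff {A B C : ℝ × ℝ × ℝ → ℝ} {n : WithTop ℕ∞} (hA : ContDiff ℝ n A) (hB : ContDiff ℝ n B)
    (hC : ContDiff ℝ n C) : ContDiff ℝ n fun p => D3 (A p) (B p) (C p) := by
  unfold D3
  exact (contDiff_const.smulRight hA).add ((contDiff_const.smulRight hB).add (contDiff_const.smulRight hC))

lemma Pk.contDiff (K : Pk) : ContDiff ℝ 2 K.u := by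
  have c1 : ∀ {A B C f : ℝ × ℝ × ℝ → ℝ}, Continuous A → Continuous B → Continuous C →
      (∀ p, HasFDerivAt f (D3 (A p) (B p) (C p)) p) → ContDiff ℝ 1 f := by
    intro A B C f hA hB hC h
    refine contDiff_one_iff_hasFDerivAt.2 ⟨_, ?_, h⟩
    exact (D3_contDiff (contDiff_zero.2 hA) (contDiff_zero.2 hB) (contDiff_zero.2 hC)).continuous
  have := contDiff_succ_iff_hasFDerivAt (𝕜 := ℝ) (f := K.u) (n := 1)
  rw [show (2 : WithTop ℕ∞) = (((1 : ℕ) : WithTop ℕ∞) + 1) from by norm_num]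
  refine this.2 ⟨fun p => D3 (K.us p) (K.ut p) (K.uy p), ?_, K.h0⟩
  simp only [Nat.cast_one]
  exact D3_contDiff (c1 K.css K.cst K.csy K.hs) (c1 K.cts K.ctt K.cty K.ht) (c1 K.cys K.cyt K.cyy K.hy)

/-- cosine basis -/
def b0 (κ θ₀ : ℝ) (n : ℤ × ℤ) (θ : ℝ) : ℂ := ((Real.cos (κ * n.1 * (θ - θ₀)) : ℝ) : ℂ)
def b1 (κ θ₀ : ℝ) (n : ℤ × ℤ) (θ : ℝ) : ℂ := ((-(κ * n.1) * Real.sin (κ * n.1 * (θ - θ₀)) : ℝ) : ℂ)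
def b2 (κ θ₀ : ℝ) (n : ℤ × ℤ) (θ : ℝ) : ℂ := ((-(κ * n.1) ^ 2 * Real.cos (κ * n.1 * (θ - θ₀)) : ℝ) : ℂ)
def c0 (n : ℤ × ℤ) (y : ℝ) : ℂ := Complex.exp (Complex.I * n.2 * y)
def c1 (n : ℤ × ℤ) (y : ℝ) : ℂ := Complex.I * n.2 * Complex.exp (Complex.I * n.2 * y)
def c2 (n : ℤ × ℤ) (y : ℝ) : ℂ := -(n.2 : ℂ) ^ 2 * Complex.exp (Complex.I * n.2 * y)

lemma b0_d (κ θ₀ : ℝ) (n : ℤ × ℤ) (θ : ℝ) : HasDerivAt (b0 κ θ₀ n) (b1 κ θ₀ n θ) θ := by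
  have h := ((((hasDerivAt_id θ).sub_const θ₀).const_mul (κ * n.1)).cos).ofReal_comp
  convert! h using 1
  simp [b1]; ring

lemma b1_d (κ θ₀ : ℝ) (n : ℤ × ℤ) (θ : ℝ) : HasDerivAt (b1 κ θ₀ n) (b2 κ θ₀ n θ) θ := by
  have h := (((((hasDerivAt_id θ).sub_const θ₀).const_mul (κ * n.1)).sin).const_mul (-(κ * n.1))).ofReal_comp
  convert! h using 1
  simp [b2]; ring

lemma c_aux (n : ℤ × ℤ) (y : ℝ) : HasDerivAt (fun y : ℝ => Complex.exp (Complex.I * n.2 * y))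
    (Complex.exp (Complex.I * n.2 * y) * (Complex.I * n.2)) y := by
  have h := (((hasDerivAt_id y).ofReal_comp).const_mul (Complex.I * n.2)).cexp
  simpa using h

lemma c0_d (n : ℤ × ℤ) (y : ℝ) : HasDerivAt (c0 n) (c1 n y) y := by
  convert! c_aux n y using 1
  simp [c1]; ring

lemma c1_d (n : ℤ × ℤ) (y : ℝ) : HasDerivAt (c1 n) (c2 n y) y := by
  convert! (c_aux n y).const_mul (Complex.I * n.2) using 1
  simp only [c2]
  linear_combination (-(n.2:ℂ)^2 * Complex.exp (Complex.I * n.2 * y)) * Complex.I_sq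

lemma nexp (n : ℤ × ℤ) (y : ℝ) : ‖Complex.exp (Complex.I * n.2 * y)‖ = 1 := by
  rw [Complex.norm_exp]; simp

lemma c0_n (n : ℤ × ℤ) (y : ℝ) : ‖c0 n y‖ = 1 := nexp n y
lemma c1_n (n : ℤ × ℤ) (y : ℝ) : ‖c1 n y‖ = |(n.2 : ℝ)| := by
  rw [c1, norm_mul, nexp]; simp
lemma c2_n (n : ℤ × ℤ) (y : ℝ) : ‖c2 n y‖ = (n.2 : ℝ) ^ 2 := by
  rw [c2, norm_mul, nexp]; simp
lemma b0_n (κ θ₀ : ℝ) (n : ℤ × ℤ) (θ : ℝ) : ‖b0 κ θ₀ n θ‖ ≤ 1 := by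
  rw [b0, Complex.norm_real]; exact abs_cos_le_one _
lemma b1_n (κ θ₀ : ℝ) (hκ : 0 ≤ κ) (n : ℤ × ℤ) (θ : ℝ) : ‖b1 κ θ₀ n θ‖ ≤ κ * |(n.1 : ℝ)| := by
  rw [b1, Complex.norm_real, norm_mul, norm_neg, norm_mul, Real.norm_of_nonneg hκ, Real.norm_eq_abs, Real.norm_eq_abs]
  exact mul_le_of_le_one_right (by positivity) (abs_sin_le_one _)
lemma b2_n (κ θ₀ : ℝ) (n : ℤ × ℤ) (θ : ℝ) : ‖b2 κ θ₀ n θ‖ ≤ κ ^ 2 * (n.1 : ℝ) ^ 2 := by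
  rw [b2, Complex.norm_real, norm_mul, norm_neg, norm_pow, Real.norm_eq_abs, Real.norm_eq_abs, sq_abs, mul_pow]
  exact mul_le_of_le_one_right (by positivity) (abs_cos_le_one _)

lemma mkLB {α b c : ℤ × ℤ → ℝ → ℂ} {g : ℤ × ℤ → ℝ} {K : ℝ} (hK : 0 ≤ K)
    (h1 : ∀ t : ℝ, ∃ w : ℤ × ℤ → ℝ, Summable w ∧ ∀ n s, |s| < t → g n * ‖α n s‖ ≤ w n)
    (h2 : ∀ n θ y, ‖b n θ‖ * ‖c n y‖ ≤ K * g n) : LB α b c := by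
  intro t
  obtain ⟨w, hw, hb⟩ := h1 t
  refine ⟨fun n => K * w n, hw.mul_left K, fun n s θ y hs => ?_⟩
  rw [norm_mul, norm_mul, mul_assoc]
  calc ‖α n s‖ * (‖b n θ‖ * ‖c n y‖) ≤ ‖α n s‖ * (K * g n) := mul_le_mul_of_nonneg_left (h2 n θ y) (norm_nonneg _)
    _ = K * (g n * ‖α n s‖) := by ring
    _ ≤ K * w n := mul_le_mul_of_nonneg_left (hb n s hs) hK

lemma re_hasFDerivAt {f : ℝ × ℝ × ℝ → ℂ} {A B C : ℂ} {p : ℝ × ℝ × ℝ} (h : HasFDerivAt f (D3 A B C) p) :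
    HasFDerivAt (fun p => (f p).re) (D3 A.re B.re C.re) p := by
  have := (Complex.reCLM.hasFDerivAt).comp p h
  convert! this using 1
  ext <;> simp [D3_apply]

lemma V_hasFDerivAt {V V₁ : ℝ → ℂ} (h : ∀ s, HasDerivAt V (V₁ s) s) (p : ℝ × ℝ × ℝ) :
    HasFDerivAt (fun p : ℝ × ℝ × ℝ => V p.1) (D3 (V₁ p.1) 0 0) p := by
  have := (h p.1).hasFDerivAt.comp p (hasFDerivAt_fst (𝕜 := ℝ) (E := ℝ) (F := ℝ × ℝ))
  convert! this using 1
  ext <;> simp [D3_apply]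

lemma D3_add (A B C A' : ℂ) : D3 A B C + D3 A' 0 0 = D3 (A + A') B C := by
  ext <;> simp [D3_apply]

lemma sum_pack (κ θ₀ : ℝ) (hκ : 0 ≤ κ) (u u₁ u₂ : ℤ × ℤ → ℝ → ℂ) (h1 : ∀ n s, HasDerivAt (u n) (u₁ n s) s)
    (h2 : ∀ n s, HasDerivAt (u₁ n) (u₂ n s) s) (h3 : ∀ n, Continuous (u₂ n))
    (hb : ∀ t : ℝ, ∃ w : ℤ × ℤ → ℝ, Summable w ∧ ∀ n s, |s| < t →
      (1 + (n.1 : ℝ) ^ 2 + (n.2 : ℝ) ^ 2) * ‖u n s‖ ≤ w n ∧ (1 + |(n.1 : ℝ)| + |(n.2 : ℝ)|) * ‖u₁ n s‖ ≤ w n ∧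
        ‖u₂ n s‖ ≤ w n) (V V₁ V₂ : ℝ → ℂ) (k1 : ∀ s, HasDerivAt V (V₁ s) s)
    (k2 : ∀ s, HasDerivAt V₁ (V₂ s) s) (k3 : Continuous V₂) :
    LB u (b0 κ θ₀) c0 ∧ LB u₁ (b0 κ θ₀) c0 ∧ LB u₂ (b0 κ θ₀) c0 ∧ LB u (b2 κ θ₀) c0 ∧
    LB u (b0 κ θ₀) c2 ∧
    ∃ K : Pk, (∀ p, K.u p = (Sm u (b0 κ θ₀) c0 p + V p.1).re) ∧
      (∀ p, K.us p = (Sm u₁ (b0 κ θ₀) c0 p + V₁ p.1).re) ∧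
      (∀ p, K.ut p = (Sm u (b1 κ θ₀) c0 p).re) ∧
      (∀ p, K.uss p = (Sm u₂ (b0 κ θ₀) c0 p + V₂ p.1).re) ∧
      (∀ p, K.utt p = (Sm u (b2 κ θ₀) c0 p).re) ∧
      (∀ p, K.uyy p = (Sm u (b0 κ θ₀) c2 p).re) := by
  set gZ : ℤ × ℤ → ℝ := fun n => 1 + (n.1 : ℝ) ^ 2 + (n.2 : ℝ) ^ 2 with hgZ
  set gY : ℤ × ℤ → ℝ := fun n => 1 + |(n.1 : ℝ)| + |(n.2 : ℝ)| with hgY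
  have H0 : ∀ t : ℝ, ∃ w : ℤ × ℤ → ℝ, Summable w ∧ ∀ n s, |s| < t → gZ n * ‖u n s‖ ≤ w n := fun t => by
    obtain ⟨w, hw, h⟩ := hb t; exact ⟨w, hw, fun n s hs => (h n s hs).1⟩
  have H1 : ∀ t : ℝ, ∃ w : ℤ × ℤ → ℝ, Summable w ∧ ∀ n s, |s| < t → gY n * ‖u₁ n s‖ ≤ w n := fun t => by
    obtain ⟨w, hw, h⟩ := hb t; exact ⟨w, hw, fun n s hs => (h n s hs).2.1⟩
  have H2 : ∀ t : ℝ, ∃ w : ℤ × ℤ → ℝ, Summable w ∧ ∀ n s, |s| < t → (fun _ => (1:ℝ)) n * ‖u₂ n s‖ ≤ w n := fun t => by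
    obtain ⟨w, hw, h⟩ := hb t; exact ⟨w, hw, fun n s hs => by simpa using (h n s hs).2.2⟩
  set B0 := b0 κ θ₀
  set B1 := b1 κ θ₀
  set B2 := b2 κ θ₀
  have hK : 0 ≤ 1 + κ + κ ^ 2 := by positivity
  have nj : ∀ n : ℤ × ℤ, |(n.1:ℝ)| ≤ 1 + (n.1:ℝ)^2 := fun n => by
    rw [← sq_abs (n.1:ℝ)]; nlinarith [sq_nonneg (|(n.1:ℝ)| - 1)]
  have nm : ∀ n : ℤ × ℤ, |(n.2:ℝ)| ≤ 1 + (n.2:ℝ)^2 := fun n => by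
    rw [← sq_abs (n.2:ℝ)]; nlinarith [sq_nonneg (|(n.2:ℝ)| - 1)]
  have njm : ∀ n : ℤ × ℤ, |(n.1:ℝ)| * |(n.2:ℝ)| ≤ 1 + (n.1:ℝ)^2 + (n.2:ℝ)^2 := fun n => by
    rw [← sq_abs (n.1:ℝ), ← sq_abs (n.2:ℝ)]; nlinarith [sq_nonneg (|(n.1:ℝ)| - |(n.2:ℝ)|)]
  have pj : ∀ n : ℤ × ℤ, 0 ≤ |(n.1:ℝ)| := fun n => abs_nonneg _
  have pm : ∀ n : ℤ × ℤ, 0 ≤ |(n.2:ℝ)| := fun n => abs_nonneg _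
  have hk2 : 0 ≤ κ ^ 2 := sq_nonneg κ
  have g1 : ∀ n, 1 ≤ gZ n := fun n => by simp only [hgZ]; nlinarith [sq_nonneg (n.1:ℝ), sq_nonneg (n.2:ℝ)]
  have gy1 : ∀ n, 1 ≤ gY n := fun n => by simp only [hgY]; linarith [pj n, pm n]
  have up : ∀ {g x c : ℝ}, 0 ≤ g → x ≤ c * g → 0 ≤ c → c ≤ 1 + κ + κ ^ 2 → x ≤ (1 + κ + κ^2) * g :=
    fun hg hx _ hc => hx.trans (by gcongr)
  have p00 : ∀ n θ y, ‖B0 n θ‖ * ‖c0 n y‖ ≤ 1 := fun n θ y => by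
    rw [c0_n, mul_one]; exact b0_n κ θ₀ n θ
  have p10 : ∀ n θ y, ‖B1 n θ‖ * ‖c0 n y‖ ≤ κ * |(n.1:ℝ)| := fun n θ y => by
    rw [c0_n, mul_one]; exact b1_n κ θ₀ hκ n θ
  have p20 : ∀ n θ y, ‖B2 n θ‖ * ‖c0 n y‖ ≤ κ ^ 2 * (n.1:ℝ)^2 := fun n θ y => by
    rw [c0_n, mul_one]; exact b2_n κ θ₀ n θ
  have p01 : ∀ n θ y, ‖B0 n θ‖ * ‖c1 n y‖ ≤ |(n.2:ℝ)| := fun n θ y => by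
    rw [c1_n]; exact mul_le_of_le_one_left (abs_nonneg _) (b0_n κ θ₀ n θ)
  have p02 : ∀ n θ y, ‖B0 n θ‖ * ‖c2 n y‖ ≤ (n.2:ℝ)^2 := fun n θ y => by
    rw [c2_n]; exact mul_le_of_le_one_left (sq_nonneg _) (b0_n κ θ₀ n θ)
  have p11 : ∀ n θ y, ‖B1 n θ‖ * ‖c1 n y‖ ≤ κ * (|(n.1:ℝ)| * |(n.2:ℝ)|) := fun n θ y => by
    rw [c1_n, ← mul_assoc]; exact mul_le_mul_of_nonneg_right (b1_n κ θ₀ hκ n θ) (abs_nonneg _)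
  have gZ0 : ∀ n, 0 ≤ gZ n := fun n => by linarith [g1 n]
  have gY0 : ∀ n, 0 ≤ gY n := fun n => by linarith [gy1 n]
  have L00 : LB u B0 c0 := mkLB hK H0 fun n θ y => up (gZ0 n) (c := 1) (by linarith [p00 n θ y, g1 n]) one_pos.le (by nlinarith)
  have L10 : LB u B1 c0 := mkLB hK H0 fun n θ y => up (gZ0 n) (c := κ) ((p10 n θ y).trans (by
    gcongr; simp only [hgZ]; nlinarith [nj n, sq_nonneg (n.2:ℝ)])) hκ (by nlinarith)
  have L20 : LB u B2 c0 := mkLB hK H0 fun n θ y => up (gZ0 n) (c := κ ^ 2) ((p20 n θ y).trans (by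
    gcongr; simp only [hgZ]; nlinarith [sq_nonneg (n.2:ℝ)])) hk2 (by nlinarith)
  have L01 : LB u B0 c1 := mkLB hK H0 fun n θ y => up (gZ0 n) (c := 1) ((p01 n θ y).trans (by
    rw [one_mul]; simp only [hgZ]; nlinarith [nm n, sq_nonneg (n.1:ℝ)])) one_pos.le (by nlinarith)
  have L02 : LB u B0 c2 := mkLB hK H0 fun n θ y => up (gZ0 n) (c := 1) ((p02 n θ y).trans (by
    rw [one_mul]; simp only [hgZ]; nlinarith [sq_nonneg (n.1:ℝ)])) one_pos.le (by nlinarith)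
  have L11 : LB u B1 c1 := mkLB hK H0 fun n θ y => up (gZ0 n) (c := κ) ((p11 n θ y).trans (by
    gcongr; simp only [hgZ]; exact njm n)) hκ (by nlinarith)
  have M00 : LB u₁ B0 c0 := mkLB hK H1 fun n θ y => up (gY0 n) (c := 1) (by linarith [p00 n θ y, gy1 n]) one_pos.le (by nlinarith)
  have M10 : LB u₁ B1 c0 := mkLB hK H1 fun n θ y => up (gY0 n) (c := κ) ((p10 n θ y).trans (by
    gcongr; simp only [hgY]; linarith [pm n])) hκ (by nlinarith)
  have M01 : LB u₁ B0 c1 := mkLB hK H1 fun n θ y => up (gY0 n) (c := 1) ((p01 n θ y).trans (by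
    rw [one_mul]; simp only [hgY]; linarith [pj n])) one_pos.le (by nlinarith)
  have N00 : LB u₂ B0 c0 := mkLB hK H2 fun n θ y => up zero_le_one (c := 1) (by linarith [p00 n θ y]) one_pos.le (by nlinarith)
  have cu : ∀ n, Continuous (u n) := fun n => continuous_iff_continuousAt.2 fun s => (h1 n s).continuousAt
  have cu1 : ∀ n, Continuous (u₁ n) := fun n => continuous_iff_continuousAt.2 fun s => (h2 n s).continuousAt
  have cB0 : ∀ n, Continuous (B0 n) := fun n => continuous_iff_continuousAt.2 fun s => (b0_d κ θ₀ n s).continuousAt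
  have cB1 : ∀ n, Continuous (B1 n) := fun n => continuous_iff_continuousAt.2 fun s => (b1_d κ θ₀ n s).continuousAt
  have cB2 : ∀ n, Continuous (B2 n) := fun n => by simp only [B2]; unfold b2; fun_prop
  have cc0 : ∀ n, Continuous (c0 n) := fun n => continuous_iff_continuousAt.2 fun s => (c0_d n s).continuousAt
  have cc1 : ∀ n, Continuous (c1 n) := fun n => continuous_iff_continuousAt.2 fun s => (c1_d n s).continuousAt
  have cc2 : ∀ n, Continuous (c2 n) := fun n => by unfold c2; fun_prop
  have d0 := LB.hasFDerivAt L00 M00 L10 L01 h1 (b0_d κ θ₀) c0_d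
  have ds := LB.hasFDerivAt M00 N00 M10 M01 h2 (b0_d κ θ₀) c0_d
  have dt := LB.hasFDerivAt L10 M10 L20 L11 h1 (b1_d κ θ₀) c0_d
  have dy := LB.hasFDerivAt L01 M01 L11 L02 h1 (b0_d κ θ₀) c1_d
  have hre : Continuous Complex.re := Complex.continuous_re
  refine ⟨L00, M00, N00, L20, L02, ?_⟩
  refine ⟨{ u := fun p => (Sm u B0 c0 p + V p.1).re
            us := fun p => (Sm u₁ B0 c0 p + V₁ p.1).re
            ut := fun p => (Sm u B1 c0 p).re
            uy := fun p => (Sm u B0 c1 p).re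
            uss := fun p => (Sm u₂ B0 c0 p + V₂ p.1).re
            ust := fun p => (Sm u₁ B1 c0 p).re
            usy := fun p => (Sm u₁ B0 c1 p).re
            uts := fun p => (Sm u₁ B1 c0 p).re
            utt := fun p => (Sm u B2 c0 p).re
            uty := fun p => (Sm u B1 c1 p).re
            uys := fun p => (Sm u₁ B0 c1 p).re
            uyt := fun p => (Sm u B1 c1 p).re
            uyy := fun p => (Sm u B0 c2 p).re
            h0 := fun p => re_hasFDerivAt (by rw [← D3_add]; exact (d0 p).add (V_hasFDerivAt k1 p))
            hs := fun p => re_hasFDerivAt (by rw [← D3_add]; exact (ds p).add (V_hasFDerivAt k2 p))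
            ht := fun p => re_hasFDerivAt (dt p)
            hy := fun p => re_hasFDerivAt (dy p)
            css := hre.comp ((N00.continuous h3 cB0 cc0).add (k3.comp continuous_fst))
            cst := hre.comp (M10.continuous cu1 cB1 cc0)
            csy := hre.comp (M01.continuous cu1 cB0 cc1)
            cts := hre.comp (M10.continuous cu1 cB1 cc0)
            ctt := hre.comp (L20.continuous cu cB2 cc0)
            cty := hre.comp (L11.continuous cu cB1 cc1)
            cys := hre.comp (M01.continuous cu1 cB0 cc1)
            cyt := hre.comp (L11.continuous cu cB1 cc1)
            cyy := hre.comp (L02.continuous cu cB0 cc2) },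
    fun _ => rfl, fun _ => rfl, fun _ => rfl, fun _ => rfl, fun _ => rfl, fun _ => rfl⟩



/-- double primitive from `-∞` -/
lemma dbl_int {F : ℝ → ℂ} (hF : Continuous F) {ℓ N c : ℝ} (hc0 : 0 < c)
    (hB : ∀ s ≤ ℓ, ‖F s‖ ≤ N * exp (c * s)) :
    ∃ V : ℝ → ℂ, (∀ s, HasDerivAt V (∫ t in Iic s, F t) s) ∧
      (∀ s, HasDerivAt (fun s => ∫ t in Iic s, F t) (F s) s) ∧
      (∀ s ≤ ℓ, ‖V s‖ ≤ N / c / c * exp (c * s)) := by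
  have i1 := integrableOn_of_exp_bound hF hc0 hB
  set P : ℝ → ℂ := fun s => ∫ t in Iic s, F t with hP
  have P1 : ∀ s, HasDerivAt P (F s) s := hasDerivAt_integral_Iic hF i1
  have Pb : ∀ s ≤ ℓ, ‖P s‖ ≤ N / c * exp (c * s) := fun s hs => by
    have e0 : ∫ t in Iic s, N * exp (c * t) = N / c * exp (c * s) := by
      rw [MeasureTheory.integral_const_mul, integral_exp_mul_Iic hc0]; ring
    rw [← e0]
    refine norm_integral_le_of_norm_le ((exp_integrableOn_Iic hc0 s).const_mul N) ?_
    filter_upwards [ae_restrict_mem measurableSet_Iic] with t ht using hB t (le_trans ht hs)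
  have Pc : Continuous P := continuous_iff_continuousAt.2 fun s => (P1 s).continuousAt
  have i2 := integrableOn_of_exp_bound Pc hc0 Pb
  refine ⟨fun s => ∫ t in Iic s, P t, hasDerivAt_integral_Iic Pc i2, P1, fun s hs => ?_⟩
  have e0 : ∫ t in Iic s, N / c * exp (c * t) = N / c / c * exp (c * s) := by
    rw [MeasureTheory.integral_const_mul, integral_exp_mul_Iic hc0]; ring
  rw [← e0]
  refine norm_integral_le_of_norm_le ((exp_integrableOn_Iic hc0 s).const_mul (N / c)) ?_
  filter_upwards [ae_restrict_mem measurableSet_Iic] with t ht using Pb t (le_trans ht hs)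

/-- approach to the origin in logarithmic polar coordinates -/
def orig : Filter (ℝ × ℝ × ℝ) := comap (fun p => p.1) atBot ⊓ comap (fun p => p.2.2) (𝓝 0)

lemma c0_per (n : ℤ × ℤ) (y : ℝ) : c0 n (y + 2 * π) = c0 n y := by
  unfold c0
  rw [show Complex.I * (n.2:ℂ) * ((y + 2 * π : ℝ) : ℂ) =
    Complex.I * n.2 * y + (n.2 : ℂ) * (2 * π * Complex.I) by push_cast; ring]
  exact Complex.exp_periodic.int_mul n.2 _

instance orig_neBot : orig.NeBot := by
  rw [orig]
  have : (comap (fun p : ℝ × ℝ × ℝ => p.1) atBot ⊓ comap (fun p => p.2.2) (𝓝 0)).NeBot ↔ True := by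
    rw [iff_true, Filter.inf_neBot_iff]
    intro s hs t ht
    obtain ⟨s', hs', hss⟩ := hs
    obtain ⟨t', ht', htt⟩ := ht
    obtain ⟨x, hx⟩ := (atBot_neBot (α := ℝ)).nonempty_of_mem hs'
    exact ⟨(x, 0, 0), hss hx, htt (show (0:ℝ) ∈ t' from mem_of_mem_nhds ht')⟩
  exact this.2 trivial

lemma polar_sol (κ θ₀ a δ₀ : ℝ) (hκ : 2 ≤ κ) (ha : 1 < a) (ha2 : a < 2) (hδ : 0 < δ₀) (hδ1 : δ₀ < 1) :
    ∃ C : ℝ, 0 < C ∧ ∀ ℓ : ℝ, 4 ≤ exp ℓ → ∀ N : ℝ, 0 ≤ N → ∀ Fc : ℤ × ℤ → ℝ → ℂ,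
      (∀ n, Continuous (Fc n)) → (∀ n, ∀ s ≤ ℓ, ‖Fc n s‖ ≤ fb a δ₀ N n.1 n.2 s) →
      ∃ K : Pk, (∀ p : ℝ × ℝ × ℝ, p.1 ≤ ℓ → ∃ S : ℂ,
          HasSum (fun n => Fc n p.1 * b0 κ θ₀ n p.2.1 * c0 n p.2.2) S ∧
          K.uss p + K.utt p + exp (2 * p.1) * K.uyy p = S.re) ∧
        (∀ θ y, K.us (ℓ, θ, y) = (∫ t in Iic ℓ, Fc 0 t).re) ∧
        (∀ s θ y, (∀ j : ℤ, Real.sin (κ * j * (θ - θ₀)) = 0) → K.ut (s, θ, y) = 0) ∧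
        (∀ s θ y, K.u (s, θ, y + 2 * π) = K.u (s, θ, y)) ∧
        Tendsto K.u orig (𝓝 0) ∧
        (∀ p : ℝ × ℝ × ℝ, p.1 ≤ ℓ → |K.u p| ≤ C * N * (1 + exp (δ₀ * p.1))) := by
  set W : ℝ := ∑' n : ℤ × ℤ, wt a n.1 n.2 with hW
  have hWs := summable_wt ha
  have hW0 : 0 ≤ W := tsum_nonneg fun n => wt_nonneg _ _ _
  set C₁ : ℝ := 15 * W + 1 / δ₀ / δ₀ with hC₁
  have hC₁0 : 0 < C₁ := by positivity
  refine ⟨3 * C₁, by positivity, ?_⟩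
  intro ℓ hℓ N hN Fc hFc hFb
  obtain ⟨Cl, hCl⟩ := mode_full κ a δ₀ ℓ hκ ha ha2 hδ hδ1 hℓ
  have hmode : ∀ n : ℤ × ℤ, ∃ (v v₁ v₂ : ℝ → ℂ), (∀ s, HasDerivAt v (v₁ s) s) ∧
      (∀ s, HasDerivAt v₁ (v₂ s) s) ∧ Continuous v₂ ∧
      (∀ s, v₂ s = (qf κ n.1 n.2 s : ℂ) * v s + (if n = 0 then 0 else Fc n s)) ∧ v₁ ℓ = 0 ∧
      (∀ s ≤ ℓ, ‖v s‖ ≤ 15 * (N * wt a n.1 n.2) * (1 + exp (δ₀ * s))) ∧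
      (∃ l, Tendsto v atBot (𝓝 l) ∧ (n.1 ≠ 0 → l = 0)) ∧
      (∀ s₁ s, s₁ ≤ s → s ≤ ℓ → (1 + (n.1:ℝ) ^ 2 + (n.2:ℝ) ^ 2) * ‖v s‖ ≤ |Cl s₁| * (N * wt a n.1 n.2) ∧
        (1 + |(n.1:ℝ)| + |(n.2:ℝ)|) * ‖v₁ s‖ ≤ |Cl s₁| * (N * wt a n.1 n.2) ∧
        ‖v₂ s‖ ≤ |Cl s₁| * (N * wt a n.1 n.2)) := by
    intro n
    have hX := mul_nonneg hN (wt_nonneg a n.1 n.2)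
    by_cases hn : n = 0
    · refine ⟨fun _ => 0, fun _ => 0, fun _ => 0, fun s => hasDerivAt_const _ _, fun s => hasDerivAt_const _ _,
        continuous_const, fun s => by simp [hn], rfl, fun s _ => ?_, ⟨0, tendsto_const_nhds, fun _ => rfl⟩,
        fun s₁ s _ _ => ?_⟩
      · rw [norm_zero]; positivity
      · simp only [norm_zero, mul_zero]
        have : 0 ≤ |Cl s₁| * (N * wt a n.1 n.2) := by positivity
        exact ⟨this, this, this⟩
    · have hn' : ¬ (n.1 = 0 ∧ n.2 = 0) := fun h => hn (Prod.ext h.1 h.2)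
      obtain ⟨v, v₁, p1, p2, p3, p4, p5, p6⟩ := hCl N hN n.1 n.2 hn' (Fc n) (hFc n) (hFb n)
      have hvc : Continuous v := continuous_iff_continuousAt.2 fun s => (p1 s).continuousAt
      have hqc : Continuous (qf κ n.1 n.2) := by unfold qf; fun_prop
      have := hFc n
      refine ⟨v, v₁, fun s => (qf κ n.1 n.2 s : ℂ) * v s + Fc n s, p1, p2, by fun_prop,
        fun s => by rw [if_neg hn], p3, p4, p5, fun s₁ s h1 h2 => ?_⟩
      obtain ⟨q1, q2, q3⟩ := p6 s₁ s h1 h2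
      have : Cl s₁ * (N * wt a n.1 n.2) ≤ |Cl s₁| * (N * wt a n.1 n.2) := by
        gcongr; exact le_abs_self _
      exact ⟨q1.trans this, q2.trans this, q3.trans this⟩
  choose v v₁ v₂ m1 m2 m3 m4 m5 m6 m7 m8 using hmode
  choose l hl hl0 using m7
  have hrefl := fun n => reflect (m1 n) (m2 n) (m3 n) (m5 n)
  choose u u₁ u₂ r1 r2 r3 r4 r5 using hrefl
  -- zero mode
  have hF0 : ∀ s ≤ ℓ, ‖Fc 0 s‖ ≤ N * exp (δ₀ * s) := fun s hs =>
    ((hFb 0 s hs).trans (fb_le a δ₀ N hN _ _ s)).trans (div_le_self (by positivity) (by simp))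
  obtain ⟨V, k1, k2, k3⟩ := dbl_int (hFc 0) hδ hF0
  -- sup bound
  have hub : ∀ n s, s ≤ ℓ → ‖u n s‖ ≤ 15 * (N * wt a n.1 n.2) * (1 + exp (δ₀ * s)) := fun n s hs => by
    rw [(r4 n s hs).1]; exact m6 n s hs
  have hterm : ∀ n (p : ℝ × ℝ × ℝ), ‖u n p.1 * b0 κ θ₀ n p.2.1 * c0 n p.2.2‖ ≤ ‖u n p.1‖ := fun n p => by
    rw [norm_mul, norm_mul, c0_n, mul_one]
    exact mul_le_of_le_one_right (norm_nonneg _) (b0_n κ θ₀ n p.2.1)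
  have hsum15 : ∀ c : ℝ, Summable fun n : ℤ × ℤ => 15 * (N * wt a n.1 n.2) * c := fun c =>
    (((hWs.mul_left N).mul_left 15).mul_right c)
  have hsup : ∀ p : ℝ × ℝ × ℝ, p.1 ≤ ℓ → ‖Sm u (b0 κ θ₀) c0 p + V p.1‖ ≤ C₁ * N * (1 + exp (δ₀ * p.1)) := by
    intro p hp
    refine (norm_add_le _ _).trans ?_
    have e1 : ‖Sm u (b0 κ θ₀) c0 p‖ ≤ 15 * (N * W) * (1 + exp (δ₀ * p.1)) := by
      have hs : HasSum (fun n : ℤ × ℤ => 15 * (N * wt a n.1 n.2) * (1 + exp (δ₀ * p.1)))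
          (15 * (N * W) * (1 + exp (δ₀ * p.1))) :=
        ((hWs.hasSum.mul_left N).mul_left 15).mul_right _
      exact tsum_of_norm_bounded hs fun n => (hterm n p).trans (hub n p.1 hp)
    have e2 := k3 p.1 hp
    have e3 : N / δ₀ / δ₀ * exp (δ₀ * p.1) ≤ (1 / δ₀ / δ₀) * N * (1 + exp (δ₀ * p.1)) := by
      rw [show N / δ₀ / δ₀ = (1 / δ₀ / δ₀) * N by ring]
      gcongr; linarith
    calc _ ≤ 15 * (N * W) * (1 + exp (δ₀ * p.1)) + (1 / δ₀ / δ₀) * N * (1 + exp (δ₀ * p.1)) := by linarith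
      _ = _ := by rw [hC₁]; ring
  -- limit
  have horig1 : Tendsto (fun p : ℝ × ℝ × ℝ => p.1) orig atBot := tendsto_comap.mono_left inf_le_left
  have horig2 : Tendsto (fun p : ℝ × ℝ × ℝ => p.2.2) orig (𝓝 0) := tendsto_comap.mono_left inf_le_right
  have hexp : Tendsto (fun s => exp (δ₀ * s)) atBot (𝓝 0) :=
    tendsto_exp_atBot.comp (tendsto_id.const_mul_atBot hδ)
  have hVlim : Tendsto (fun p : ℝ × ℝ × ℝ => V p.1) orig (𝓝 0) := by
    have : Tendsto V atBot (𝓝 0) := by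
      refine squeeze_zero_norm' (a := fun s => N / δ₀ / δ₀ * exp (δ₀ * s)) ?_ (by simpa using hexp.const_mul (N/δ₀/δ₀))
      filter_upwards [eventually_le_atBot ℓ] with s hs using k3 s hs
    exact this.comp horig1
  have hul : ∀ n, Tendsto (u n) atBot (𝓝 (l n)) := fun n => by
    refine (hl n).congr' ?_
    filter_upwards [eventually_le_atBot ℓ] with s hs using (r4 n s hs).1.symm
  have hSlim : Tendsto (Sm u (b0 κ θ₀) c0) orig (𝓝 (∑' n, l n)) := by
    refine tendsto_tsum_of_dominated_convergence (bound := fun n : ℤ × ℤ => 15 * (N * wt a n.1 n.2) * (1 + exp (δ₀ * ℓ)))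
      (hsum15 _) (fun n => ?_) ?_
    · by_cases hj : n.1 = 0
      · have e : ∀ p : ℝ × ℝ × ℝ, u n p.1 * b0 κ θ₀ n p.2.1 * c0 n p.2.2 = u n p.1 * c0 n p.2.2 := fun p => by
          simp [b0, hj]
        simp only [e]
        have hcc : Continuous (c0 n) := continuous_iff_continuousAt.2 fun s => (c0_d n s).continuousAt
        have := ((hul n).comp horig1).mul ((hcc.tendsto 0).comp horig2)
        simpa [c0] using this
      · rw [hl0 n hj]
        have h0 : Tendsto (fun p : ℝ × ℝ × ℝ => ‖u n p.1‖) orig (𝓝 0) := by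
          have := ((hul n).comp horig1).norm
          simpa [hl0 n hj] using this
        exact squeeze_zero_norm (fun p => hterm n p) h0
    · filter_upwards [horig1.eventually (eventually_le_atBot ℓ)] with p hp n
      refine (hterm n p).trans ((hub n p.1 hp).trans ?_)
      have := wt_nonneg a n.1 n.2
      gcongr
  set c : ℝ := (∑' n, l n).re with hc
  have hlim0 : Tendsto (fun p : ℝ × ℝ × ℝ => (Sm u (b0 κ θ₀) c0 p + V p.1).re) orig (𝓝 c) := by
    have := (Complex.continuous_re.tendsto _).comp (hSlim.add hVlim)
    rw [add_zero] at this
    exact this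
  have hcb : |c| ≤ 2 * (C₁ * N) := by
    refine le_of_tendsto hlim0.abs ?_
    filter_upwards [horig1.eventually (eventually_le_atBot ℓ), horig1.eventually (eventually_le_atBot 0)] with p hp hp0
    refine ((Complex.abs_re_le_norm _).trans (hsup p hp)).trans ?_
    have : exp (δ₀ * p.1) ≤ 1 := exp_le_one_iff.2 (by nlinarith)
    have : 0 ≤ C₁ * N := by positivity
    nlinarith
  -- local bounds
  have hloc : ∀ t : ℝ, ∃ w : ℤ × ℤ → ℝ, Summable w ∧ ∀ n s, |s| < t →
      (1 + (n.1 : ℝ) ^ 2 + (n.2 : ℝ) ^ 2) * ‖u n s‖ ≤ w n ∧ (1 + |(n.1 : ℝ)| + |(n.2 : ℝ)|) * ‖u₁ n s‖ ≤ w n ∧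
        ‖u₂ n s‖ ≤ w n := by
    intro t
    set s₁ := min (-t) (2 * ℓ - t)
    refine ⟨fun n => |Cl s₁| * (N * wt a n.1 n.2), (hWs.mul_left N).mul_left _, fun n s hs => ?_⟩
    obtain ⟨q1, q2, q3⟩ := r5 n s
    rw [q1, q2, q3]
    rw [abs_lt] at hs
    refine m8 n s₁ (min s (2 * ℓ - s)) ?_ ?_
    · exact min_le_min (by linarith) (by linarith)
    · rcases le_total s ℓ with h | h
      · exact (min_le_left _ _).trans h
      · exact (min_le_right _ _).trans (by linarith)
  obtain ⟨L1, L2, L3, L4, L5, K, K1, K2, K3, K4, K5, K6⟩ := sum_pack κ θ₀ (by linarith) u u₁ u₂ r1 r2 r3 hloc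
    (fun s => V s - (c : ℂ)) (fun s => ∫ t in Iic s, Fc 0 t) (Fc 0) (fun s => (k1 s).sub_const _) k2 (hFc 0)
  have hKu : ∀ p, K.u p = (Sm u (b0 κ θ₀) c0 p + V p.1).re - c := fun p => by
    rw [K1]; simp [add_sub_assoc]
  refine ⟨K, fun p hp => ?_, fun θ y => ?_, fun s θ y h => ?_, fun s θ y => ?_, ?_, fun p hp => ?_⟩
  · have H := ((L3.summable p).hasSum.add (L4.summable p).hasSum).add
      ((L5.summable p).hasSum.mul_left ((exp (2 * p.1) : ℝ) : ℂ))
    have H0 := hasSum_ite_eq (0 : ℤ × ℤ) (Fc 0 p.1)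
    have H1 := H.add H0
    have hfin : ∀ (g : ℤ × ℤ → ℂ) (S : ℂ), HasSum g S → K.uss p + K.utt p + exp (2 * p.1) * K.uyy p = S.re →
        (fun n => Fc n p.1 * b0 κ θ₀ n p.2.1 * c0 n p.2.2) = g →
        ∃ S : ℂ, HasSum (fun n => Fc n p.1 * b0 κ θ₀ n p.2.1 * c0 n p.2.2) S ∧
          K.uss p + K.utt p + exp (2 * p.1) * K.uyy p = S.re := fun g S hg hS h => ⟨S, h ▸ hg, hS⟩
    refine hfin _ _ H1 (by
      rw [K4, K5, K6]
      simp only [Complex.add_re, Complex.re_ofReal_mul, Sm]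
      ring) ?_
    · ext n
      have e2 := (r4 n p.1 hp)
      have e3 : u₂ n p.1 = (qf κ n.1 n.2 p.1 : ℂ) * u n p.1 + (if n = 0 then 0 else Fc n p.1) := by
        rw [e2.2.2, e2.1]; exact m4 n p.1
      by_cases hn : n = 0
      · rw [e3]; subst hn
        simp [b0, c0, b2, c2, qf]
      · rw [e3, if_neg hn, if_neg hn]
        simp only [b2, b0, c2, c0, qf]
        push_cast
        ring
  · rw [K2]
    have : Sm u₁ (b0 κ θ₀) c0 (ℓ, θ, y) = 0 := by
      unfold Sm
      have : ∀ n, u₁ n ℓ = 0 := fun n => by rw [(r4 n ℓ le_rfl).2.1]; exact m5 n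
      simp [this]
    rw [this, zero_add]
  · rw [K3]
    have : Sm u (b1 κ θ₀) c0 (s, θ, y) = 0 := by
      unfold Sm
      have : ∀ n, b1 κ θ₀ n θ = 0 := fun n => by unfold b1; rw [h n.1]; simp
      simp [this]
    rw [this]; simp
  · rw [hKu, hKu]
    have : Sm u (b0 κ θ₀) c0 (s, θ, y + 2 * π) = Sm u (b0 κ θ₀) c0 (s, θ, y) := by
      unfold Sm
      simp only [c0_per]
    rw [this]
  · have : K.u = fun p => (Sm u (b0 κ θ₀) c0 p + V p.1).re - c := funext hKu
    rw [this]
    simpa using hlim0.sub_const c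
  · rw [hKu]
    have e1 := (Complex.abs_re_le_norm _).trans (hsup p hp)
    have e2 := abs_sub ((Sm u (b0 κ θ₀) c0 p + V p.1).re) c
    have : 0 ≤ C₁ * N := by positivity
    nlinarith [mul_nonneg this (exp_pos (δ₀ * p.1)).le]



/-- polar map -/
def Ph (p : ℝ × ℝ × ℝ) : V3 := !₂[exp p.1 * Real.cos p.2.1, p.2.2, exp p.1 * Real.sin p.2.1]
/-- inverse polar map -/
def Ps (x : V3) : ℝ × ℝ × ℝ := (Real.log (x 0 ^ 2 + x 2 ^ 2) / 2, π / 2 - Real.arctan (x 0 / x 2), x 1)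

@[simp] lemma Ph_0 (p) : Ph p 0 = exp p.1 * Real.cos p.2.1 := by simp [Ph]
@[simp] lemma Ph_1 (p) : Ph p 1 = p.2.2 := by simp [Ph]
@[simp] lemma Ph_2 (p) : Ph p 2 = exp p.1 * Real.sin p.2.1 := by simp [Ph]

lemma Ph_sq (p) : Ph p 0 ^ 2 + Ph p 2 ^ 2 = exp p.1 ^ 2 := by
  simp only [Ph_0, Ph_2]
  nlinarith [Real.sin_sq_add_cos_sq p.2.1]

lemma rx_Ph (p) : rx (Ph p) = exp p.1 := by
  rw [rx, Ph_sq, Real.sqrt_sq (exp_pos _).le]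

lemma Ph_Ps {x : V3} (hx : 0 < x 2) : Ph (Ps x) = x := by
  have hr : 0 < x 0 ^ 2 + x 2 ^ 2 := by positivity
  have h1 : exp (Real.log (x 0 ^ 2 + x 2 ^ 2) / 2) = √(x 0 ^ 2 + x 2 ^ 2) := by
    rw [Real.sqrt_eq_rpow, Real.rpow_def_of_pos hr]; congr 1; ring
  have h2 : √(1 + (x 0 / x 2) ^ 2) = √(x 0 ^ 2 + x 2 ^ 2) / x 2 := by
    rw [show 1 + (x 0 / x 2) ^ 2 = (x 0 ^ 2 + x 2 ^ 2) / x 2 ^ 2 by field_simp; ring,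
      Real.sqrt_div hr.le, Real.sqrt_sq hx.le]
  have h3 : √(x 0 ^ 2 + x 2 ^ 2) ≠ 0 := (Real.sqrt_pos.2 hr).ne'
  ext i
  fin_cases i
  · show Ph (Ps x) 0 = x 0
    rw [Ph_0]
    simp only [Ps]
    rw [Real.cos_pi_div_two_sub, Real.sin_arctan, h1, h2]
    field_simp
  · show Ph (Ps x) 1 = x 1
    rw [Ph_1]; rfl
  · show Ph (Ps x) 2 = x 2
    rw [Ph_2]
    simp only [Ps]
    rw [Real.sin_pi_div_two_sub, Real.cos_arctan, h1, h2]
    field_simp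

lemma Ps_Ph {p : ℝ × ℝ × ℝ} (h0 : 0 < p.2.1) (h1 : p.2.1 < π) : Ps (Ph p) = p := by
  obtain ⟨s, θ, y⟩ := p
  simp only at h0 h1
  have hs : 0 < Real.sin θ := Real.sin_pos_of_pos_of_lt_pi h0 h1
  unfold Ps
  rw [Ph_sq, ← Real.exp_nat_mul, Real.log_exp]
  simp only [Ph_0, Ph_1, Ph_2, Prod.mk.injEq]
  refine ⟨by push_cast; ring, ?_, trivial⟩
  have : exp s * Real.cos θ / (exp s * Real.sin θ) = Real.tan (π / 2 - θ) := by
    rw [Real.tan_eq_sin_div_cos, Real.sin_pi_div_two_sub, Real.cos_pi_div_two_sub,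
      mul_div_mul_left _ _ (exp_pos _).ne']
  rw [this, Real.arctan_tan (by linarith) (by linarith)]
  ring

section
variable {b₀ L : ℝ}

lemma th0_pos (hb : 0 < b₀) : 0 < Real.arctan b₀ := by
  exact Real.arctan_pos.2 hb

lemma sin_sub_th0 (b₀ θ : ℝ) : Real.sin θ - b₀ * Real.cos θ = Real.sin (θ - Real.arctan b₀) / Real.cos (Real.arctan b₀) := by
  have h := Real.cos_arctan_pos b₀
  rw [eq_div_iff h.ne', Real.sin_sub]
  have : Real.sin (Real.arctan b₀) = b₀ * Real.cos (Real.arctan b₀) := by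
    rw [← Real.tan_mul_cos h.ne', Real.tan_arctan]
  rw [this]; ring

lemma wedgeQL_convex (hL : 0 < L) : Convex ℝ (wedgeQL b₀ L) := by
  intro x hx y hy a b ha hb hab
  obtain ⟨⟨hx0, hx2⟩, hxr⟩ := hx
  obtain ⟨⟨hy0, hy2⟩, hyr⟩ := hy
  rw [rx, Real.sqrt_lt' hL] at hxr hyr
  have key : ∀ u v : ℝ, 0 < u → 0 < v → 0 < a * u + b * v := by
    intro u v hu hv
    rcases ha.eq_or_lt with h | h
    · subst h; simp at hab; subst hab; simpa
    · have := mul_pos h hu; have := mul_nonneg hb hv.le; linarith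
  refine ⟨⟨?_, ?_⟩, ?_⟩
  · simpa using key _ _ hx0 hy0
  · have := key _ _ (sub_pos.2 hx2) (sub_pos.2 hy2)
    simp; nlinarith
  · rw [rx, Real.sqrt_lt' hL]
    have := key _ _ (sub_pos.2 hxr) (sub_pos.2 hyr)
    simp
    have e : b = 1 - a := by linarith
    subst e
    nlinarith [mul_nonneg (mul_nonneg ha hb) (sq_nonneg (x 0 - y 0)), mul_nonneg (mul_nonneg ha hb) (sq_nonneg (x 2 - y 2))]

lemma cont_coord (i : Fin 3) : Continuous fun x : V3 => x i := by fun_prop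

lemma rx_cont : Continuous rx := by unfold rx; fun_prop

lemma wedgeQ_open : IsOpen (wedgeQ b₀) :=
  (isOpen_lt continuous_const (cont_coord 0)).inter (isOpen_lt (continuous_const.mul (cont_coord 0)) (cont_coord 2))

lemma wedgeQL_open : IsOpen (wedgeQL b₀ L) := wedgeQ_open.inter (isOpen_lt rx_cont continuous_const)

lemma wedgeQ_convex : Convex ℝ (wedgeQ b₀) := by
  intro x hx y hy a b ha hb hab
  obtain ⟨hx0, hx2⟩ := hx
  obtain ⟨hy0, hy2⟩ := hy
  have key : ∀ u v : ℝ, 0 < u → 0 < v → 0 < a * u + b * v := by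
    intro u v hu hv
    rcases ha.eq_or_lt with h | h
    · subst h; simp at hab; subst hab; simpa
    · have := mul_pos h hu; have := mul_nonneg hb hv.le; linarith
  refine ⟨?_, ?_⟩
  · simpa using key _ _ hx0 hy0
  · have := key _ _ (sub_pos.2 hx2) (sub_pos.2 hy2)
    simp; nlinarith

lemma closure_subset_Q {x : V3} (hx : x ∈ closure (wedgeQ b₀)) : 0 ≤ x 0 ∧ b₀ * x 0 ≤ x 2 := by
  have : IsClosed {x : V3 | 0 ≤ x 0 ∧ b₀ * x 0 ≤ x 2} :=
    (isClosed_le continuous_const (cont_coord 0)).inter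
      (isClosed_le (continuous_const.mul (cont_coord 0)) (cont_coord 2))
  have hsub : wedgeQ b₀ ⊆ {x : V3 | 0 ≤ x 0 ∧ b₀ * x 0 ≤ x 2} := fun y hy => ⟨hy.1.le, hy.2.le⟩
  exact closure_minimal hsub this hx

lemma closure_subset_QL {x : V3} (hx : x ∈ closure (wedgeQL b₀ L)) : 0 ≤ x 0 ∧ b₀ * x 0 ≤ x 2 ∧ rx x ≤ L := by
  obtain ⟨h1, h2⟩ := closure_subset_Q (closure_mono (fun y hy => hy.1) hx : x ∈ closure (wedgeQ b₀))
  exact ⟨h1, h2, closure_minimal (fun y hy => hy.2.le) (isClosed_le rx_cont continuous_const) hx⟩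

lemma x2_pos (hb : 0 < b₀) {x : V3} (h0 : 0 ≤ x 0) (h2 : b₀ * x 0 ≤ x 2) (he : x ∉ edge) : 0 < x 2 := by
  by_contra h
  push Not at h
  have : 0 ≤ b₀ * x 0 := by positivity
  apply he
  refine ⟨?_, by linarith⟩
  nlinarith

lemma Ph_cont : Continuous Ph := by
  unfold Ph
  apply (PiLp.continuous_toLp 2 _).comp
  refine continuous_pi fun i => ?_
  fin_cases i <;> simp <;> fun_prop

lemma Ph_not_edge (p) : Ph p ∉ edge := by
  intro h
  have := Ph_sq p
  rw [h.1, h.2] at this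
  have := exp_pos p.1
  nlinarith

/-- the angle range -/
def Th (b₀ : ℝ) : Set ℝ := Icc (Real.arctan b₀) (π / 2)

lemma Ph_mem_Q (hb : 0 < b₀) {s θ y : ℝ} (h1 : Real.arctan b₀ < θ) (h2 : θ < π / 2) : Ph (s, θ, y) ∈ wedgeQ b₀ := by
  have h0 := th0_pos hb
  refine ⟨?_, ?_⟩
  · rw [Ph_0]
    exact mul_pos (exp_pos _) (Real.cos_pos_of_mem_Ioo ⟨by simp; linarith, h2⟩)
  · rw [Ph_0, Ph_2]
    have := sin_sub_th0 b₀ θ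
    have h3 : 0 < Real.sin (θ - Real.arctan b₀) / Real.cos (Real.arctan b₀) :=
      div_pos (Real.sin_pos_of_pos_of_lt_pi (by linarith) (by linarith)) (Real.cos_arctan_pos b₀)
    have := exp_pos s
    simp only
    nlinarith

lemma Ph_mem_QL (hb : 0 < b₀) {s θ y : ℝ} (h1 : Real.arctan b₀ < θ) (h2 : θ < π / 2) (hs : exp s < L) :
    Ph (s, θ, y) ∈ wedgeQL b₀ L := ⟨Ph_mem_Q hb h1 h2, by rw [rx_Ph]; exact hs⟩

/-- approximating path from inside -/
def appr (b₀ : ℝ) (p : ℝ × ℝ × ℝ) (ε : ℝ) : ℝ × ℝ × ℝ :=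
  (p.1 - ε, (1 - ε) * p.2.1 + ε * ((Real.arctan b₀ + π / 2) / 2), p.2.2)

lemma appr_cont (p) : Continuous (appr b₀ p) := by unfold appr; fun_prop

lemma appr_zero (p) : appr b₀ p 0 = p := by simp [appr]

lemma appr_tendsto (p) : Tendsto (fun ε => Ph (appr b₀ p ε)) (𝓝[>] 0) (𝓝 (Ph p)) := by
  have := ((Ph_cont.comp (appr_cont (b₀ := b₀) p)).tendsto 0).mono_left (nhdsWithin_le_nhds (s := Ioi 0))
  rw [Function.comp_apply, appr_zero] at this
  exact this

lemma appr_mem (hb : 0 < b₀) {p : ℝ × ℝ × ℝ} (hθ : p.2.1 ∈ Th b₀) (hs : exp p.1 ≤ L) {ε : ℝ} (h0 : 0 < ε) (h1 : ε < 1) :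
    Ph (appr b₀ p ε) ∈ wedgeQL b₀ L := by
  have := Real.arctan_lt_pi_div_two b₀
  obtain ⟨h2, h3⟩ := hθ
  refine Ph_mem_QL hb ?_ ?_ ?_
  · nlinarith
  · nlinarith
  · exact (exp_lt_exp.2 (by linarith)).trans_le hs

lemma Ph_mem_SL (hb : 0 < b₀) {p : ℝ × ℝ × ℝ} (hθ : p.2.1 ∈ Th b₀) (hs : exp p.1 ≤ L) : Ph p ∈ SL b₀ L := by
  refine ⟨mem_closure_of_tendsto (appr_tendsto (b₀ := b₀) p) ?_, Ph_not_edge p⟩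
  filter_upwards [Ioo_mem_nhdsGT (zero_lt_one (α := ℝ))] with ε hε
  exact appr_mem hb hθ hs hε.1 hε.2

lemma SL_sub_SQ : SL b₀ L ⊆ SQ b₀ := sdiff_subset_sdiff_left (closure_mono fun _ h => h.1)

lemma Ph_mem_SQ (hb : 0 < b₀) {p : ℝ × ℝ × ℝ} (hθ : p.2.1 ∈ Th b₀) : Ph p ∈ SQ b₀ :=
  SL_sub_SQ (Ph_mem_SL hb hθ le_rfl)

lemma Ps_ang (hb : 0 < b₀) {x : V3} (h0 : 0 ≤ x 0) (h2 : b₀ * x 0 ≤ x 2) (hx : 0 < x 2) : (Ps x).2.1 ∈ Th b₀ := by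
  refine ⟨?_, ?_⟩
  · show Real.arctan b₀ ≤ π / 2 - Real.arctan (x 0 / x 2)
    have h3 : x 0 / x 2 ≤ b₀⁻¹ := by
      rw [div_le_iff₀ hx, inv_mul_eq_div, le_div_iff₀ hb]; linarith
    have := Real.arctan_mono h3
    rw [Real.arctan_inv_of_pos hb] at this
    linarith
  · show π / 2 - Real.arctan (x 0 / x 2) ≤ π / 2
    have := Real.arctan_nonneg.2 (div_nonneg h0 hx.le)
    linarith

lemma exp_Ps {x : V3} (hx : 0 < x 2) : exp (Ps x).1 = rx x := by
  rw [← rx_Ph, Ph_Ps hx]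

lemma SL_param (hb : 0 < b₀) {x : V3} (hx : x ∈ SL b₀ L) :
    0 < x 2 ∧ (Ps x).2.1 ∈ Th b₀ ∧ exp (Ps x).1 ≤ L ∧ Ph (Ps x) = x := by
  obtain ⟨h0, h2, hr⟩ := closure_subset_QL hx.1
  have hx2 := x2_pos hb h0 h2 hx.2
  exact ⟨hx2, Ps_ang hb h0 h2 hx2, by rwa [exp_Ps hx2], Ph_Ps hx2⟩

lemma wedgeQL_nonempty (hb : 0 < b₀) (hL : 0 < L) : (wedgeQL b₀ L).Nonempty := by
  have := Real.arctan_lt_pi_div_two b₀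
  have h : exp (Real.log L) ≤ L := (exp_log hL).le
  exact ⟨_, appr_mem hb (p := (Real.log L, Real.arctan b₀, 0)) ⟨le_rfl, this.le⟩ h (ε := 1/2) (by norm_num) (by norm_num)⟩

lemma edge_closed : IsClosed edge :=
  (isClosed_eq (cont_coord 0) continuous_const).inter (isClosed_eq (cont_coord 2) continuous_const)

lemma uniq_SL (hb : 0 < b₀) (hL : 0 < L) : UniqueDiffOn ℝ (SL b₀ L) := by
  have h : UniqueDiffOn ℝ (closure (wedgeQL b₀ L)) := by
    refine uniqueDiffOn_convex (wedgeQL_convex hL).closure ?_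
    exact (wedgeQL_nonempty hb hL).mono (interior_maximal subset_closure wedgeQL_open)
  exact h.inter edge_closed.isOpen_compl

lemma uniq_SQ (hb : 0 < b₀) : UniqueDiffOn ℝ (SQ b₀) := by
  have h : UniqueDiffOn ℝ (closure (wedgeQ b₀)) := by
    refine uniqueDiffOn_convex (wedgeQ_convex).closure ?_
    exact ((wedgeQL_nonempty hb one_pos).mono fun _ h => h.1).mono (interior_maximal subset_closure wedgeQ_open)
  exact h.inter edge_closed.isOpen_compl

lemma wedgeQL_sub_SL (_ : 0 < b₀) : wedgeQL b₀ L ⊆ SL b₀ L := fun x hx =>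
  ⟨subset_closure hx, fun h => hx.1.1.ne' h.1⟩

end



abbrev ee (i : Fin 3) : V3 := EuclideanSpace.single i 1

lemma hproj (i : Fin 3) (x : V3) : HasFDerivAt (fun x : V3 => x i) (EuclideanSpace.proj i : V3 →L[ℝ] ℝ) x :=
  (EuclideanSpace.proj i : V3 →L[ℝ] ℝ).hasFDerivAt

lemma fdiv {f g : V3 → ℝ} {f' g' : V3 →L[ℝ] ℝ} {x : V3} (hf : HasFDerivAt f f' x) (hg : HasFDerivAt g g' x)
    (h : g x ≠ 0) : HasFDerivAt (fun x => f x / g x) ((g x)⁻¹ • f' - (f x / g x ^ 2) • g') x := by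
  have h1 := (hasDerivAt_inv h).comp_hasFDerivAt x hg
  have h2 := hf.mul h1
  have e : (fun x => f x / g x) = f * ((fun x => x⁻¹) ∘ g) := by ext x; simp [div_eq_mul_inv]
  rw [e]
  refine h2.congr_fderiv ?_
  ext v
  simp
  field_simp
  ring

lemma hPs {g : ℝ × ℝ × ℝ → ℝ} {A B C : ℝ} {x : V3} (hx : 0 < x 2) (hg : HasFDerivAt g (D3 A B C) (Ps x)) :
    ∃ Λ : V3 →L[ℝ] ℝ, HasFDerivAt (fun x => g (Ps x)) Λ x ∧ Λ (ee 0) = (A * x 0 - B * x 2) / (x 0 ^ 2 + x 2 ^ 2) ∧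
      Λ (ee 1) = C ∧ Λ (ee 2) = (A * x 2 + B * x 0) / (x 0 ^ 2 + x 2 ^ 2) := by
  have hr : 0 < x 0 ^ 2 + x 2 ^ 2 := by positivity
  have h0 := hproj 0 x
  have h1 := hproj 1 x
  have h2 := hproj 2 x
  have hσ := ((((h0.pow 2).add (h2.pow 2)).log hr.ne').mul_const (1/2 : ℝ))
  have hτ := (((fdiv h0 h2 hx.ne').arctan).const_sub (π / 2))
  have hP := hσ.prodMk (hτ.prodMk h1)
  have e : (fun x : V3 => (Real.log (x 0 ^ 2 + x 2 ^ 2) * (1/2), π / 2 - Real.arctan (x 0 / x 2), x 1)) = Ps := by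
    ext x <;> simp [Ps]; ring
  obtain ⟨P', hP'⟩ : ∃ P', P' = _ ∧ HasFDerivAt Ps P' x := ⟨_, rfl, e ▸ hP⟩
  refine ⟨_, hg.comp x hP'.2, ?_, ?_, ?_⟩ <;> rw [hP'.1]
  · simp [D3_apply]
    field_simp
    ring
  · simp [D3_apply]
  · simp [D3_apply]
    field_simp
    ring

lemma Ps_contDiffAt {x : V3} (hx : 0 < x 2) {n : WithTop ℕ∞} : ContDiffAt ℝ n Ps x := by
  have hr : 0 < x 0 ^ 2 + x 2 ^ 2 := by positivity
  have hp : ∀ i : Fin 3, ContDiffAt ℝ n (fun x : V3 => x i) x := fun i =>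
    (EuclideanSpace.proj i : V3 →L[ℝ] ℝ).contDiff.contDiffAt
  unfold Ps
  refine ContDiffAt.prodMk ?_ (ContDiffAt.prodMk ?_ (hp 1))
  · exact ((((hp 0).pow 2).add ((hp 2).pow 2)).log hr.ne').div_const _
  · exact contDiffAt_const.sub (Real.contDiff_arctan.contDiffAt.comp x ((hp 0).div (hp 2) hx.ne'))

section
variable {b₀ L : ℝ}

lemma pd_eq (hb : 0 < b₀) (hL : 0 < L) {g : V3 → ℝ} {Λ : V3 →L[ℝ] ℝ} {x : V3} (hx : x ∈ SL b₀ L)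
    (hg : HasFDerivAt g Λ x) (i : Fin 3) : pdW (SL b₀ L) i g x = Λ (ee i) := by
  unfold pdW
  rw [hg.hasFDerivWithinAt.fderivWithin (uniq_SL hb hL x hx)]

lemma pd_congr {g h : V3 → ℝ} {x : V3} (hx : x ∈ SL b₀ L) (e : ∀ y ∈ SL b₀ L, g y = h y) (i : Fin 3) :
    pdW (SL b₀ L) i g x = pdW (SL b₀ L) i h x := by
  unfold pdW
  rw [fderivWithin_congr e (e x hx)]

lemma pk_pd (hb : 0 < b₀) (hL : 0 < L) (K : Pk) {x : V3} (hx : x ∈ SL b₀ L) :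
    pdW (SL b₀ L) 0 (fun x => K.u (Ps x)) x = (K.us (Ps x) * x 0 - K.ut (Ps x) * x 2) / (x 0 ^ 2 + x 2 ^ 2) ∧
    pdW (SL b₀ L) 1 (fun x => K.u (Ps x)) x = K.uy (Ps x) ∧
    pdW (SL b₀ L) 2 (fun x => K.u (Ps x)) x = (K.us (Ps x) * x 2 + K.ut (Ps x) * x 0) / (x 0 ^ 2 + x 2 ^ 2) := by
  obtain ⟨Λ, h, h0, h1, h2⟩ := hPs (SL_param hb hx).1 (K.h0 (Ps x))
  rw [pd_eq hb hL hx h, pd_eq hb hL hx h, pd_eq hb hL hx h]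
  exact ⟨h0, h1, h2⟩

lemma pk_lap (hb : 0 < b₀) (hL : 0 < L) (K : Pk) {x : V3} (hx : x ∈ SL b₀ L) :
    lapW (SL b₀ L) (fun x => K.u (Ps x)) x =
      (K.uss (Ps x) + K.utt (Ps x)) / (x 0 ^ 2 + x 2 ^ 2) + K.uyy (Ps x) := by
  have hx2 := (SL_param hb hx).1
  have hr : 0 < x 0 ^ 2 + x 2 ^ 2 := by positivity
  obtain ⟨Λs, hs, s0, s1, s2⟩ := hPs hx2 (K.hs (Ps x))
  obtain ⟨Λt, ht, t0, t1, t2⟩ := hPs hx2 (K.ht (Ps x))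
  obtain ⟨Λy, hy, y0, y1, y2⟩ := hPs hx2 (K.hy (Ps x))
  have p0 := hproj 0 x
  have p2 := hproj 2 x
  have hρ := (p0.pow 2).add (p2.pow 2)
  have H0 := fdiv ((hs.mul p0).sub (ht.mul p2)) hρ hr.ne'
  have H2 := fdiv ((hs.mul p2).add (ht.mul p0)) hρ hr.ne'
  unfold lapW
  rw [Fin.sum_univ_three, pd_congr hx (fun y hy => (pk_pd hb hL K hy).1),
    pd_congr hx (fun y hy => (pk_pd hb hL K hy).2.1) 1, pd_congr hx (fun y hy => (pk_pd hb hL K hy).2.2) 2,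
    pd_eq hb hL hx hy, y1]
  erw [pd_eq hb hL hx H0 0, pd_eq hb hL hx H2 2]
  simp [s0, s2, t0, t2]
  field_simp
  ring

end



section
variable {b₀ L : ℝ}

lemma Ps_orig (hb : 0 < b₀) : Tendsto Ps (𝓝[SL b₀ L] 0) orig := by
  unfold orig
  refine tendsto_inf.2 ⟨tendsto_comap_iff.2 ?_, tendsto_comap_iff.2 ?_⟩
  · show Tendsto (fun x : V3 => Real.log (x 0 ^ 2 + x 2 ^ 2) / 2) (𝓝[SL b₀ L] 0) atBot
    apply Tendsto.atBot_div_const (by norm_num)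
    refine Real.tendsto_log_nhdsGT_zero.comp ?_
    refine tendsto_nhdsWithin_iff.2 ⟨?_, ?_⟩
    · have : Continuous fun x : V3 => x 0 ^ 2 + x 2 ^ 2 := by fun_prop
      have := (this.tendsto 0).mono_left (nhdsWithin_le_nhds (s := SL b₀ L))
      simpa using this
    · filter_upwards [self_mem_nhdsWithin] with x hx
      have := (SL_param hb hx).1
      show 0 < x 0 ^ 2 + x 2 ^ 2
      positivity
  · show Tendsto (fun x : V3 => x 1) (𝓝[SL b₀ L] 0) (𝓝 0)
    have := ((cont_coord 1).tendsto 0).mono_left (nhdsWithin_le_nhds (s := SL b₀ L))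
    simpa using this

lemma sol_of_pk (hb : 0 < b₀) (hL : 0 < L) (K : Pk) (f : V3 → ℝ)
    (hpde : ∀ p : ℝ × ℝ × ℝ, exp p.1 < L → p.2.1 ∈ Th b₀ →
      K.uss p + K.utt p + exp (2 * p.1) * K.uyy p = exp (2 * p.1) * f (Ph p))
    (hus : ∀ θ y, K.us (Real.log L, θ, y) = L * cutoffConst b₀ L f)
    (hut0 : ∀ s y, K.ut (s, Real.arctan b₀, y) = 0) (hut1 : ∀ s y, K.ut (s, π / 2, y) = 0)
    (hper : ∀ s θ y, K.u (s, θ, y + 2 * π) = K.u (s, θ, y)) (hlim : Tendsto K.u orig (𝓝 0)) :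
    IsCutoffSolution b₀ L f (fun x => K.u (Ps x)) := by
  refine ⟨fun x hx => ?_, fun x hx => ?_, fun x hx h _ => ?_, fun x hx h _ => ?_, fun x hx h => ?_, fun x hx => ?_, ?_⟩
  · exact (K.contDiff.contDiffAt.comp x (Ps_contDiffAt (SL_param hb hx).1)).contDiffWithinAt
  · have hx' := wedgeQL_sub_SL hb hx
    obtain ⟨h2, hθ, hs, e⟩ := SL_param hb hx'
    rw [pk_lap hb hL K hx']
    have hr : x 0 ^ 2 + x 2 ^ 2 = exp (2 * (Ps x).1) := by
      have := Ph_sq (Ps x)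
      rw [e] at this
      rw [this, ← Real.exp_nat_mul]; norm_num
    have := hpde (Ps x) (by rw [exp_Ps h2]; exact hx.2) hθ
    rw [e] at this
    rw [hr]
    have h3 := exp_pos (2 * (Ps x).1)
    field_simp
    linarith
  · obtain ⟨h2, hθ, hs, e⟩ := SL_param hb hx
    have hr : 0 < x 0 ^ 2 + x 2 ^ 2 := by positivity
    obtain ⟨p0, -, p2⟩ := pk_pd hb hL K hx
    rw [p0, p2]
    have : Ps x = ((Ps x).1, Real.arctan b₀, (Ps x).2.2) := by
      have : (Ps x).2.1 = Real.arctan b₀ := by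
        show π / 2 - Real.arctan (x 0 / x 2) = _
        have h0 : x 0 / x 2 = b₀⁻¹ := by
          rw [h] at h2 ⊢
          have : 0 < x 0 := by
            by_contra hc; push Not at hc; nlinarith
          field_simp
        rw [h0, Real.arctan_inv_of_pos hb]; ring
      rw [← this]
    have h0 : K.ut (Ps x) = 0 := by rw [this]; exact hut0 _ _
    rw [h0, h]
    field_simp
    ring
  · obtain ⟨h2, hθ, hs, e⟩ := SL_param hb hx
    obtain ⟨p0, -, p2⟩ := pk_pd hb hL K hx
    rw [p0]
    have : Ps x = ((Ps x).1, π / 2, (Ps x).2.2) := by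
      have : (Ps x).2.1 = π / 2 := by
        show π / 2 - Real.arctan (x 0 / x 2) = _
        simp [h]
      rw [← this]
    have h0 : K.ut (Ps x) = 0 := by rw [this]; exact hut1 _ _
    rw [h0, h]
    simp
  · obtain ⟨h2, hθ, hs, e⟩ := SL_param hb hx
    have hr : 0 < x 0 ^ 2 + x 2 ^ 2 := by positivity
    obtain ⟨p0, -, p2⟩ := pk_pd hb hL K hx
    rw [p0, p2]
    have hl : (Ps x).1 = Real.log L := by
      rw [← Real.log_exp (Ps x).1, exp_Ps h2, h]
    have h0 : K.us (Ps x) = L * cutoffConst b₀ L f := by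
      have : Ps x = (Real.log L, (Ps x).2.1, (Ps x).2.2) := by rw [← hl]
      rw [this]; exact hus _ _
    rw [h0]
    field_simp
    ring
  · have : Ps (x + EuclideanSpace.single 1 (2 * π)) = ((Ps x).1, (Ps x).2.1, (Ps x).2.2 + 2 * π) := by
      simp [Ps]
    show K.u (Ps (x + EuclideanSpace.single 1 (2 * π))) = _
    rw [this, hper]
  · exact hlim.comp (Ps_orig hb)
end



lemma Ph_eq (p : ℝ × ℝ × ℝ) : Ph p = (exp p.1 * Real.cos p.2.1) • ee 0 + (p.2.2 • ee 1 + (exp p.1 * Real.sin p.2.1) • ee 2) := by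
  ext i
  fin_cases i <;> simp [Ph]

lemma Ph_dt (s θ y : ℝ) : HasDerivAt (fun θ => Ph (s, θ, y)) ((-(exp s * Real.sin θ)) • ee 0 + (exp s * Real.cos θ) • ee 2) θ := by
  have h := (((Real.hasDerivAt_cos θ).const_mul (exp s)).smul_const (ee 0)).add
    (((hasDerivAt_const θ (y • ee 1))).add (((Real.hasDerivAt_sin θ).const_mul (exp s)).smul_const (ee 2)))
  have e : (fun θ => Ph (s, θ, y)) = fun θ => (exp s * Real.cos θ) • ee 0 + (y • ee 1 + (exp s * Real.sin θ) • ee 2) := by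
    ext1 θ; rw [Ph_eq]
  rw [e]
  convert! h using 1
  simp

lemma Ph_dy (s θ y : ℝ) : HasDerivAt (fun y => Ph (s, θ, y)) (ee 1) y := by
  have h := (hasDerivAt_const y ((exp s * Real.cos θ) • ee 0)).add
    (((hasDerivAt_id y).smul_const (ee 1)).add (hasDerivAt_const y ((exp s * Real.sin θ) • ee 2)))
  have e : (fun y => Ph (s, θ, y)) = fun y => (exp s * Real.cos θ) • ee 0 + (y • ee 1 + (exp s * Real.sin θ) • ee 2) := by
    ext1 y; rw [Ph_eq]
  rw [e]
  convert! h using 1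
  simp

lemma Ph_ds (s θ y : ℝ) : HasDerivAt (fun s => Ph (s, θ, y)) ((exp s * Real.cos θ) • ee 0 + (exp s * Real.sin θ) • ee 2) s := by
  have h := (((Real.hasDerivAt_exp s).mul_const (Real.cos θ)).smul_const (ee 0)).add
    (((hasDerivAt_const s (y • ee 1))).add (((Real.hasDerivAt_exp s).mul_const (Real.sin θ)).smul_const (ee 2)))
  have e : (fun s => Ph (s, θ, y)) = fun s => (exp s * Real.cos θ) • ee 0 + (y • ee 1 + (exp s * Real.sin θ) • ee 2) := by
    ext1 s; rw [Ph_eq]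
  rw [e]
  convert! h using 1
  simp

section
variable {b₀ L : ℝ} {f : V3 → ℝ}

/-- evaluated iterated derivatives -/
def TT (b₀ : ℝ) (f : V3 → ℝ) (k : ℕ) (m : Fin k → V3) (x : V3) : ℝ := iteratedFDerivWithin ℝ k f (SQ b₀) x m

lemma TT_zero (m) (x) : TT b₀ f 0 m x = f x := by simp [TT]

lemma TT_deriv (hb : 0 < b₀) (hf : ContDiffOn ℝ 4 f (SQ b₀)) {k : ℕ} (hk : k < 4) (m : Fin k → V3) {x : V3} (hx : x ∈ SQ b₀) :
    ∃ Λ : V3 →L[ℝ] ℝ, HasFDerivWithinAt (TT b₀ f k m) Λ (SQ b₀) x ∧ ∀ v, Λ v = TT b₀ f (k+1) (Fin.cons v m) x := by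
  have h1 := (hf.differentiableOn_iteratedFDerivWithin (m := k) (by exact_mod_cast hk) (uniq_SQ hb)) x hx
  have h2 := h1.hasFDerivWithinAt
  have h3 := ((ContinuousMultilinearMap.apply ℝ (fun _ : Fin k => V3) ℝ m).hasFDerivAt).comp_hasFDerivWithinAt x h2
  refine ⟨_, h3, fun v => ?_⟩
  unfold TT
  rw [iteratedFDerivWithin_succ_apply_left]
  simp

lemma TT_dt (hb : 0 < b₀) (hf : ContDiffOn ℝ 4 f (SQ b₀)) {k : ℕ} (hk : k < 4) (m : Fin k → V3) (s : ℝ) {θ : ℝ}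
    (hθ : θ ∈ Th b₀) (y : ℝ) : HasDerivWithinAt (fun θ => TT b₀ f k m (Ph (s, θ, y)))
      (-(exp s * Real.sin θ) * TT b₀ f (k+1) (Fin.cons (ee 0) m) (Ph (s, θ, y)) +
        (exp s * Real.cos θ) * TT b₀ f (k+1) (Fin.cons (ee 2) m) (Ph (s, θ, y))) (Th b₀) θ := by
  obtain ⟨Λ, h, e⟩ := TT_deriv hb hf hk m (x := Ph (s, θ, y)) (Ph_mem_SQ hb hθ)
  have := h.comp_hasDerivWithinAt θ (Ph_dt s θ y).hasDerivWithinAt (s := Th b₀) (fun t ht => Ph_mem_SQ hb ht)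
  convert! this using 1
  rw [map_add, map_smul, map_smul, e, e]
  simp

lemma TT_dy (hb : 0 < b₀) (hf : ContDiffOn ℝ 4 f (SQ b₀)) {k : ℕ} (hk : k < 4) (m : Fin k → V3) (s : ℝ) {θ : ℝ}
    (hθ : θ ∈ Th b₀) (y : ℝ) : HasDerivAt (fun y => TT b₀ f k m (Ph (s, θ, y)))
      (TT b₀ f (k+1) (Fin.cons (ee 1) m) (Ph (s, θ, y))) y := by
  obtain ⟨Λ, h, e⟩ := TT_deriv hb hf hk m (x := Ph (s, θ, y)) (Ph_mem_SQ hb hθ)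
  have := h.comp_hasDerivWithinAt y (Ph_dy s θ y).hasDerivWithinAt (s := univ) (fun t ht => Ph_mem_SQ hb hθ)
  rw [e, hasDerivWithinAt_univ] at this
  exact this

lemma TT_cont (hb : 0 < b₀) (hf : ContDiffOn ℝ 4 f (SQ b₀)) {k : ℕ} (hk : k ≤ 4) (m : Fin k → V3) :
    ContinuousOn (TT b₀ f k m) (SQ b₀) := by
  have h1 := (hf.continuousOn_iteratedFDerivWithin (m := k) (by exact_mod_cast hk) (uniq_SQ hb))
  exact (ContinuousMultilinearMap.apply ℝ (fun _ : Fin k => V3) ℝ m).continuous.comp_continuousOn h1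

lemma f_bound (hb : 0 < b₀) (hf : ContDiffOn ℝ 4 f (SQ b₀)) {δ δ₀ M : ℝ} (hδ0 : 0 < δ) (hδ1 : δ < 1) (hδ₀1 : δ₀ < 1)
    (hδ₀0 : 0 < δ₀)
    (h : wsupLE (SQ b₀) 4 (1 - δ) (2 - δ₀) (wedgeQL b₀ L) f M) {k : ℕ} (hk : k ≤ 4) {p : ℝ × ℝ × ℝ}
    (hθ : p.2.1 ∈ Th b₀) (hs : exp p.1 ≤ L) :
    exp (2 * p.1) * (exp p.1 ^ k * ‖iteratedFDerivWithin ℝ k f (SQ b₀) (Ph p)‖) ≤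
      M * min (exp ((1 + δ) * p.1)) (exp (δ₀ * p.1)) := by
  -- interior
  have hInt : ∀ q : ℝ × ℝ × ℝ, Ph q ∈ wedgeQL b₀ L → q.1 ≠ 0 → 
      exp (2 * q.1) * (exp q.1 ^ k * ‖iteratedFDerivWithin ℝ k f (SQ b₀) (Ph q)‖) ≤
      M * min (exp ((1 + δ) * q.1)) (exp (δ₀ * q.1)) := by
    intro q hq hq0
    rcases lt_or_gt_of_ne hq0 with h0 | h0
    · have := h.1 k hk _ hq (by rw [rx_Ph]; exact exp_pos _) (by rw [rx_Ph, ← Real.exp_zero]; exact exp_lt_exp.2 h0)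
      have hk0 : (0:ℝ) ≤ k := Nat.cast_nonneg k
      rw [rx_Ph, max_eq_left (by linarith), ← Real.exp_mul] at this
      rw [min_eq_left (exp_le_exp.2 (by nlinarith))]
      have h2 := mul_le_mul_of_nonneg_right this (exp_pos ((1 + δ) * q.1)).le
      refine le_of_eq_of_le ?_ h2
      rw [← Real.exp_nat_mul, ← mul_assoc, ← Real.exp_add, mul_right_comm, ← Real.exp_add]
      congr 2; ring
    · have := h.2 k hk _ hq (by rw [rx_Ph]; exact one_lt_exp_iff.2 h0)
      rw [rx_Ph, ← Real.exp_mul] at this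
      rw [min_eq_right (exp_le_exp.2 (by nlinarith))]
      have h2 := mul_le_mul_of_nonneg_right this (exp_pos (δ₀ * q.1)).le
      refine le_of_eq_of_le ?_ h2
      rw [← Real.exp_nat_mul, ← mul_assoc, ← Real.exp_add, mul_right_comm, ← Real.exp_add]
      congr 2; ring
  have ht0 : Tendsto (appr b₀ p) (𝓝[>] 0) (𝓝 p) := by
    have := ((appr_cont (b₀ := b₀) p).tendsto 0).mono_left (nhdsWithin_le_nhds (s := Ioi 0))
    rwa [appr_zero] at this
  have hc : Continuous fun q : ℝ × ℝ × ℝ => exp (2 * q.1) * exp q.1 ^ k := by fun_prop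
  have hc2 : Continuous fun q : ℝ × ℝ × ℝ => M * min (exp ((1 + δ) * q.1)) (exp (δ₀ * q.1)) := by fun_prop
  have h1 := (hf.continuousOn_iteratedFDerivWithin (m := k) (by exact_mod_cast hk) (uniq_SQ hb)) (Ph p) (Ph_mem_SQ hb hθ)
  have hmem : ∀ᶠ ε in 𝓝[>] (0:ℝ), Ph (appr b₀ p ε) ∈ wedgeQL b₀ L := by
    filter_upwards [Ioo_mem_nhdsGT (zero_lt_one (α := ℝ))] with ε hε
    exact appr_mem hb hθ hs hε.1 hε.2
  have ht1 : Tendsto (fun ε => Ph (appr b₀ p ε)) (𝓝[>] 0) (𝓝[SQ b₀] (Ph p)) := by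
    refine tendsto_nhdsWithin_iff.2 ⟨appr_tendsto p, ?_⟩
    filter_upwards [hmem] with ε hε
    exact SL_sub_SQ (wedgeQL_sub_SL hb hε)
  have hA := (h1.norm.tendsto.comp ht1)
  have hlhs := ((hc.tendsto p).comp ht0).mul hA
  have hrhs := (hc2.tendsto p).comp ht0
  have := le_of_tendsto_of_tendsto hlhs hrhs ?_
  · simpa [mul_assoc] using this
  · have hne : ∀ᶠ ε in 𝓝[>] (0:ℝ), ε ≠ p.1 := by
      by_cases hp : p.1 = 0
      · filter_upwards [self_mem_nhdsWithin] with ε (hε : 0 < ε)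
        rw [hp]; exact hε.ne'
      · exact nhdsWithin_le_nhds (isOpen_ne.mem_nhds (Ne.symm hp))
    filter_upwards [hmem, hne] with ε h1 h2
    have := hInt _ h1 (by simp only [appr]; intro h; apply h2; linarith)
    simpa [mul_assoc] using this

lemma TT_bound (hb : 0 < b₀) (hf : ContDiffOn ℝ 4 f (SQ b₀)) {δ δ₀ M : ℝ} (hδ0 : 0 < δ) (hδ1 : δ < 1) (hδ₀1 : δ₀ < 1)
    (hδ₀0 : 0 < δ₀)
    (h : wsupLE (SQ b₀) 4 (1 - δ) (2 - δ₀) (wedgeQL b₀ L) f M) {k : ℕ} (hk : k ≤ 4) {p : ℝ × ℝ × ℝ}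
    (hθ : p.2.1 ∈ Th b₀) (hs : exp p.1 ≤ L) (m : Fin k → V3) (hm : ∀ i, ‖m i‖ ≤ 1) :
    exp (2 * p.1) * (exp p.1 ^ k * |TT b₀ f k m (Ph p)|) ≤ M * min (exp ((1 + δ) * p.1)) (exp (δ₀ * p.1)) := by
  refine le_trans ?_ (f_bound hb hf hδ0 hδ1 hδ₀1 hδ₀0 h hk hθ hs)
  have h1 : |TT b₀ f k m (Ph p)| ≤ ‖iteratedFDerivWithin ℝ k f (SQ b₀) (Ph p)‖ := by
    have := (iteratedFDerivWithin ℝ k f (SQ b₀) (Ph p)).le_opNorm m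
    refine this.trans (mul_le_of_le_one_right (norm_nonneg _) ?_)
    exact Finset.prod_le_one (fun i _ => norm_nonneg _) (fun i _ => hm i)
  gcongr
end



lemma theta_parts {θ₀ θ₁ κ b : ℝ} (h01 : θ₀ < θ₁) (hκ : κ * (θ₁ - θ₀) = π) (hκ1 : 1 ≤ κ) (hω : θ₁ - θ₀ ≤ 2) {q q1 q2 : ℝ → ℝ}
    (h1 : ∀ θ ∈ Icc θ₀ θ₁, HasDerivWithinAt q (q1 θ) (Icc θ₀ θ₁) θ)
    (h2 : ∀ θ ∈ Icc θ₀ θ₁, HasDerivWithinAt q1 (q2 θ) (Icc θ₀ θ₁) θ)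
    (h3 : ContinuousOn q2 (Icc θ₀ θ₁))
    (b0' : ∀ θ ∈ Icc θ₀ θ₁, |q θ| ≤ b) (b1' : ∀ θ ∈ Icc θ₀ θ₁, |q1 θ| ≤ b) (b2' : ∀ θ ∈ Icc θ₀ θ₁, |q2 θ| ≤ b) (j : ℤ) :
    (1 + (j : ℝ) ^ 2) * |∫ θ in θ₀..θ₁, q θ * Real.cos (κ * j * (θ - θ₀))| ≤ 6 * b := by
  set μ := κ * j with hμ
  have hb : 0 ≤ b := (abs_nonneg _).trans (b0' θ₀ ⟨le_rfl, h01.le⟩)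
  have cq : ContinuousOn q (Icc θ₀ θ₁) := fun θ hθ => (h1 θ hθ).continuousWithinAt
  have cq1 : ContinuousOn q1 (Icc θ₀ θ₁) := fun θ hθ => (h2 θ hθ).continuousWithinAt
  have cc : Continuous fun θ => Real.cos (μ * (θ - θ₀)) := by fun_prop
  have cs : Continuous fun θ => Real.sin (μ * (θ - θ₀)) := by fun_prop
  have hi : ∀ {g : ℝ → ℝ}, ContinuousOn g (Icc θ₀ θ₁) → IntervalIntegrable (fun θ => g θ * Real.cos (μ * (θ - θ₀))) volume θ₀ θ₁ := by
    intro g hg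
    apply ContinuousOn.intervalIntegrable
    rw [uIcc_of_le h01.le]
    exact hg.mul cc.continuousOn
  have hbd : ∀ {g : ℝ → ℝ}, (∀ θ ∈ Icc θ₀ θ₁, |g θ| ≤ b) → |∫ θ in θ₀..θ₁, g θ * Real.cos (μ * (θ - θ₀))| ≤ b * 2 := by
    intro g hg
    have := intervalIntegral.norm_integral_le_of_norm_le_const (a := θ₀) (b := θ₁) (C := b)
      (f := fun θ => g θ * Real.cos (μ * (θ - θ₀))) (fun θ hθ => by
        rw [uIoc_of_le h01.le] at hθ
        rw [norm_mul]
        exact (mul_le_of_le_one_right (norm_nonneg _) (Real.abs_cos_le_one _)).trans (hg θ ⟨hθ.1.le, hθ.2⟩))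
    rw [abs_of_pos (sub_pos.2 h01)] at this
    exact this.trans (mul_le_mul_of_nonneg_left hω hb)
  have hftc : ∫ θ in θ₀..θ₁, (q2 θ * Real.cos (μ * (θ - θ₀)) + μ ^ 2 * (q θ * Real.cos (μ * (θ - θ₀)))) =
      (q1 θ₁ * Real.cos (μ * (θ₁ - θ₀)) + μ * (q θ₁ * Real.sin (μ * (θ₁ - θ₀)))) -
      (q1 θ₀ * Real.cos (μ * (θ₀ - θ₀)) + μ * (q θ₀ * Real.sin (μ * (θ₀ - θ₀)))) := by
    refine intervalIntegral.integral_eq_sub_of_hasDerivAt_of_le (f := fun θ => q1 θ * Real.cos (μ * (θ - θ₀)) + μ * (q θ * Real.sin (μ * (θ - θ₀)))) h01.le ?_ (fun θ hθ => ?_) ?_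
    · exact (cq1.mul cc.continuousOn).add (continuousOn_const.mul (cq.mul cs.continuousOn))
    · have hn : Icc θ₀ θ₁ ∈ 𝓝 θ := Icc_mem_nhds hθ.1 hθ.2
      have d0 := (h1 θ ⟨hθ.1.le, hθ.2.le⟩).hasDerivAt hn
      have d1 := (h2 θ ⟨hθ.1.le, hθ.2.le⟩).hasDerivAt hn
      have dl : HasDerivAt (fun θ => μ * (θ - θ₀)) μ θ := by
        simpa using ((hasDerivAt_id θ).sub_const θ₀).const_mul μ
      have := (d1.mul dl.cos).add ((d0.mul dl.sin).const_mul μ)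
      convert! this using 1
      ring
    · exact (hi h3).add ((hi cq).const_mul _)
  rw [intervalIntegral.integral_add (hi h3) ((hi cq).const_mul _), intervalIntegral.integral_const_mul] at hftc
  have e1 : Real.sin (μ * (θ₁ - θ₀)) = 0 := by
    rw [hμ, show κ * j * (θ₁ - θ₀) = j * (κ * (θ₁ - θ₀)) by ring, hκ]; exact Real.sin_int_mul_pi j
  rw [e1] at hftc
  simp only [sub_self, mul_zero, Real.sin_zero, Real.cos_zero, mul_one, add_zero] at hftc
  have i0 := hbd b0'
  have i2 := hbd b2'
  set I := ∫ θ in θ₀..θ₁, q θ * Real.cos (μ * (θ - θ₀))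
  set I2 := ∫ θ in θ₀..θ₁, q2 θ * Real.cos (μ * (θ - θ₀))
  have hend : |q1 θ₁ * Real.cos (μ * (θ₁ - θ₀))| ≤ b := by
    rw [abs_mul]
    exact (mul_le_of_le_one_right (abs_nonneg _) (Real.abs_cos_le_one _)).trans (b1' θ₁ ⟨h01.le, le_rfl⟩)
  have hst := b1' θ₀ ⟨le_rfl, h01.le⟩
  have hμI : μ ^ 2 * |I| ≤ 4 * b := by
    rw [show μ ^ 2 * |I| = |μ ^ 2 * I| by rw [abs_mul, abs_of_nonneg (sq_nonneg μ)]]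
    rw [show μ ^ 2 * I = q1 θ₁ * Real.cos (μ * (θ₁ - θ₀)) - q1 θ₀ - I2 by linarith]
    rw [abs_le] at *
    constructor <;> linarith [hend.1, hend.2, hst.1, hst.2, i2.1, i2.2]
  have hjμ : (j : ℝ) ^ 2 ≤ μ ^ 2 := by
    rw [hμ, mul_pow]
    exact le_mul_of_one_le_left (sq_nonneg _) (one_le_pow₀ hκ1)
  have := mul_le_mul_of_nonneg_right hjμ (abs_nonneg I)
  nlinarith

lemma y_parts {g g1 g2 : ℝ → ℝ} (h1 : ∀ y, HasDerivAt g (g1 y) y) (h2 : ∀ y, HasDerivAt g1 (g2 y) y) (h3 : Continuous g2)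
    (hp : ∀ y, g (y + 2 * π) = g y) (m : ℤ) :
    (m : ℂ) ^ 2 * ∫ y in (0:ℝ)..2 * π, (g y : ℂ) * Complex.exp (-(Complex.I * m * y)) =
      - ∫ y in (0:ℝ)..2 * π, (g2 y : ℂ) * Complex.exp (-(Complex.I * m * y)) := by
  have hp1 : ∀ y, g1 (y + 2 * π) = g1 y := by
    intro y
    have := (h1 (y + 2 * π)).comp_add_const y (2 * π)
    exact (this.congr_of_eventuallyEq (Eventually.of_forall fun z => (hp z).symm)).unique (h1 y)
  have cg : Continuous g := continuous_iff_continuousAt.2 fun y => (h1 y).continuousAt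
  have hE : ∀ y : ℝ, HasDerivAt (fun y : ℝ => Complex.exp (-(Complex.I * m * y)))
      (Complex.exp (-(Complex.I * m * y)) * (-(Complex.I * m))) y := by
    intro y
    have : HasDerivAt (fun y : ℝ => -(Complex.I * m * (y : ℂ))) (-(Complex.I * m)) y := by
      have := ((hasDerivAt_id y).ofReal_comp.const_mul (Complex.I * m)).neg
      convert! this using 1
      simp
    exact this.cexp
  have hEp : Complex.exp (-(Complex.I * m * ((2 * π : ℝ) : ℂ))) = 1 := by
    rw [show -(Complex.I * (m:ℂ) * ((2 * π : ℝ) : ℂ)) = ((-m : ℤ) : ℂ) * (2 * π * Complex.I) by push_cast; ring]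
    exact Complex.exp_int_mul_two_pi_mul_I (-m)
  have cE : Continuous fun y : ℝ => Complex.exp (-(Complex.I * m * y)) := by fun_prop
  have hftc : ∫ y in (0:ℝ)..2 * π, ((g2 y : ℂ) * Complex.exp (-(Complex.I * m * y)) +
      (m : ℂ) ^ 2 * ((g y : ℂ) * Complex.exp (-(Complex.I * m * y)))) =
      ((g1 (2 * π) : ℂ) * Complex.exp (-(Complex.I * m * ((2 * π : ℝ) : ℂ))) +
        Complex.I * m * ((g (2 * π) : ℂ) * Complex.exp (-(Complex.I * m * ((2 * π : ℝ) : ℂ))))) -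
      ((g1 0 : ℂ) * Complex.exp (-(Complex.I * m * ((0 : ℝ) : ℂ))) +
        Complex.I * m * ((g 0 : ℂ) * Complex.exp (-(Complex.I * m * ((0 : ℝ) : ℂ))))) := by
    refine intervalIntegral.integral_eq_sub_of_hasDerivAt (f := fun y : ℝ => (g1 y : ℂ) * Complex.exp (-(Complex.I * m * y)) +
        Complex.I * m * ((g y : ℂ) * Complex.exp (-(Complex.I * m * y)))) (fun y _ => ?_) ?_
    · have := ((h2 y).ofReal_comp.mul (hE y)).add (((h1 y).ofReal_comp.mul (hE y)).const_mul (Complex.I * m))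
      convert! this using 1
      linear_combination ((m:ℂ)^2 * g y * Complex.exp (-(Complex.I * m * y))) * Complex.I_sq
    · apply Continuous.intervalIntegrable
      fun_prop
  have q0 : g (2 * π) = g 0 := by simpa using hp 0
  have q1 : g1 (2 * π) = g1 0 := by simpa using hp1 0
  rw [intervalIntegral.integral_add, intervalIntegral.integral_const_mul, hEp, q0, q1] at hftc
  · simp at hftc
    linear_combination hftc
  · apply Continuous.intervalIntegrable; fun_prop
  · apply Continuous.intervalIntegrable; fun_prop

lemma y_inv {g : ℝ → ℂ} (hg : Continuous g) (hp : ∀ y, g (y + 2 * π) = g y) (c : ℤ → ℂ)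
    (hc : ∀ m : ℤ, c m = (1 / (2 * π) : ℂ) * ∫ y in (0:ℝ)..2 * π, g y * Complex.exp (-(Complex.I * m * y)))
    (hs : Summable c) (y : ℝ) : HasSum (fun m : ℤ => c m * Complex.exp (Complex.I * m * y)) (g y) := by
  have : Fact (0 < 2 * π) := ⟨by positivity⟩
  have hper : Function.Periodic g (2 * π) := hp
  have hcont : Continuous hper.lift := continuous_quot_lift _ hg
  set G : C(AddCircle (2 * π), ℂ) := ⟨hper.lift, hcont⟩
  have hG : ∀ y : ℝ, G (y : AddCircle (2 * π)) = g y := fun y => hper.lift_coe y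
  have hcoef : ∀ m, fourierCoeff G m = c m := by
    intro m
    rw [fourierCoeff_eq_intervalIntegral _ m 0, hc m, zero_add, Complex.real_smul]
    congr 1
    · push_cast; rfl
    · congr 1; ext y
      rw [hG, fourier_coe_apply, smul_eq_mul, mul_comm]
      congr 2
      push_cast
      field_simp
  have h := has_pointwise_sum_fourier_series_of_summable (f := G) (by simpa [funext hcoef] using hs) (y : AddCircle (2 * π))
  rw [hG] at h
  convert! h using 1
  ext m
  rw [hcoef, fourier_coe_apply, smul_eq_mul]
  congr 2
  push_cast
  field_simp

lemma theta_inv {θ₀ θ₁ κ : ℝ} (h01 : θ₀ < θ₁) (hκ : κ * (θ₁ - θ₀) = π) {h : ℝ → ℂ} (hh : Continuous h) (c : ℤ → ℂ)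
    (hc : ∀ j : ℤ, c j = (1 / (θ₁ - θ₀) : ℂ) * ∫ θ in θ₀..θ₁, h θ * (Real.cos (κ * j * (θ - θ₀)) : ℂ))
    (hs : Summable c) {θ : ℝ} (hθ : θ ∈ Icc θ₀ θ₁) :
    HasSum (fun j : ℤ => c j * (Real.cos (κ * j * (θ - θ₀)) : ℂ)) (h θ) := by
  set ω := θ₁ - θ₀ with hω
  have hω0 : 0 < ω := sub_pos.2 h01
  have : Fact (0 < 2 * ω) := ⟨by positivity⟩
  set G : C(AddCircle (2 * ω), ℂ) := ⟨fun x => h (θ₀ + ‖x‖), by fun_prop⟩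
  have hG : ∀ x : ℝ, |x| ≤ ω → G (x : AddCircle (2 * ω)) = h (θ₀ + |x|) := fun x hx => by
    show h (θ₀ + ‖(x : AddCircle (2 * ω))‖) = _
    rw [(AddCircle.norm_coe_eq_abs_iff (2 * ω) (by positivity)).2]
    rw [abs_of_pos (by linarith : (0:ℝ) < 2 * ω)]; linarith
  have hfou : ∀ (n : ℤ) (x : ℝ), fourier n (x : AddCircle (2 * ω)) = Complex.exp (((κ * n * x : ℝ) : ℂ) * Complex.I) := by
    intro n x
    rw [fourier_coe_apply]
    congr 1
    rw [← hκ]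
    have : (ω : ℂ) ≠ 0 := by exact_mod_cast hω0.ne'
    push_cast
    field_simp
  have hκ' : ((2 * ω : ℝ) : ℂ) ≠ 0 := by exact_mod_cast (by positivity : (2 * ω) ≠ 0)
  have hcoef : ∀ j, fourierCoeff G j = c j := by
    intro j
    rw [fourierCoeff_eq_intervalIntegral _ j (-ω), hc j, show -ω + 2 * ω = ω by ring, Complex.real_smul]
    have hcont : Continuous fun x : ℝ => fourier (-j) (x : AddCircle (2 * ω)) • G (x : AddCircle (2 * ω)) := by
      refine Continuous.smul (f := fun x : ℝ => fourier (-j) (x : AddCircle (2 * ω))) (g := fun x : ℝ => G (x : AddCircle (2 * ω))) ?_ ?_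
      · exact (map_continuous (fourier (-j))).comp (AddCircle.continuous_mk' _)
      · exact (map_continuous G).comp (AddCircle.continuous_mk' _)
    rw [← intervalIntegral.integral_add_adjacent_intervals (b := 0) (hcont.intervalIntegrable _ _) (hcont.intervalIntegrable _ _)]
    have e1 := intervalIntegral.integral_comp_neg (a := 0) (b := ω) (fun x : ℝ => fourier (-j) (x : AddCircle (2 * ω)) • G (x : AddCircle (2 * ω)))
    rw [neg_zero] at e1
    rw [← e1, ← intervalIntegral.integral_add]
    · have e2 := intervalIntegral.integral_comp_add_left (a := 0) (b := ω) (fun θ => h θ * (Real.cos (κ * j * (θ - θ₀)) : ℂ)) θ₀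
      rw [show θ₀ + ω = θ₁ by rw [hω]; ring, add_zero] at e2
      rw [← e2]
      have e3 : ∫ x in (0:ℝ)..ω, (fourier (-j) ((-x : ℝ) : AddCircle (2 * ω)) • G ((-x : ℝ) : AddCircle (2 * ω)) + fourier (-j) (x : AddCircle (2 * ω)) • G (x : AddCircle (2 * ω))) =
          ∫ x in (0:ℝ)..ω, 2 * (h (θ₀ + x) * (Real.cos (κ * j * (θ₀ + x - θ₀)) : ℂ)) := by
        refine intervalIntegral.integral_congr fun x hx => ?_
        rw [uIcc_of_le hω0.le] at hx
        have hx' : |x| ≤ ω := by rw [abs_of_nonneg hx.1]; exact hx.2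
        rw [hG x hx', hG (-x) (by rwa [abs_neg]), abs_neg, abs_of_nonneg hx.1, hfou, hfou, add_sub_cancel_left]
        rw [show κ * ((-j : ℤ) : ℝ) * -x = κ * j * x by push_cast; ring, show κ * ((-j : ℤ) : ℝ) * x = -(κ * j * x) by push_cast; ring]
        rw [Complex.ofReal_cos, Complex.cos]
        simp only [smul_eq_mul, Complex.ofReal_neg]
        ring
      rw [e3, intervalIntegral.integral_const_mul, ← mul_assoc]
      congr 1
      have : (ω : ℂ) ≠ 0 := by exact_mod_cast hω0.ne'
      push_cast
      rw [← Complex.ofReal_sub, ← hω]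
      field_simp
    · exact (hcont.comp continuous_neg).intervalIntegrable _ _
    · exact hcont.intervalIntegrable _ _
  have hsum : Summable (fourierCoeff G) := by simpa [funext hcoef] using hs
  have hx : |θ - θ₀| ≤ ω := by rw [abs_of_nonneg (by linarith [hθ.1])]; linarith [hθ.2]
  have h1 := has_pointwise_sum_fourier_series_of_summable hsum ((θ - θ₀ : ℝ) : AddCircle (2 * ω))
  have h2 := has_pointwise_sum_fourier_series_of_summable hsum ((-(θ - θ₀) : ℝ) : AddCircle (2 * ω))
  rw [hG _ hx] at h1
  rw [hG _ (by rwa [abs_neg]), abs_neg] at h2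
  rw [abs_of_nonneg (by linarith [hθ.1]), add_sub_cancel] at h1 h2
  have h3 := (h1.add h2).mul_left (1/2 : ℂ)
  convert! h3 using 1
  · ext j
    rw [hcoef, hfou, hfou, Complex.ofReal_cos, Complex.cos]
    rw [show κ * j * -(θ - θ₀) = -(κ * j * (θ - θ₀)) by ring]
    simp only [smul_eq_mul, Complex.ofReal_neg]
    ring
  · ring



section
variable {b₀ L : ℝ} {f : V3 → ℝ}

def clampT (b₀ θ : ℝ) : ℝ := max (Real.arctan b₀) (min θ (π / 2))

lemma clampT_mem (θ : ℝ) : clampT b₀ θ ∈ Th b₀ :=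
  ⟨le_max_left _ _, max_le (Real.arctan_lt_pi_div_two b₀).le (min_le_right _ _)⟩

lemma clampT_eq {θ : ℝ} (h : θ ∈ Th b₀) : clampT b₀ θ = θ := by
  unfold clampT; rw [min_eq_left h.2, max_eq_right h.1]

lemma clampT_cont : Continuous (clampT b₀) := by unfold clampT; fun_prop

def FF (b₀ : ℝ) (f : V3 → ℝ) (s θ y : ℝ) : ℝ := exp (2 * s) * f (Ph (s, clampT b₀ θ, y))

lemma FF_cont (hb : 0 < b₀) (hf : ContinuousOn f (SQ b₀)) : Continuous fun p : ℝ × ℝ × ℝ => FF b₀ f p.1 p.2.1 p.2.2 := by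
  unfold FF
  have h1 : Continuous fun p : ℝ × ℝ × ℝ => Ph (p.1, clampT b₀ p.2.1, p.2.2) := by
    have := clampT_cont (b₀ := b₀)
    exact Ph_cont.comp (by fun_prop)
  have h2 := hf.comp_continuous h1 (fun p => Ph_mem_SQ hb (clampT_mem _))
  exact (by fun_prop : Continuous fun p : ℝ × ℝ × ℝ => exp (2 * p.1)).mul h2

/-- Fourier coefficient in `y`. -/
def hm (b₀ : ℝ) (f : V3 → ℝ) (m : ℤ) (s θ : ℝ) : ℂ :=
  (1 / (2 * π) : ℂ) * ∫ y in (0:ℝ)..2 * π, (FF b₀ f s θ y : ℂ) * Complex.exp (-(Complex.I * m * y))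

def kap (b₀ : ℝ) : ℝ := π / (π / 2 - Real.arctan b₀)

/-- Full Fourier coefficient. -/
def Fco (b₀ : ℝ) (f : V3 → ℝ) (n : ℤ × ℤ) (s : ℝ) : ℂ :=
  (1 / ((π / 2 : ℝ) - (Real.arctan b₀ : ℝ)) : ℂ) * ∫ θ in (Real.arctan b₀)..(π / 2),
    hm b₀ f n.2 s θ * (Real.cos (kap b₀ * n.1 * (θ - Real.arctan b₀)) : ℂ)

lemma hm_cont (hb : 0 < b₀) (hf : ContinuousOn f (SQ b₀)) (m : ℤ) : Continuous fun p : ℝ × ℝ => hm b₀ f m p.1 p.2 := by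
  unfold hm
  refine continuous_const.mul (intervalIntegral.continuous_parametric_intervalIntegral_of_continuous' ?_ _ _)
  have h1 := FF_cont hb hf
  have h2 : Continuous fun q : (ℝ × ℝ) × ℝ => FF b₀ f q.1.1 q.1.2 q.2 :=
    h1.comp (by fun_prop : Continuous fun q : (ℝ × ℝ) × ℝ => (q.1.1, q.1.2, q.2))
  show Continuous fun q : (ℝ × ℝ) × ℝ => (FF b₀ f q.1.1 q.1.2 q.2 : ℂ) * Complex.exp (-(Complex.I * m * q.2))
  fun_prop

lemma Fco_cont (hb : 0 < b₀) (hf : ContinuousOn f (SQ b₀)) (n : ℤ × ℤ) : Continuous (Fco b₀ f n) := by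
  unfold Fco
  refine continuous_const.mul (intervalIntegral.continuous_parametric_intervalIntegral_of_continuous' ?_ _ _)
  have h1 := hm_cont hb hf n.2
  show Continuous fun q : ℝ × ℝ => hm b₀ f n.2 q.1 q.2 * (Real.cos (kap b₀ * n.1 * (q.2 - Real.arctan b₀)) : ℂ)
  fun_prop

lemma kap_mul (b₀ : ℝ) : kap b₀ * (π / 2 - Real.arctan b₀) = π := by
  have := Real.arctan_lt_pi_div_two b₀
  unfold kap
  rw [div_mul_cancel₀]; linarith

lemma kap_ge (hb : 0 < b₀) : 2 ≤ kap b₀ := by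
  have := Real.arctan_lt_pi_div_two b₀
  have := th0_pos hb
  unfold kap
  rw [le_div_iff₀ (by linarith)]; linarith

lemma per_Ph (hb : 0 < b₀) (hp : Per2On (closure (wedgeQ b₀)) f) {s θ : ℝ} (hθ : θ ∈ Th b₀) (y : ℝ) :
    f (Ph (s, θ, y + 2 * π)) = f (Ph (s, θ, y)) := by
  rw [← hp _ (Ph_mem_SQ (p := (s, θ, y)) hb hθ).1]
  congr 1
  ext i
  fin_cases i <;> simp [Ph]

lemma dt2 (hb : 0 < b₀) (hf : ContDiffOn ℝ 4 f (SQ b₀)) {k : ℕ} (hk : k ≤ 2) (m : Fin k → V3) (s y X : ℝ)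
    (hm : ∀ i, ‖m i‖ ≤ 1)
    (hX : ∀ l ≤ 4, ∀ m : Fin l → V3, (∀ i, ‖m i‖ ≤ 1) → ∀ θ ∈ Th b₀, exp s ^ l * |TT b₀ f l m (Ph (s, θ, y))| ≤ X) :
    ∃ U1 U2 : ℝ → ℝ, (∀ θ ∈ Th b₀, HasDerivWithinAt (fun θ => TT b₀ f k m (Ph (s, θ, y))) (U1 θ) (Th b₀) θ) ∧
      (∀ θ ∈ Th b₀, HasDerivWithinAt U1 (U2 θ) (Th b₀) θ) ∧ ContinuousOn U2 (Th b₀) ∧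
      (∀ θ ∈ Th b₀, exp s ^ k * |U1 θ| ≤ 2 * X) ∧ (∀ θ ∈ Th b₀, exp s ^ k * |U2 θ| ≤ 6 * X) := by
  have hc0 : ∀ {l : ℕ} {m : Fin l → V3} (i : Fin 3), (∀ i, ‖m i‖ ≤ 1) → ∀ i', ‖(Fin.cons (ee i) m : Fin (l+1) → V3) i'‖ ≤ 1 := by
    intro l m i h i'
    refine Fin.cases ?_ (fun j => ?_) i'
    · simp
    · simpa using h j
  set T1 : Fin 3 → ℝ → ℝ := fun i θ => TT b₀ f (k+1) (Fin.cons (ee i) m) (Ph (s, θ, y)) with hT1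
  set T2 : Fin 3 → Fin 3 → ℝ → ℝ := fun i j θ => TT b₀ f (k+2) (Fin.cons (ee i) (Fin.cons (ee j) m)) (Ph (s, θ, y)) with hT2
  have hd1 : ∀ i, ∀ θ ∈ Th b₀, HasDerivWithinAt (T1 i) (-(exp s * Real.sin θ) * T2 0 i θ + (exp s * Real.cos θ) * T2 2 i θ) (Th b₀) θ :=
    fun i θ hθ => TT_dt hb hf (by omega) _ s hθ y
  have hcT : ∀ {l : ℕ} (_ : l ≤ 4) (m : Fin l → V3), ContinuousOn (fun θ => TT b₀ f l m (Ph (s, θ, y))) (Th b₀) := by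
    intro l hl m
    refine (TT_cont hb hf hl m).comp ?_ (fun θ hθ => Ph_mem_SQ hb hθ)
    exact (Ph_cont.comp (by fun_prop : Continuous fun θ : ℝ => (s, θ, y))).continuousOn
  have hc1 : ∀ i, ContinuousOn (T1 i) (Th b₀) := fun i => hcT (by omega) _
  have hc2 : ∀ i j, ContinuousOn (T2 i j) (Th b₀) := fun i j => hcT (by omega) _
  have b1 : ∀ i, ∀ θ ∈ Th b₀, exp s ^ k * (exp s * |T1 i θ|) ≤ X := fun i θ hθ => by
    have := hX (k+1) (by omega) (Fin.cons (ee i) m) (hc0 i hm) θ hθ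
    rw [pow_succ, mul_assoc] at this; exact this
  have b2 : ∀ i j, ∀ θ ∈ Th b₀, exp s ^ k * (exp s * (exp s * |T2 i j θ|)) ≤ X := fun i j θ hθ => by
    have := hX (k+2) (by omega) (Fin.cons (ee i) (Fin.cons (ee j) m)) (hc0 i (hc0 j hm)) θ hθ
    rw [pow_succ, pow_succ, mul_assoc, mul_assoc] at this; exact this
  have hr := exp_pos s
  have a1 : ∀ i (c : ℝ), |c| ≤ 1 → ∀ θ ∈ Th b₀, |exp s ^ k * (exp s * c * T1 i θ)| ≤ X := by
    intro i c hc θ hθ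
    refine le_trans ?_ (b1 i θ hθ)
    rw [abs_mul, abs_mul, abs_mul, abs_of_pos hr, abs_of_pos (pow_pos hr k)]
    gcongr
    exact mul_le_of_le_one_right hr.le hc
  have a2 : ∀ i j (c d : ℝ), |c| ≤ 1 → |d| ≤ 1 → ∀ θ ∈ Th b₀, |exp s ^ k * (exp s * c * (exp s * d * T2 i j θ))| ≤ X := by
    intro i j c d hc hd θ hθ
    refine le_trans ?_ (b2 i j θ hθ)
    rw [abs_mul, abs_mul, abs_mul, abs_mul, abs_mul, abs_of_pos hr, abs_of_pos (pow_pos hr k)]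
    gcongr
    · exact mul_le_of_le_one_right hr.le hc
    · exact mul_le_of_le_one_right hr.le hd
  have hsn : ∀ θ, |Real.sin θ| ≤ 1 := Real.abs_sin_le_one
  have hcs : ∀ θ, |Real.cos θ| ≤ 1 := Real.abs_cos_le_one
  refine ⟨fun θ => -(exp s * Real.sin θ) * T1 0 θ + (exp s * Real.cos θ) * T1 2 θ, fun θ =>
    (-(exp s * Real.cos θ) * T1 0 θ + -(exp s * Real.sin θ) * (-(exp s * Real.sin θ) * T2 0 0 θ + (exp s * Real.cos θ) * T2 2 0 θ)) +
    ((exp s * -Real.sin θ) * T1 2 θ + (exp s * Real.cos θ) * (-(exp s * Real.sin θ) * T2 0 2 θ + (exp s * Real.cos θ) * T2 2 2 θ)),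
    fun θ hθ => TT_dt hb hf (by omega) m s hθ y, fun θ hθ => ?_, ?_, fun θ hθ => ?_, fun θ hθ => ?_⟩
  · have s1 := ((Real.hasDerivAt_sin θ).const_mul (exp s)).neg.hasDerivWithinAt (s := Th b₀)
    have s2 := ((Real.hasDerivAt_cos θ).const_mul (exp s)).hasDerivWithinAt (s := Th b₀)
    exact (s1.mul (hd1 0 θ hθ)).add (s2.mul (hd1 2 θ hθ))
  · have := hc1 0; have := hc1 2; have := hc2 0 0; have := hc2 2 0; have := hc2 0 2; have := hc2 2 2
    fun_prop
  · have e1 := a1 0 _ (hsn θ) θ hθ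
    have e2 := a1 2 _ (hcs θ) θ hθ
    rw [← abs_of_pos (pow_pos hr k), ← abs_mul]
    rw [abs_le] at *
    constructor <;> linarith [e1.1, e1.2, e2.1, e2.2]
  · have e1 := a1 0 _ (hcs θ) θ hθ
    have e2 := a1 2 _ (hsn θ) θ hθ
    have e3 := a2 0 0 _ _ (hsn θ) (hsn θ) θ hθ
    have e4 := a2 2 0 _ _ (hsn θ) (hcs θ) θ hθ
    have e5 := a2 0 2 _ _ (hcs θ) (hsn θ) θ hθ
    have e6 := a2 2 2 _ _ (hcs θ) (hcs θ) θ hθ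
    rw [← abs_of_pos (pow_pos hr k), ← abs_mul]
    rw [abs_le] at *
    constructor <;> linarith [e1.1, e1.2, e2.1, e2.2, e3.1, e3.2, e4.1, e4.2, e5.1, e5.2, e6.1, e6.2]
end



section
variable {b₀ L : ℝ} {f : V3 → ℝ}

abbrev m11 : Fin 2 → V3 := Fin.cons (ee 1) (Fin.cons (ee 1) (Fin.elim0 : Fin 0 → V3))

def qq (b₀ : ℝ) (f : V3 → ℝ) (s θ y : ℝ) : ℝ :=
  exp (2 * s) * (TT b₀ f 0 Fin.elim0 (Ph (s, clampT b₀ θ, y)) - exp (2 * s) * TT b₀ f 2 m11 (Ph (s, clampT b₀ θ, y)))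

lemma qq_cont (hb : 0 < b₀) (hf : ContDiffOn ℝ 4 f (SQ b₀)) (s : ℝ) : Continuous fun p : ℝ × ℝ => qq b₀ f s p.1 p.2 := by
  have h1 : Continuous fun p : ℝ × ℝ => Ph (s, clampT b₀ p.1, p.2) := by
    have := clampT_cont (b₀ := b₀)
    exact Ph_cont.comp (by fun_prop)
  have h2 := (TT_cont hb hf (k := 0) (by norm_num) Fin.elim0).comp_continuous h1 (fun p => Ph_mem_SQ hb (clampT_mem _))
  have h3 := (TT_cont hb hf (k := 2) (by norm_num) m11).comp_continuous h1 (fun p => Ph_mem_SQ hb (clampT_mem _))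
  unfold qq
  fun_prop

lemma hm_qq (hb : 0 < b₀) (hf : ContDiffOn ℝ 4 f (SQ b₀)) (hp : Per2On (closure (wedgeQ b₀)) f) (m : ℤ) (s θ : ℝ) :
    (1 + (m:ℂ) ^ 2 * exp (2 * s)) * hm b₀ f m s θ =
      (1 / (2 * π) : ℂ) * ∫ y in (0:ℝ)..2 * π, (qq b₀ f s θ y : ℂ) * Complex.exp (-(Complex.I * m * y)) := by
  have hθ := clampT_mem (b₀ := b₀) θ
  have d1 := fun y => TT_dy hb hf (k := 0) (by norm_num) Fin.elim0 s hθ y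
  have d2 := fun y => TT_dy hb hf (k := 1) (by norm_num) (Fin.cons (ee 1) Fin.elim0) s hθ y
  have hy : Continuous fun y : ℝ => Ph (s, clampT b₀ θ, y) := Ph_cont.comp (by fun_prop)
  have c2 := (TT_cont hb hf (k := 2) (by norm_num) m11).comp_continuous hy (fun y => Ph_mem_SQ hb hθ)
  have c0 := (TT_cont hb hf (k := 0) (by norm_num) Fin.elim0).comp_continuous hy (fun y => Ph_mem_SQ hb hθ)
  have key := y_parts (g := fun y => TT b₀ f 0 Fin.elim0 (Ph (s, clampT b₀ θ, y))) d1 d2 c2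
    (fun y => by simp only [TT_zero]; exact per_Ph hb hp hθ y) m
  unfold hm
  have e1 : ∀ y, FF b₀ f s θ y = exp (2 * s) * TT b₀ f 0 Fin.elim0 (Ph (s, clampT b₀ θ, y)) := fun y => by
    rw [TT_zero]; rfl
  have cE : Continuous fun y : ℝ => Complex.exp (-(Complex.I * m * y)) := by fun_prop
  have i0 : ∫ y in (0:ℝ)..2 * π, (FF b₀ f s θ y : ℂ) * Complex.exp (-(Complex.I * m * y)) =
     (exp (2 * s) : ℂ) * ∫ y in (0:ℝ)..2 * π, (TT b₀ f 0 Fin.elim0 (Ph (s, clampT b₀ θ, y)) : ℂ) * Complex.exp (-(Complex.I * m * y)) := by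
    rw [← intervalIntegral.integral_const_mul]
    congr 1; ext y; rw [e1]; push_cast; ring
  have i1 : ∫ y in (0:ℝ)..2 * π, (qq b₀ f s θ y : ℂ) * Complex.exp (-(Complex.I * m * y)) =
     (exp (2 * s) : ℂ) * ((∫ y in (0:ℝ)..2 * π, (TT b₀ f 0 Fin.elim0 (Ph (s, clampT b₀ θ, y)) : ℂ) * Complex.exp (-(Complex.I * m * y)))
     - (exp (2 * s) : ℂ) * ∫ y in (0:ℝ)..2 * π, (TT b₀ f 2 m11 (Ph (s, clampT b₀ θ, y)) : ℂ) * Complex.exp (-(Complex.I * m * y))) := by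
    rw [← intervalIntegral.integral_const_mul (exp (2 * s) : ℂ), ← intervalIntegral.integral_sub, ← intervalIntegral.integral_const_mul]
    · congr 1; ext y; unfold qq; push_cast; ring
    · exact ((Complex.continuous_ofReal.comp c0).mul cE).intervalIntegrable _ _
    · exact (continuous_const.mul ((Complex.continuous_ofReal.comp c2).mul cE)).intervalIntegrable _ _
  rw [i0, i1]
  have : ∫ y in (0:ℝ)..2 * π, (TT b₀ f 2 m11 (Ph (s, clampT b₀ θ, y)) : ℂ) * Complex.exp (-(Complex.I * m * y)) =
    - ((m : ℂ) ^ 2 * ∫ y in (0:ℝ)..2 * π, (TT b₀ f 0 Fin.elim0 (Ph (s, clampT b₀ θ, y)) : ℂ) * Complex.exp (-(Complex.I * m * y))) := by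
    rw [key, neg_neg]
  rw [this]; ring

lemma Fco_qq (hb : 0 < b₀) (hf : ContDiffOn ℝ 4 f (SQ b₀)) (hp : Per2On (closure (wedgeQ b₀)) f) (n : ℤ × ℤ) (s : ℝ) :
    (1 + (n.2:ℂ) ^ 2 * exp (2 * s)) * Fco b₀ f n s =
      (1 / ((π / 2 : ℝ) - (Real.arctan b₀ : ℝ)) : ℂ) * ((1 / (2 * π) : ℂ) * ∫ y in (0:ℝ)..2 * π,
        Complex.exp (-(Complex.I * n.2 * y)) * ((∫ θ in (Real.arctan b₀)..(π / 2), qq b₀ f s θ y * Real.cos (kap b₀ * n.1 * (θ - Real.arctan b₀)) : ℝ) : ℂ)) := by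
  unfold Fco
  rw [mul_left_comm]
  congr 1
  have hq := qq_cont hb hf s
  have hsw := MeasureTheory.intervalIntegral_intervalIntegral_swap (a := Real.arctan b₀) (b := π / 2) (c := 0) (d := 2 * π)
    (F := fun θ y : ℝ => (qq b₀ f s θ y : ℂ) * Complex.exp (-(Complex.I * n.2 * y)) * (Real.cos (kap b₀ * n.1 * (θ - Real.arctan b₀)) : ℂ)) 
    (by
      have : Continuous (Function.uncurry fun θ y : ℝ => (qq b₀ f s θ y : ℂ) * Complex.exp (-(Complex.I * n.2 * y)) * (Real.cos (kap b₀ * n.1 * (θ - Real.arctan b₀)) : ℂ)) := by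
        show Continuous fun p : ℝ × ℝ => (qq b₀ f s p.1 p.2 : ℂ) * Complex.exp (-(Complex.I * n.2 * p.2)) * (Real.cos (kap b₀ * n.1 * (p.1 - Real.arctan b₀)) : ℂ)
        fun_prop
      have h2 := this.continuousOn.integrableOn_compact (μ := volume) (isCompact_uIcc.prod isCompact_uIcc : IsCompact (uIcc (Real.arctan b₀) (π/2) ×ˢ uIcc (0:ℝ) (2*π)))
      refine IntegrableOn.mono_set ?_ (Set.prod_mono uIoc_subset_uIcc uIoc_subset_uIcc)
      exact h2)
  rw [← intervalIntegral.integral_const_mul]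
  have : ∀ θ, (1 + (n.2:ℂ) ^ 2 * exp (2 * s)) * (hm b₀ f n.2 s θ * (Real.cos (kap b₀ * n.1 * (θ - Real.arctan b₀)) : ℂ)) =
     (1 / (2 * π) : ℂ) * ∫ y in (0:ℝ)..2 * π, (qq b₀ f s θ y : ℂ) * Complex.exp (-(Complex.I * n.2 * y)) * (Real.cos (kap b₀ * n.1 * (θ - Real.arctan b₀)) : ℂ) := by
    intro θ
    rw [← mul_assoc, hm_qq hb hf hp, mul_assoc, intervalIntegral.integral_mul_const]
  simp_rw [this]
  rw [intervalIntegral.integral_const_mul, hsw]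
  congr 2
  ext y
  rw [← intervalIntegral.integral_ofReal, ← intervalIntegral.integral_const_mul]
  congr 1; ext θ; push_cast; ring

lemma Fco_bound (hb : 0 < b₀) (hf : ContDiffOn ℝ 4 f (SQ b₀)) (hp : Per2On (closure (wedgeQ b₀)) f)
    {δ δ₀ M : ℝ} (hδ0 : 0 < δ) (hδ1 : δ < 1) (hδ₀1 : δ₀ < 1) (hδ₀0 : 0 < δ₀)
    (h : wsupLE (SQ b₀) 4 (1-δ) (2-δ₀) (wedgeQL b₀ L) f M) (n : ℤ × ℤ) {s : ℝ} (hs : exp s ≤ L) :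
    ‖Fco b₀ f n s‖ ≤ fb (1 + δ) δ₀ (72 / (π / 2 - Real.arctan b₀) * M) n.1 n.2 s := by
  have hω : 0 < π / 2 - Real.arctan b₀ := by linarith [Real.arctan_lt_pi_div_two b₀]
  set ω := π / 2 - Real.arctan b₀ with hωd
  set μ := min (exp ((1+δ)*s)) (exp (δ₀*s)) with hμ
  set X := M * μ / exp (2 * s) with hX
  have hE := exp_pos (2 * s)
  have hXE : exp (2 * s) * X = M * μ := by rw [hX]; field_simp
  have hTT : ∀ y, ∀ l ≤ 4, ∀ m : Fin l → V3, (∀ i, ‖m i‖ ≤ 1) → ∀ θ ∈ Th b₀, exp s ^ l * |TT b₀ f l m (Ph (s, θ, y))| ≤ X := by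
    intro y l hl m hm θ hθ
    have := TT_bound hb hf hδ0 hδ1 hδ₀1 hδ₀0 h hl (p := (s, θ, y)) hθ hs m hm
    rw [hX, le_div_iff₀ hE, mul_comm]
    exact this
  have m11b : ∀ i, ‖m11 i‖ ≤ 1 := by
    intro i; fin_cases i <;> simp [m11]
  have hex : exp s ^ 2 = exp (2 * s) := by rw [← exp_nat_mul]; norm_num
  have hInt : ∀ y, (1 + (n.1 : ℝ) ^ 2) * |∫ θ in (Real.arctan b₀)..(π / 2), qq b₀ f s θ y * Real.cos (kap b₀ * n.1 * (θ - Real.arctan b₀))| ≤ 6 * (12 * (M * μ)) := by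
    intro y
    obtain ⟨U1, U2, a1, a2, a3, a4, a5⟩ := dt2 hb hf (k := 0) (by norm_num) Fin.elim0 s y X (fun i => i.elim0) (hTT y)
    obtain ⟨W1, W2, e1, e2, e3, e4, e5⟩ := dt2 hb hf (k := 2) le_rfl m11 s y X m11b (hTT y)
    have z0 := hTT y 0 (by norm_num) Fin.elim0 (fun i => i.elim0)
    have z2 := hTT y 2 (by norm_num) m11 m11b
    rw [hex] at e4 e5 z2
    simp only [pow_zero, one_mul] at a4 a5 z0
    have hX0 : 0 ≤ X := (abs_nonneg _).trans (z0 (π/2) ⟨(Real.arctan_lt_pi_div_two b₀).le, le_rfl⟩)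
    have hcomb : ∀ {a c A B : ℝ}, |a| ≤ A → exp (2*s) * |c| ≤ B → A + B ≤ 12 * X → |exp (2 * s) * (a - exp (2 * s) * c)| ≤ 12 * (M * μ) := by
      intro a c A B h1 h2 h3
      rw [abs_mul, abs_of_pos hE, ← hXE, mul_left_comm]
      refine mul_le_mul_of_nonneg_left ?_ hE.le
      refine (abs_sub _ _).trans ?_
      rw [abs_mul, abs_of_pos hE]; linarith
    have := theta_parts (θ₀ := Real.arctan b₀) (θ₁ := π / 2) (κ := kap b₀) (b := 12 * (M * μ)) (Real.arctan_lt_pi_div_two b₀) (kap_mul b₀)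
      (by linarith [kap_ge hb]) (by linarith [th0_pos hb, pi_lt_four])
      (q := fun θ => exp (2 * s) * (TT b₀ f 0 Fin.elim0 (Ph (s, θ, y)) - exp (2 * s) * TT b₀ f 2 m11 (Ph (s, θ, y))))
      (q1 := fun θ => exp (2 * s) * (U1 θ - exp (2 * s) * W1 θ))
      (q2 := fun θ => exp (2 * s) * (U2 θ - exp (2 * s) * W2 θ))
      (fun θ hθ => ((a1 θ hθ).sub ((e1 θ hθ).const_mul _)).const_mul _)
      (fun θ hθ => ((a2 θ hθ).sub ((e2 θ hθ).const_mul _)).const_mul _)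
      (by change ContinuousOn _ (Th b₀); fun_prop)
      (fun θ hθ => hcomb (z0 θ hθ) (z2 θ hθ) (by linarith))
      (fun θ hθ => hcomb (a4 θ hθ) (e4 θ hθ) (by linarith))
      (fun θ hθ => hcomb (a5 θ hθ) (e5 θ hθ) (by linarith)) n.1
    refine le_trans (le_of_eq ?_) this
    congr 2
    refine intervalIntegral.integral_congr fun θ hθ => ?_
    rw [uIcc_of_le (Real.arctan_lt_pi_div_two b₀).le] at hθ
    simp only [qq, clampT_eq hθ]
  have hj : (0:ℝ) < 1 + (n.1:ℝ)^2 := by positivity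
  have hm : (0:ℝ) < 1 + (n.2:ℝ)^2 * exp (2*s) := by positivity
  have key := congrArg norm (Fco_qq hb hf hp n s)
  have hn1 : ‖(1 + (n.2:ℂ) ^ 2 * exp (2 * s))‖ = 1 + (n.2:ℝ)^2 * exp (2*s) := by
    have : (1 + (n.2:ℂ) ^ 2 * exp (2 * s)) = ((1 + (n.2:ℝ)^2 * exp (2*s) : ℝ) : ℂ) := by push_cast; rfl
    rw [this, Complex.norm_real, Real.norm_of_nonneg hm.le]
  have hn2 : ‖(1 / ((π / 2 : ℝ) - (Real.arctan b₀ : ℝ)) : ℂ)‖ = 1 / ω := by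
    rw [← Complex.ofReal_sub, ← Complex.ofReal_one, ← Complex.ofReal_div, Complex.norm_real, Real.norm_of_nonneg (by positivity)]
  have hn3 : ‖(1 / (2 * π) : ℂ)‖ = 1 / (2 * π) := by
    have : (1 / (2 * π) : ℂ) = ((1 / (2 * π) : ℝ) : ℂ) := by push_cast; rfl
    rw [this, Complex.norm_real, Real.norm_of_nonneg (by positivity)]
  rw [norm_mul, norm_mul, norm_mul, hn1, hn2, hn3] at key
  have hI := intervalIntegral.norm_integral_le_of_norm_le_const (a := 0) (b := 2 * π) (C := 6 * (12 * (M * μ)) / (1 + (n.1 : ℝ) ^ 2))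
    (f := fun y : ℝ => Complex.exp (-(Complex.I * n.2 * y)) * ((∫ θ in (Real.arctan b₀)..(π / 2), qq b₀ f s θ y * Real.cos (kap b₀ * n.1 * (θ - Real.arctan b₀)) : ℝ) : ℂ))
    (fun y _ => by
      have : Complex.exp (-(Complex.I * n.2 * y)) = Complex.exp (((-(n.2 * y) : ℝ) : ℂ) * Complex.I) := by congr 1; push_cast; ring
      rw [norm_mul, this, Complex.norm_exp_ofReal_mul_I, one_mul, Complex.norm_real, Real.norm_eq_abs, le_div_iff₀ hj, mul_comm]
      exact hInt y)
  rw [sub_zero, abs_of_pos (by positivity : (0:ℝ) < 2 * π)] at hI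
  unfold fb
  rw [le_div_iff₀ (by positivity)]
  calc ‖Fco b₀ f n s‖ * ((1 + (n.1:ℝ) ^ 2) * (1 + (n.2:ℝ) ^ 2 * exp (2 * s)))
      = (1 + (n.1:ℝ)^2) * ((1 + (n.2:ℝ)^2 * exp (2*s)) * ‖Fco b₀ f n s‖) := by ring
    _ ≤ (1 + (n.1:ℝ)^2) * (1 / ω * (1 / (2 * π) * (6 * (12 * (M * μ)) / (1 + (n.1 : ℝ) ^ 2) * (2 * π)))) := by
        rw [key]; gcongr
    _ = 72 / ω * M * μ := by field_simp; ring

lemma FF_inv (hb : 0 < b₀) (hf : ContDiffOn ℝ 4 f (SQ b₀)) (hp : Per2On (closure (wedgeQ b₀)) f)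
    {δ δ₀ M : ℝ} (hδ0 : 0 < δ) (hδ1 : δ < 1) (hδ₀1 : δ₀ < 1) (hδ₀0 : 0 < δ₀)
    (h : wsupLE (SQ b₀) 4 (1-δ) (2-δ₀) (wedgeQL b₀ L) f M) {s : ℝ} (hs : exp s ≤ L) {θ : ℝ} (hθ : θ ∈ Th b₀) (y : ℝ) {S : ℂ}
    (hS : HasSum (fun n : ℤ × ℤ => Fco b₀ f n s * b0 (kap b₀) (Real.arctan b₀) n θ * c0 n y) S) : S = FF b₀ f s θ y := by
  have hfc := hf.continuousOn
  have h' := ((Equiv.prodComm ℤ ℤ).hasSum_iff).2 hS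
  have hm0 : ∀ m : ℤ, Summable fun j : ℤ => Fco b₀ f (j, m) s := by
    intro m
    refine Summable.of_norm_bounded (summable_inv_one_add_sq.mul_left
      (72 / (π / 2 - Real.arctan b₀) * M * min (exp ((1 + δ) * s)) (exp (δ₀ * s)) / (1 + (m : ℝ) ^ 2 * exp (2 * s)))) fun j => ?_
    refine (Fco_bound hb hf hp hδ0 hδ1 hδ₀1 hδ₀0 h (j, m) hs).trans (le_of_eq ?_)
    simp only [fb]
    field_simp
  have hfib : ∀ m : ℤ, HasSum (fun j : ℤ => Fco b₀ f (j, m) s * b0 (kap b₀) (Real.arctan b₀) (j, m) θ * c0 (j, m) y)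
      (hm b₀ f m s θ * Complex.exp (Complex.I * m * y)) := by
    intro m
    have hc : Continuous (fun θ => hm b₀ f m s θ) := by
      have h1 := (hm_cont hb hfc m)
      have h2 : Continuous fun θ : ℝ => (s, θ) := by fun_prop
      have h3 := Continuous.comp h1 h2
      exact h3
    have := theta_inv (Real.arctan_lt_pi_div_two b₀) (kap_mul b₀) hc (fun j => Fco b₀ f (j, m) s) (fun j => by simp only [Fco]) (hm0 m) hθ
    exact this.mul_right _
  have h2 : HasSum (fun m : ℤ => hm b₀ f m s θ * Complex.exp (Complex.I * m * y)) S :=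
    HasSum.prod_fiberwise h' hfib
  have hFc : Continuous fun y => (FF b₀ f s θ y : ℂ) :=
    Complex.continuous_ofReal.comp ((FF_cont hb hfc).comp (by fun_prop : Continuous fun y : ℝ => (s, θ, y)))
  have hsum : Summable fun m => hm b₀ f m s θ := by
    refine Summable.of_norm ?_
    refine h2.summable.norm.congr fun m => ?_
    have : Complex.exp (Complex.I * m * y) = Complex.exp (((m * y : ℝ) : ℂ) * Complex.I) := by congr 1; push_cast; ring
    rw [norm_mul, this, Complex.norm_exp_ofReal_mul_I, mul_one]
  have h3 := y_inv hFc (fun y => by unfold FF; rw [per_Ph hb hp (clampT_mem _)]) (fun m => hm b₀ f m s θ) (fun m => rfl) hsum y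
  exact h2.unique h3

end



section
variable {b₀ L : ℝ} {f : V3 → ℝ}

def EqV : V3 ≃ᵐ ℝ × (ℝ × ℝ) :=
  ((MeasurableEquiv.toLp 2 (Fin 3 → ℝ)).symm.trans (MeasurableEquiv.piFinSuccAbove (fun _ : Fin 3 => ℝ) 1)).trans
    (MeasurableEquiv.prodCongr (MeasurableEquiv.refl ℝ) MeasurableEquiv.finTwoArrow)

lemma EqV_mp : MeasurePreserving EqV volume volume := by
  unfold EqV
  have h1 := EuclideanSpace.volume_preserving_symm_measurableEquiv_toLp (Fin 3)
  have h2 := volume_preserving_piFinSuccAbove (fun _ : Fin 3 => ℝ) 1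
  have h3 := (MeasurePreserving.id (volume : Measure ℝ)).prod (volume_preserving_finTwoArrow ℝ)
  exact h3.comp (h2.comp h1)

lemma EqV_apply (x : V3) : EqV x = (x 1, (x 0, x 2)) := rfl

/-- cylindrical coordinates in the plane -/
def Pz (z : ℝ × (ℝ × ℝ)) : ℝ × (ℝ × ℝ) := (z.1, (exp z.2.1 * Real.cos z.2.2, exp z.2.1 * Real.sin z.2.2))

lemma EqV_symm_Pz (z) : EqV.symm (Pz z) = Ph (z.2.1, z.2.2, z.1) := by
  rw [MeasurableEquiv.symm_apply_eq, EqV_apply]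
  simp [Pz]

def Dp (p : ℝ × ℝ) : ℝ × ℝ →L[ℝ] ℝ × ℝ :=
  (Matrix.toLin (.finTwoProd ℝ) (.finTwoProd ℝ)
    !![exp p.1 * Real.cos p.2, -(exp p.1 * Real.sin p.2); exp p.1 * Real.sin p.2, exp p.1 * Real.cos p.2]).toContinuousLinearMap

lemma Dp_has (p : ℝ × ℝ) : HasFDerivAt (fun p : ℝ × ℝ => (exp p.1 * Real.cos p.2, exp p.1 * Real.sin p.2)) (Dp p) p := by
  unfold Dp
  rw [Matrix.toLin_finTwoProd_toContinuousLinearMap]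
  have e : HasFDerivAt (fun p : ℝ × ℝ => exp p.1) _ p := (hasFDerivAt_fst (𝕜 := ℝ) (p := p)).exp
  have c : HasFDerivAt (fun p : ℝ × ℝ => Real.cos p.2) _ p := (hasFDerivAt_snd (𝕜 := ℝ) (p := p)).cos
  have d : HasFDerivAt (fun p : ℝ × ℝ => Real.sin p.2) _ p := (hasFDerivAt_snd (𝕜 := ℝ) (p := p)).sin
  refine ((e.mul c).prodMk (e.mul d)).congr_fderiv ?_
  ext <;> simp <;> ring

lemma Dp_det (p : ℝ × ℝ) : (Dp p).det = exp (2 * p.1) := by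
  unfold Dp
  simp only [LinearMap.det_toContinuousLinearMap, LinearMap.det_toLin, Matrix.det_fin_two_of]
  have : exp (2 * p.1) = exp p.1 * exp p.1 := by rw [← exp_add]; ring_nf
  rw [this]
  linear_combination (exp p.1 * exp p.1) * Real.cos_sq_add_sin_sq p.2

def DP (z : ℝ × (ℝ × ℝ)) : ℝ × (ℝ × ℝ) →L[ℝ] ℝ × (ℝ × ℝ) := (ContinuousLinearMap.id ℝ ℝ).prodMap (Dp z.2)

lemma DP_has (z) : HasFDerivAt Pz (DP z) z := by
  have := HasFDerivAt.prodMap z (hasFDerivAt_id (𝕜 := ℝ) z.1) (Dp_has z.2)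
  exact this

lemma DP_det (z) : (DP z).det = exp (2 * z.2.1) := by
  have : ((DP z : ℝ × (ℝ × ℝ) →L[ℝ] ℝ × (ℝ × ℝ)) : ℝ × (ℝ × ℝ) →ₗ[ℝ] ℝ × (ℝ × ℝ)) = LinearMap.prodMap LinearMap.id (Dp z.2 : ℝ × ℝ →ₗ[ℝ] ℝ × ℝ) := rfl
  rw [ContinuousLinearMap.det, this, LinearMap.det_prodMap, LinearMap.det_id, one_mul]
  exact Dp_det z.2

lemma Ps_ang_strict (hb : 0 < b₀) {x : V3} (hx : x ∈ wedgeQ b₀) : 0 < x 2 ∧ (Ps x).2.1 ∈ Ioo (Real.arctan b₀) (π / 2) := by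
  have h2 : 0 < x 2 := (mul_pos hb hx.1).trans hx.2
  have h := Ps_ang hb hx.1.le hx.2.le h2
  have e0 : x 0 = exp (Ps x).1 * Real.cos (Ps x).2.1 := by rw [← Ph_0, Ph_Ps h2]
  have e2 : x 2 = exp (Ps x).1 * Real.sin (Ps x).2.1 := by rw [← Ph_2, Ph_Ps h2]
  refine ⟨h2, lt_of_le_of_ne h.1 fun e => ?_, lt_of_le_of_ne h.2 fun e => ?_⟩
  · have := sin_sub_th0 b₀ (Ps x).2.1
    rw [← e, sub_self, Real.sin_zero, zero_div] at this
    rw [← e] at e0 e2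
    have h3 := hx.2
    rw [e0, e2] at h3
    have : exp (Ps x).1 * (Real.sin (Real.arctan b₀) - b₀ * Real.cos (Real.arctan b₀)) = 0 := by rw [this, mul_zero]
    nlinarith
  · rw [e, Real.cos_pi_div_two, mul_zero] at e0
    exact hx.1.ne' e0

def DD (b₀ L : ℝ) : Set (ℝ × (ℝ × ℝ)) := Ioo 0 (2 * π) ×ˢ (Iio (Real.log L) ×ˢ Ioo (Real.arctan b₀) (π / 2))

lemma DD_image (hb : 0 < b₀) (hL : 0 < L) : EqV.symm ⁻¹' {y ∈ wedgeQL b₀ L | 0 < y 1 ∧ y 1 < 2 * Real.pi} = Pz '' DD b₀ L := by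
  ext z
  constructor
  · rintro ⟨hz, h1⟩
    set x := EqV.symm z with hx
    obtain ⟨h2, h3⟩ := Ps_ang_strict hb hz.1
    refine ⟨(x 1, ((Ps x).1, (Ps x).2.1)), ⟨h1, ?_, h3⟩, ?_⟩
    · rw [mem_Iio, ← exp_lt_exp, exp_log hL, exp_Ps h2]; exact hz.2
    · apply EqV.symm.injective
      rw [EqV_symm_Pz]
      exact Ph_Ps h2
  · rintro ⟨w, ⟨h1, h2, h3⟩, rfl⟩
    rw [mem_preimage, EqV_symm_Pz]
    refine ⟨Ph_mem_QL hb h3.1 h3.2 ?_, by simpa using h1⟩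
    rw [mem_Iio] at h2
    rw [← exp_log hL]; exact exp_lt_exp.2 h2

lemma Pz_inj (hb : 0 < b₀) : InjOn Pz (DD b₀ L) := by
  intro z hz w hw h
  have h' := congrArg EqV.symm h
  rw [EqV_symm_Pz, EqV_symm_Pz] at h'
  have := congrArg Ps h'
  have h0 := th0_pos hb
  have hp := pi_pos
  rw [Ps_Ph (by simp; linarith [hz.2.2.1]) (by simp; linarith [hz.2.2.2]), Ps_Ph (by simp; linarith [hw.2.2.1]) (by simp; linarith [hw.2.2.2])] at this
  obtain ⟨a, b, c⟩ := z
  obtain ⟨a', b', c'⟩ := w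
  simp only [Prod.mk.injEq] at this ⊢
  tauto

lemma DD_meas : MeasurableSet (DD b₀ L) := measurableSet_Ioo.prod (measurableSet_Iio.prod measurableSet_Ioo)

lemma cyl_int (hb : 0 < b₀) (hL : 0 < L) (f : V3 → ℝ) :
    ∫ y in {y ∈ wedgeQL b₀ L | 0 < y 1 ∧ y 1 < 2 * Real.pi}, f y = ∫ z in DD b₀ L, FF b₀ f z.2.1 z.2.2 z.1 := by
  rw [← (EqV_mp.symm).setIntegral_preimage_emb EqV.symm.measurableEmbedding f, DD_image hb hL]
  have : Measure.IsAddHaarMeasure (volume : Measure (ℝ × (ℝ × ℝ))) := Measure.prod.instIsAddHaarMeasure _ _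
  rw [integral_image_eq_integral_abs_det_fderiv_smul volume DD_meas (fun z _ => (DP_has z).hasFDerivWithinAt) (Pz_inj hb)]
  refine setIntegral_congr_fun DD_meas fun z hz => ?_
  simp only [DP_det, EqV_symm_Pz, FF, smul_eq_mul, abs_of_pos (exp_pos _)]
  rw [clampT_eq ⟨hz.2.2.1.le, hz.2.2.2.le⟩]

lemma FF_int (hb : 0 < b₀) (hf : ContDiffOn ℝ 4 f (SQ b₀)) {δ δ₀ M : ℝ} (hδ0 : 0 < δ) (hδ1 : δ < 1) (hδ₀1 : δ₀ < 1) (hδ₀0 : 0 < δ₀)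
    (hL : 0 < L) (h : wsupLE (SQ b₀) 4 (1-δ) (2-δ₀) (wedgeQL b₀ L) f M) :
    IntegrableOn (fun z : ℝ × (ℝ × ℝ) => FF b₀ f z.2.1 z.2.2 z.1) (DD b₀ L) := by
  have hc : Continuous (fun z : ℝ × (ℝ × ℝ) => FF b₀ f z.2.1 z.2.2 z.1) :=
    Continuous.comp (FF_cont hb hf.continuousOn) (by fun_prop : Continuous fun z : ℝ × (ℝ × ℝ) => (z.2.1, z.2.2, z.1))
  have hi : IntegrableOn (fun z : ℝ × (ℝ × ℝ) => (1:ℝ) * (M * exp (δ₀ * z.2.1) * 1)) (DD b₀ L) := by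
    have i1 : IntegrableOn (fun _ : ℝ => (1:ℝ)) (Ioo 0 (2*π)) := integrableOn_const (by rw [Real.volume_Ioo]; exact ENNReal.ofReal_ne_top)
    have i3 : IntegrableOn (fun _ : ℝ => (1:ℝ)) (Ioo (Real.arctan b₀) (π / 2)) := by simp [integrableOn_const_iff]
    have i2 : IntegrableOn (fun s : ℝ => M * exp (δ₀ * s)) (Iio (Real.log L)) :=
      ((integrableOn_exp_mul_Iic hδ₀0 _).mono_set Iio_subset_Iic_self).const_mul M
    have := i1.integrable.mul_prod (i2.integrable.mul_prod i3.integrable)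
    rw [IntegrableOn, DD, Measure.volume_eq_prod, Measure.volume_eq_prod, ← Measure.prod_restrict, ← Measure.prod_restrict]
    exact this
  refine Integrable.mono' hi hc.aestronglyMeasurable ?_
  refine (ae_restrict_iff' DD_meas).2 (Eventually.of_forall fun z hz => ?_)
  have hθ : z.2.2 ∈ Th b₀ := ⟨hz.2.2.1.le, hz.2.2.2.le⟩
  have hs : exp z.2.1 ≤ L := by
    rw [← exp_log hL]; exact exp_le_exp.2 (le_of_lt hz.2.1)
  have := TT_bound hb hf hδ0 hδ1 hδ₀1 hδ₀0 h (k := 0) (by norm_num) (p := (z.2.1, z.2.2, z.1)) hθ hs Fin.elim0 (fun i => i.elim0)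
  rw [TT_zero, pow_zero, one_mul] at this
  have hM : 0 ≤ M := by
    by_contra hM
    push Not at hM
    have h1 : 0 ≤ exp (2 * z.2.1) * |f (Ph (z.2.1, z.2.2, z.1))| := by positivity
    have h2 : 0 < min (exp ((1 + δ) * z.2.1)) (exp (δ₀ * z.2.1)) := by positivity
    have h3 := mul_neg_of_neg_of_pos hM h2
    exact absurd (h1.trans this) (not_le.2 h3)
  rw [FF, clampT_eq hθ, Real.norm_eq_abs, abs_mul, abs_of_pos (exp_pos _), one_mul, mul_one]
  exact this.trans (mul_le_mul_of_nonneg_left (min_le_right _ _) hM)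

lemma cL (hb : 0 < b₀) (hf : ContDiffOn ℝ 4 f (SQ b₀)) {δ δ₀ M : ℝ} (hδ0 : 0 < δ) (hδ1 : δ < 1) (hδ₀1 : δ₀ < 1) (hδ₀0 : 0 < δ₀)
    (hL : 0 < L) (h : wsupLE (SQ b₀) 4 (1-δ) (2-δ₀) (wedgeQL b₀ L) f M) :
    (∫ t in Iic (Real.log L), Fco b₀ f 0 t).re = L * cutoffConst b₀ L f := by
  have hω : 0 < π / 2 - Real.arctan b₀ := by linarith [Real.arctan_lt_pi_div_two b₀]
  have hF : ∀ t, Fco b₀ f 0 t = ((1 / (π / 2 - Real.arctan b₀) * (1 / (2 * π)) * ∫ θ in Ioo (Real.arctan b₀) (π/2), ∫ y in Ioo 0 (2*π), FF b₀ f t θ y : ℝ) : ℂ) := by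
    intro t
    simp only [Fco, hm, Prod.fst_zero, Prod.snd_zero, Int.cast_zero, mul_zero, zero_mul, neg_zero, Complex.exp_zero, mul_one,
      Real.cos_zero, Complex.ofReal_one, intervalIntegral.integral_const_mul, intervalIntegral.integral_ofReal]
    rw [intervalIntegral.integral_of_le (Real.arctan_lt_pi_div_two b₀).le, ← integral_Ioc_eq_integral_Ioo]
    simp only [intervalIntegral.integral_of_le (by positivity : (0:ℝ) ≤ 2 * π), integral_Ioc_eq_integral_Ioo]
    push_cast
    ring
  simp_rw [hF]
  rw [integral_complex_ofReal, Complex.ofReal_re, integral_const_mul, cutoffConst, cyl_int hb hL]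
  have hInt := FF_int hb hf hδ0 hδ1 hδ₀1 hδ₀0 hL h
  have e : ∫ z in DD b₀ L, FF b₀ f z.2.1 z.2.2 z.1 = ∫ t in Iic (Real.log L), ∫ θ in Ioo (Real.arctan b₀) (π/2), ∫ y in Ioo 0 (2*π), FF b₀ f t θ y := by
    rw [IntegrableOn, DD, Measure.volume_eq_prod, ← Measure.prod_restrict] at hInt
    rw [DD, Measure.volume_eq_prod, ← Measure.prod_restrict, integral_prod_symm _ hInt, Measure.volume_eq_prod,
      setIntegral_prod, integral_Iic_eq_integral_Iio]
    have := hInt.integral_prod_right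
    rw [Measure.volume_eq_prod] at this
    exact this
  rw [e]
  field_simp
end



section
variable {K : Set (ℝ × ℝ)} {ℓ : ℝ} {F F' : ℝ × ℝ × ℝ → ℝ}

lemma slice_cont (hF : ContinuousOn F (Iic ℓ ×ˢ K)) {s : ℝ} (hs : s ≤ ℓ) : ContinuousOn (fun z => F (s, z)) K :=
  hF.comp (Continuous.prodMk_right s).continuousOn (fun z hz => ⟨hs, hz⟩)

lemma slice_meas (hK : IsCompact K) (hF : ContinuousOn F (Iic ℓ ×ˢ K)) {s : ℝ} (hs : s ≤ ℓ) :
    AEStronglyMeasurable (fun z => F (s, z)) (volume.restrict K) :=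
  (slice_cont hF hs).aestronglyMeasurable_of_isCompact hK hK.measurableSet

lemma slice_int (hK : IsCompact K) (hF : ContinuousOn F (Iic ℓ ×ˢ K)) {s : ℝ} (hs : s ≤ ℓ) :
    IntegrableOn (fun z => F (s, z)) K := (slice_cont hF hs).integrableOn_compact hK

lemma par_bound (hK : IsCompact K) (hF : ContinuousOn F (Iic ℓ ×ˢ K)) (a : ℝ) :
    ∃ C : ℝ, ∀ s ∈ Icc a ℓ, ∀ z ∈ K, ‖F (s, z)‖ ≤ C := by
  obtain ⟨C, hC⟩ := (isCompact_Icc.prod hK).exists_bound_of_continuousOn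
    (hF.mono (Set.prod_mono (Icc_subset_Iic_self (a := a)) (le_refl K)))
  exact ⟨C, fun s hs z hz => hC (s, z) ⟨hs, hz⟩⟩

lemma par_cont (hK : IsCompact K) (hF : ContinuousOn F (Iic ℓ ×ˢ K)) :
    ContinuousWithinAt (fun s => ∫ z in K, F (s, z)) (Iic ℓ) ℓ := by
  obtain ⟨C, hC⟩ := par_bound hK hF (ℓ - 1)
  have hmem : Icc (ℓ - 1) ℓ ∈ 𝓝[≤] ℓ := Icc_mem_nhdsLE (by linarith)
  refine continuousWithinAt_of_dominated (bound := fun _ => C) ?_ ?_ ?_ ?_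
  · filter_upwards [hmem] with s hs using slice_meas hK hF hs.2
  · filter_upwards [hmem] with s hs
    exact (ae_restrict_iff' hK.measurableSet).2 (Eventually.of_forall fun z hz => hC s hs z hz)
  · exact integrableOn_const hK.measure_lt_top.ne
  · refine (ae_restrict_iff' hK.measurableSet).2 (Eventually.of_forall fun z hz => ?_)
    exact ContinuousWithinAt.comp (g := F) (f := fun s : ℝ => (s, z)) (t := Iic ℓ ×ˢ K) (hF (ℓ, z) ⟨mem_Iic.2 le_rfl, hz⟩)
      (Continuous.prodMk_left z).continuousWithinAt (fun s hs => ⟨hs, hz⟩)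

lemma par_deriv (hK : IsCompact K) (hF : ContinuousOn F (Iic ℓ ×ˢ K)) (hF' : ContinuousOn F' (Iic ℓ ×ˢ K))
    (hd : ∀ s < ℓ, ∀ z ∈ K, HasDerivAt (fun s => F (s, z)) (F' (s, z)) s) {s : ℝ} (hs : s < ℓ) :
    HasDerivAt (fun s => ∫ z in K, F (s, z)) (∫ z in K, F' (s, z)) s := by
  obtain ⟨C, hC⟩ := par_bound hK hF' (s - 1)
  refine (hasDerivAt_integral_of_dominated_loc_of_deriv_le (F := fun s z => F (s, z)) (F' := fun s z => F' (s, z)) (s := Ioo (s - 1) ℓ) (bound := fun _ => C) (Ioo_mem_nhds (by linarith) hs)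
    ?_ (slice_int hK hF hs.le) (slice_meas hK hF' hs.le) ?_ ?_ ?_).2
  · filter_upwards [Iio_mem_nhds hs] with t ht using slice_meas hK hF (le_of_lt ht)
  · exact (ae_restrict_iff' hK.measurableSet).2 (Eventually.of_forall fun z hz t ht => hC t ⟨ht.1.le, ht.2.le⟩ z hz)
  · exact integrableOn_const hK.measure_lt_top.ne
  · exact (ae_restrict_iff' hK.measurableSet).2 (Eventually.of_forall fun z hz t ht => hd t ht.2 z hz)
end

lemma ftc_zero {a b : ℝ} (hab : a ≤ b) {u u1 u2 : ℝ → ℝ} (c0 : ContinuousOn u (Icc a b)) (c1 : ContinuousOn u1 (Icc a b)) (c2 : ContinuousOn u2 (Icc a b))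
    (d0 : ∀ x ∈ Ioo a b, HasDerivAt u (u1 x) x) (d1 : ∀ x ∈ Ioo a b, HasDerivAt u1 (u2 x) x) (hbd : u b * u1 b = u a * u1 a) :
    ∫ x in Icc a b, (u1 x ^ 2 + u x * u2 x) = 0 := by
  rw [integral_Icc_eq_integral_Ioc, ← intervalIntegral.integral_of_le hab]
  rw [intervalIntegral.integral_eq_sub_of_hasDerivAt_of_le (f := fun x => u x * u1 x) hab (c0.mul c1)]
  · rw [hbd, sub_self]
  · intro x hx
    refine ((d0 x hx).mul (d1 x hx)).congr_deriv ?_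
    ring
  · apply ContinuousOn.intervalIntegrable
    rw [uIcc_of_le hab]
    fun_prop

lemma energy {ℓ θ₀ θ₁ M : ℝ} (h01 : θ₀ < θ₁) {W Ws Wt Wy Wss Wtt Wyy : ℝ × ℝ × ℝ → ℝ}
    (cW : ContinuousOn W (Iic ℓ ×ˢ (Icc θ₀ θ₁ ×ˢ Icc 0 (2 * π))))
    (cs : ContinuousOn Ws (Iic ℓ ×ˢ (Icc θ₀ θ₁ ×ˢ Icc 0 (2 * π))))
    (ct : ContinuousOn Wt (Iic ℓ ×ˢ (Icc θ₀ θ₁ ×ˢ Icc 0 (2 * π))))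
    (cy : ContinuousOn Wy (Iic ℓ ×ˢ (Icc θ₀ θ₁ ×ˢ Icc 0 (2 * π))))
    (css : ContinuousOn Wss (Iic ℓ ×ˢ (Icc θ₀ θ₁ ×ˢ Icc 0 (2 * π))))
    (ctt : ContinuousOn Wtt (Iic ℓ ×ˢ (Icc θ₀ θ₁ ×ˢ Icc 0 (2 * π))))
    (cyy : ContinuousOn Wyy (Iic ℓ ×ˢ (Icc θ₀ θ₁ ×ˢ Icc 0 (2 * π))))
    (hs : ∀ s < ℓ, ∀ θ ∈ Icc θ₀ θ₁, ∀ y, HasDerivAt (fun s => W (s, θ, y)) (Ws (s, θ, y)) s)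
    (hss : ∀ s < ℓ, ∀ θ ∈ Icc θ₀ θ₁, ∀ y, HasDerivAt (fun s => Ws (s, θ, y)) (Wss (s, θ, y)) s)
    (ht : ∀ s < ℓ, ∀ θ ∈ Ioo θ₀ θ₁, ∀ y, HasDerivAt (fun θ => W (s, θ, y)) (Wt (s, θ, y)) θ)
    (htt : ∀ s < ℓ, ∀ θ ∈ Ioo θ₀ θ₁, ∀ y, HasDerivAt (fun θ => Wt (s, θ, y)) (Wtt (s, θ, y)) θ)
    (hy : ∀ s < ℓ, ∀ θ ∈ Icc θ₀ θ₁, ∀ y, HasDerivAt (fun y => W (s, θ, y)) (Wy (s, θ, y)) y)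
    (hyy : ∀ s < ℓ, ∀ θ ∈ Icc θ₀ θ₁, ∀ y, HasDerivAt (fun y => Wy (s, θ, y)) (Wyy (s, θ, y)) y)
    (pde : ∀ s < ℓ, ∀ θ ∈ Ioo θ₀ θ₁, ∀ y, Wss (s, θ, y) + Wtt (s, θ, y) + exp (2 * s) * Wyy (s, θ, y) = 0)
    (bt0 : ∀ s < ℓ, ∀ y, Wt (s, θ₀, y) = 0) (bt1 : ∀ s < ℓ, ∀ y, Wt (s, θ₁, y) = 0)
    (bs : ∀ θ ∈ Icc θ₀ θ₁, ∀ y, Ws (ℓ, θ, y) = 0)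
    (per : ∀ s < ℓ, ∀ θ ∈ Icc θ₀ θ₁, W (s, θ, 2 * π) = W (s, θ, 0))
    (pery : ∀ s < ℓ, ∀ θ ∈ Icc θ₀ θ₁, Wy (s, θ, 2 * π) = Wy (s, θ, 0))
    (bdd : ∀ s < ℓ, s < 0 → ∀ θ ∈ Ioo θ₀ θ₁, ∀ y, |W (s, θ, y)| ≤ M) :
    ∀ s < ℓ, ∀ θ ∈ Icc θ₀ θ₁, ∀ y ∈ Icc 0 (2 * π), Ws (s, θ, y) = 0 ∧ Wy (s, θ, y) = 0 := by
  set K := Icc θ₀ θ₁ ×ˢ Icc 0 (2 * π) with hKd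
  have hK : IsCompact K := isCompact_Icc.prod isCompact_Icc
  have hpi : (0:ℝ) ≤ 2 * π := by positivity
  have slt : ∀ {F : ℝ × ℝ × ℝ → ℝ}, ContinuousOn F (Iic ℓ ×ˢ K) → ∀ s < ℓ, ∀ y ∈ Icc 0 (2 * π), ContinuousOn (fun θ => F (s, θ, y)) (Icc θ₀ θ₁) :=
    fun hF s hs y hy => hF.comp (by fun_prop : Continuous fun θ : ℝ => (s, θ, y)).continuousOn (fun θ hθ => ⟨hs.le, hθ, hy⟩)
  have sly : ∀ {F : ℝ × ℝ × ℝ → ℝ}, ContinuousOn F (Iic ℓ ×ˢ K) → ∀ s < ℓ, ∀ θ ∈ Icc θ₀ θ₁, ContinuousOn (fun y => F (s, θ, y)) (Icc 0 (2 * π)) :=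
    fun hF s hs y hy => hF.comp (by fun_prop : Continuous fun θ : ℝ => (s, y, θ)).continuousOn (fun θ hθ => ⟨hs.le, hy, hθ⟩)
  have hclo := closure_Ioo h01.ne
  have pde' : ∀ s < ℓ, ∀ z ∈ K, Wss (s, z) + Wtt (s, z) + exp (2 * s) * Wyy (s, z) = 0 := by
    rintro s hs' ⟨θ, y⟩ ⟨hθ, hy'⟩
    have a1 := slt css s hs' y hy'
    have a2 := slt ctt s hs' y hy'
    have a3 := slt cyy s hs' y hy'
    have : EqOn (fun θ => Wss (s, θ, y) + Wtt (s, θ, y) + exp (2 * s) * Wyy (s, θ, y)) (fun _ => 0) (Icc θ₀ θ₁) :=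
      EqOn.of_subset_closure (s := Ioo θ₀ θ₁) (fun θ hθ => pde s hs' θ hθ y) ((a1.add a2).add (continuousOn_const.mul a3)) continuousOn_const Ioo_subset_Icc_self (by rw [hclo])
    exact this hθ
  have bdd' : ∀ s < ℓ, s < 0 → ∀ z ∈ K, |W (s, z)| ≤ M := by
    rintro s hs' h0 ⟨θ, y⟩ ⟨hθ, hy'⟩
    have a1 := slt cW s hs' y hy'
    rw [← hclo] at hθ a1
    exact le_on_closure (fun θ hθ => bdd s hs' h0 θ hθ y) a1.abs continuousOn_const hθ
  -- integrated identities
  have iA : ∀ s < ℓ, ∫ z in K, (Wt (s, z) ^ 2 + W (s, z) * Wtt (s, z)) = 0 := by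
    intro s hs'
    have hi : IntegrableOn (fun z => Wt (s, z) ^ 2 + W (s, z) * Wtt (s, z)) K :=
      slice_int (F := fun p => Wt p ^ 2 + W p * Wtt p) hK (by fun_prop) hs'.le
    rw [hKd, IntegrableOn, Measure.volume_eq_prod, ← Measure.prod_restrict] at hi
    rw [hKd, Measure.volume_eq_prod, ← Measure.prod_restrict, integral_prod_symm _ hi]
    rw [setIntegral_congr_fun (g := fun _ => 0) measurableSet_Icc]
    · simp
    intro y hy'
    exact ftc_zero h01.le (slt cW s hs' y hy') (slt ct s hs' y hy') (slt ctt s hs' y hy') (fun θ hθ => ht s hs' θ hθ y) (fun θ hθ => htt s hs' θ hθ y)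
      (by rw [bt0 s hs', bt1 s hs']; simp)
  have iB : ∀ s < ℓ, ∫ z in K, (Wy (s, z) ^ 2 + W (s, z) * Wyy (s, z)) = 0 := by
    intro s hs'
    have hi : IntegrableOn (fun z => Wy (s, z) ^ 2 + W (s, z) * Wyy (s, z)) K :=
      slice_int (F := fun p => Wy p ^ 2 + W p * Wyy p) hK (by fun_prop) hs'.le
    rw [Measure.volume_eq_prod] at hi ⊢
    rw [hKd, setIntegral_prod _ hi]
    rw [setIntegral_congr_fun (g := fun _ => 0) measurableSet_Icc]
    · simp
    intro θ hθ
    exact ftc_zero hpi (sly cW s hs' θ hθ) (sly cy s hs' θ hθ) (sly cyy s hs' θ hθ) (fun y _ => hy s hs' θ hθ y) (fun y _ => hyy s hs' θ hθ y)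
      (by rw [per s hs' θ hθ, pery s hs' θ hθ])
  set E : ℝ × ℝ × ℝ → ℝ := fun p => Ws p ^ 2 + Wt p ^ 2 + exp (2 * p.1) * Wy p ^ 2 with hE
  have cE : ContinuousOn E (Iic ℓ ×ˢ K) := by rw [hE]; fun_prop
  have iC : ∀ s < ℓ, ∫ z in K, (Ws (s, z) ^ 2 + W (s, z) * Wss (s, z)) = ∫ z in K, E (s, z) := by
    intro s hs'
    have e1 : IntegrableOn (fun z => Wt (s, z) ^ 2 + W (s, z) * Wtt (s, z)) K :=
      slice_int (F := fun p => Wt p ^ 2 + W p * Wtt p) hK (by fun_prop) hs'.le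
    have e2 : IntegrableOn (fun z => Wy (s, z) ^ 2 + W (s, z) * Wyy (s, z)) K :=
      slice_int (F := fun p => Wy p ^ 2 + W p * Wyy p) hK (by fun_prop) hs'.le
    have e3 := slice_int hK cE hs'.le
    have : ∫ z in K, (Ws (s, z) ^ 2 + W (s, z) * Wss (s, z)) =
        ∫ z in K, ((E (s, z) - (Wt (s, z) ^ 2 + W (s, z) * Wtt (s, z))) - exp (2 * s) * (Wy (s, z) ^ 2 + W (s, z) * Wyy (s, z))) := by
      refine setIntegral_congr_fun hK.measurableSet fun z hz => ?_
      have := pde' s hs' z hz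
      simp only [hE]
      linear_combination W (s, z) * this
    have e4 : IntegrableOn (fun z => E (s, z) - (Wt (s, z) ^ 2 + W (s, z) * Wtt (s, z))) K := e3.sub e1
    have e5 : IntegrableOn (fun z => exp (2 * s) * (Wy (s, z) ^ 2 + W (s, z) * Wyy (s, z))) K := e2.const_mul _
    rw [this, integral_sub e4 e5, integral_sub e3 e1, integral_const_mul, iA s hs', iB s hs']
    ring
  set I : ℝ → ℝ := fun s => ∫ z in K, W (s, z) * Ws (s, z) with hI
  set G : ℝ → ℝ := fun s => ∫ z in K, W (s, z) ^ 2 with hG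
  have dI : ∀ s < ℓ, HasDerivAt I (∫ z in K, E (s, z)) s := by
    intro s hs'
    rw [← iC s hs']
    exact par_deriv (F := fun p => W p * Ws p) (F' := fun p => Ws p ^ 2 + W p * Wss p) hK (by fun_prop) (by fun_prop)
      (fun t ht z hz => ((hs t ht z.1 hz.1 z.2).mul (hss t ht z.1 hz.1 z.2)).congr_deriv (by ring)) hs'
  have dG : ∀ s < ℓ, HasDerivAt G (2 * I s) s := by
    intro s hs'
    rw [hI, ← integral_const_mul]
    exact par_deriv (F := fun p => W p ^ 2) (F' := fun p => 2 * (W p * Ws p)) hK (by fun_prop) (by fun_prop)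
      (fun t ht z hz => ((hs t ht z.1 hz.1 z.2).pow 2).congr_deriv (by push_cast; ring)) hs'
  have Enn : ∀ p, 0 ≤ E p := fun p => by simp only [hE]; positivity
  have mono : MonotoneOn I (Iic ℓ) := by
    refine monotoneOn_of_deriv_nonneg (convex_Iic ℓ) ?_ ?_ ?_
    · intro s hs'
      rcases eq_or_lt_of_le (mem_Iic.1 hs') with h | h
      · rw [h]; exact par_cont (F := fun p => W p * Ws p) hK (by fun_prop)
      · exact (dI s h).continuousAt.continuousWithinAt
    · rw [interior_Iic]; exact fun s hs' => (dI s hs').differentiableAt.differentiableWithinAt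
    · rw [interior_Iic]; intro s hs'
      rw [(dI s hs').deriv]
      exact setIntegral_nonneg hK.measurableSet fun z _ => Enn _
  have Iℓ : I ℓ = 0 := by
    rw [hI]
    simp only
    rw [setIntegral_congr_fun (g := fun _ => 0) hK.measurableSet]
    · simp
    · rintro ⟨θ, y⟩ hz
      simp only [bs θ hz.1 y, mul_zero]
  have Gbd : ∀ s < ℓ, s < 0 → G s ≤ M ^ 2 * volume.real K := by
    intro s hs' h0
    rw [hG]
    calc ∫ z in K, W (s, z) ^ 2 ≤ ∫ z in K, M ^ 2 := by
          refine setIntegral_mono_on (slice_int (F := fun p => W p ^ 2) hK (by fun_prop) hs'.le) (integrableOn_const hK.measure_lt_top.ne) hK.measurableSet fun z hz => ?_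
          have := bdd' s hs' h0 z hz
          exact sq_le_sq' (by linarith [neg_abs_le (W (s, z))]) ((le_abs_self _).trans this)
      _ = _ := by simp [mul_comm]
  have Gnn : ∀ s, 0 ≤ G s := fun s => integral_nonneg fun z => sq_nonneg _
  have I0 : ∀ s < ℓ, I s = 0 := by
    intro s hs'
    refine le_antisymm (Iℓ ▸ mono (mem_Iic.2 hs'.le) (mem_Iic.2 le_rfl) hs'.le) ?_
    by_contra hneg
    push Not at hneg
    -- for t ≤ s, G t - 2 I(s) t is antitone
    have anti : ∀ t < s, G s - 2 * I s * s ≤ G t - 2 * I s * t := by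
      intro t hts
      have hd : ∀ x ∈ Icc t s, HasDerivAt (fun x => G x - 2 * I s * x) (2 * I x - 2 * I s) x := fun x hx => by
        have h5 : HasDerivAt (fun x : ℝ => 2 * I s * x) (2 * I s) x := by
          simpa only [mul_one, id] using (hasDerivAt_id x).const_mul (2 * I s)
        exact (dG x (hx.2.trans_lt hs')).fun_sub h5
      have := antitoneOn_of_deriv_nonpos (convex_Icc t s) (f := fun x => G x - 2 * I s * x)
        (fun x hx => (hd x hx).continuousAt.continuousWithinAt)
        (fun x hx => (hd x (interior_subset hx)).differentiableAt.differentiableWithinAt)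
        (fun x hx => by
          have hx' := interior_subset hx
          rw [(hd x hx').deriv]
          have := mono (mem_Iic.2 (hx'.2.trans hs'.le)) (mem_Iic.2 hs'.le) hx'.2
          linarith)
      exact this ⟨le_rfl, hts.le⟩ ⟨hts.le, le_rfl⟩ hts.le
    set B := M ^ 2 * volume.real K with hB
    set t := min (min (s - 1) (-1)) (s - (B + 1) / (2 * -I s)) with ht'
    have t1 : t ≤ s - 1 := (min_le_left _ _).trans (min_le_left _ _)
    have t2 : t ≤ -1 := (min_le_left _ _).trans (min_le_right _ _)
    have t3 : t ≤ s - (B + 1) / (2 * -I s) := min_le_right _ _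
    have g1 := anti t (by linarith)
    have g2 := Gbd t (by linarith) (by linarith)
    have g3 := Gnn s
    have t4 : (B + 1) / (2 * -I s) ≤ s - t := by linarith
    rw [div_le_iff₀ (by linarith)] at t4
    nlinarith
  intro s hs' θ hθ y hy'
  have dz : ∫ z in K, E (s, z) = 0 := by
    have h1 := dI s hs'
    have h2 : HasDerivAt I 0 s := by
      refine (hasDerivAt_const s (0:ℝ)).congr_of_eventuallyEq ?_
      filter_upwards [Iio_mem_nhds hs'] with t ht using I0 t ht
    exact h1.unique h2
  have ae := (setIntegral_eq_zero_iff_of_nonneg_ae (Eventually.of_forall fun z => Enn (s, z)) (slice_int hK cE hs'.le)).1 dz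
  have hEz : EqOn (fun z => E (s, z)) 0 K := by
    refine Measure.eqOn_of_ae_eq ae (slice_cont cE hs'.le) continuousOn_const ?_
    rw [hKd, interior_prod_eq, interior_Icc, interior_Icc, closure_prod_eq, closure_Ioo h01.ne, closure_Ioo (by positivity : (0:ℝ) < 2 * π).ne]
  have hz := hEz (show (θ, y) ∈ K from ⟨hθ, hy'⟩)
  simp only [hE, Pi.zero_apply] at hz
  have a1 := sq_nonneg (Ws (s, θ, y))
  have a2 := sq_nonneg (Wt (s, θ, y))
  have a3 := sq_nonneg (Wy (s, θ, y))
  have a4 := exp_pos (2 * s)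
  have a5 : 0 ≤ exp (2 * s) * Wy (s, θ, y) ^ 2 := by positivity
  constructor
  · exact pow_eq_zero_iff (two_ne_zero) |>.1 (by linarith)
  · have : exp (2 * s) * Wy (s, θ, y) ^ 2 = 0 := by linarith
    rcases mul_eq_zero.1 this with h | h
    · exact absurd h a4.ne'
    · exact pow_eq_zero_iff (two_ne_zero) |>.1 h



section
variable {b₀ L : ℝ}

lemma pd_diff {n m : WithTop ℕ∞} {v : V3 → ℝ} (hb : 0 < b₀) (hL : 0 < L) (hv : ContDiffOn ℝ n v (SL b₀ L)) (hmn : m + 1 ≤ n) (i : Fin 3) :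
    ContDiffOn ℝ m (pdW (SL b₀ L) i v) (SL b₀ L) :=
  (hv.fderivWithin (uniq_SL hb hL) hmn).clm_apply contDiffOn_const

lemma pd_sub (hb : 0 < b₀) (hL : 0 < L) {u v : V3 → ℝ} {x : V3} (hx : x ∈ SL b₀ L) (hu : DifferentiableOn ℝ u (SL b₀ L))
    (hv : DifferentiableOn ℝ v (SL b₀ L)) (i : Fin 3) :
    pdW (SL b₀ L) i (fun x => u x - v x) x = pdW (SL b₀ L) i u x - pdW (SL b₀ L) i v x := by
  unfold pdW
  rw [fderivWithin_fun_sub (uniq_SL hb hL x hx) (hu x hx) (hv x hx)]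
  rfl

lemma sol_sub (hb : 0 < b₀) (hL : 0 < L) {f v₁ v₂ : V3 → ℝ} (h1 : IsCutoffSolution b₀ L f v₁) (h2 : IsCutoffSolution b₀ L f v₂) :
    IsCutoffSolution b₀ L (fun _ => 0) (fun x => v₁ x - v₂ x) := by
  obtain ⟨c1, p1, a1, d1, r1, q1, t1⟩ := h1
  obtain ⟨c2, p2, a2, d2, r2, q2, t2⟩ := h2
  have e1 := c1.differentiableOn two_ne_zero
  have e2 := c2.differentiableOn two_ne_zero
  have f1 := fun i => (pd_diff (m := 1) hb hL c1 (by norm_num) i).differentiableOn one_ne_zero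
  have f2 := fun i => (pd_diff (m := 1) hb hL c2 (by norm_num) i).differentiableOn one_ne_zero
  refine ⟨c1.sub c2, ?_, ?_, ?_, ?_, ?_, ?_⟩
  · intro y hy
    have hy' := wedgeQL_sub_SL hb hy
    have := p1 y hy
    have h3 := p2 y hy
    unfold lapW at *
    have : ∀ i, pdW (SL b₀ L) i (pdW (SL b₀ L) i fun x => v₁ x - v₂ x) y =
        pdW (SL b₀ L) i (pdW (SL b₀ L) i v₁) y - pdW (SL b₀ L) i (pdW (SL b₀ L) i v₂) y := by
      intro i
      rw [pd_congr hy' (fun z hz => pd_sub hb hL hz e1 e2 i) i, pd_sub hb hL hy' (f1 i) (f2 i)]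
    simp only [this, Finset.sum_sub_distrib]
    linarith
  · intro y hy hy2 hr
    rw [pd_sub hb hL hy e1 e2, pd_sub hb hL hy e1 e2]
    linarith [a1 y hy hy2 hr, a2 y hy hy2 hr]
  · intro y hy hy2 hr
    rw [pd_sub hb hL hy e1 e2]
    linarith [d1 y hy hy2 hr, d2 y hy hy2 hr]
  · intro y hy hr
    rw [pd_sub hb hL hy e1 e2, pd_sub hb hL hy e1 e2]
    have : cutoffConst b₀ L (fun _ => 0) = 0 := by simp [cutoffConst]
    rw [this]
    linarith [r1 y hy hr, r2 y hy hr]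
  · intro y hy
    simp only [q1 y hy, q2 y hy]
  · simpa using t1.sub t2

variable {U : V3 → ℝ}

lemma fd_decomp {S : Set V3} {x : V3} (a b : ℝ) : fderivWithin ℝ U S x (a • ee 0 + b • ee 2) = a * pdW S 0 U x + b * pdW S 2 U x := by
  simp [pdW, ee]

lemma U_ds (hb : 0 < b₀) (hL : 0 < L) (hU : DifferentiableOn ℝ U (SL b₀ L)) {s θ : ℝ} (y : ℝ) (hs : s < Real.log L) (hθ : θ ∈ Th b₀) :
    HasDerivAt (fun s => U (Ph (s, θ, y))) (exp s * Real.cos θ * pdW (SL b₀ L) 0 U (Ph (s, θ, y)) +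
      exp s * Real.sin θ * pdW (SL b₀ L) 2 U (Ph (s, θ, y))) s := by
  have m : ∀ t ∈ Iic (Real.log L), Ph (t, θ, y) ∈ SL b₀ L := fun t ht => Ph_mem_SL hb hθ ((le_log_iff_exp_le hL).1 ht)
  have h := (hU _ (m s hs.le)).hasFDerivWithinAt.comp_hasDerivWithinAt s (Ph_ds s θ y).hasDerivWithinAt (s := Iic (Real.log L)) m
  rw [fd_decomp] at h
  exact h.hasDerivAt (Iic_mem_nhds hs)

lemma U_dt (hb : 0 < b₀) (hL : 0 < L) (hU : DifferentiableOn ℝ U (SL b₀ L)) {s θ : ℝ} (y : ℝ) (hs : s < Real.log L) (hθ : θ ∈ Ioo (Real.arctan b₀) (π / 2)) :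
    HasDerivAt (fun θ => U (Ph (s, θ, y))) (-(exp s * Real.sin θ) * pdW (SL b₀ L) 0 U (Ph (s, θ, y)) +
      exp s * Real.cos θ * pdW (SL b₀ L) 2 U (Ph (s, θ, y))) θ := by
  have m : ∀ t ∈ Th b₀, Ph (s, t, y) ∈ SL b₀ L := fun t ht => Ph_mem_SL hb ht ((le_log_iff_exp_le hL).1 hs.le)
  have h := (hU _ (m θ (Ioo_subset_Icc_self hθ))).hasFDerivWithinAt.comp_hasDerivWithinAt θ (Ph_dt s θ y).hasDerivWithinAt (s := Th b₀) m
  rw [fd_decomp] at h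
  exact h.hasDerivAt (Icc_mem_nhds hθ.1 hθ.2)

lemma U_dy (hb : 0 < b₀) (hL : 0 < L) (hU : DifferentiableOn ℝ U (SL b₀ L)) {s θ : ℝ} (y : ℝ) (hs : s < Real.log L) (hθ : θ ∈ Th b₀) :
    HasDerivAt (fun y => U (Ph (s, θ, y))) (pdW (SL b₀ L) 1 U (Ph (s, θ, y))) y := by
  have m : ∀ t ∈ univ, Ph (s, θ, t) ∈ SL b₀ L := fun t _ => Ph_mem_SL hb hθ ((le_log_iff_exp_le hL).1 hs.le)
  have h := (hU _ (m y trivial)).hasFDerivWithinAt.comp_hasDerivWithinAt y (Ph_dy s θ y).hasDerivWithinAt (s := univ) m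
  exact h.hasDerivAt univ_mem

lemma U_cont (hb : 0 < b₀) (hL : 0 < L) (hU : ContinuousOn U (SL b₀ L)) :
    ContinuousOn (fun p => U (Ph p)) (Iic (Real.log L) ×ˢ (Icc (Real.arctan b₀) (π / 2) ×ˢ Icc 0 (2 * π))) :=
  hU.comp Ph_cont.continuousOn fun _ hp => Ph_mem_SL hb hp.2.1 ((le_log_iff_exp_le hL).1 hp.1)

lemma Ph_shift (s θ y : ℝ) : Ph (s, θ, y + 2 * π) = Ph (s, θ, y) + EuclideanSpace.single 1 (2 * π) := by
  ext i
  fin_cases i <;> simp [Ph]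

lemma homog (hb : 0 < b₀) (hL : 0 < L) {w : V3 → ℝ} {M : ℝ} (h : IsCutoffSolution b₀ L (fun _ => 0) w)
    (hM : ∀ x ∈ wedgeQL b₀ L, rx x < 1 → |w x| ≤ M) : ∀ x ∈ wedgeQL b₀ L, w x = 0 := by
  obtain ⟨c2, pde, a0, a1, ar, per, lim⟩ := h
  set S := SL b₀ L with hS
  have hlt := Real.arctan_lt_pi_div_two b₀
  have dw := c2.differentiableOn two_ne_zero
  have cP := fun i => pd_diff (m := 1) hb hL c2 (by norm_num) i
  have dP := fun i => (cP i).differentiableOn one_ne_zero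
  have cPP := fun i j => (pd_diff (m := 0) hb hL (cP j) (by norm_num) i).continuousOn
  have perW : ∀ s < Real.log L, ∀ θ ∈ Th b₀, ∀ y, w (Ph (s, θ, y + 2 * π)) = w (Ph (s, θ, y)) := by
    intro s hs θ hθ y
    rw [Ph_shift]
    exact per _ (Ph_mem_SL hb hθ ((le_log_iff_exp_le hL).1 hs.le)).1
  have k0 := U_cont hb hL c2.continuousOn
  have k1 := fun i => U_cont hb hL (cP i).continuousOn
  have k2 := fun i j => U_cont hb hL (cPP i j)
  rw [← hS] at *
  have main := energy (ℓ := Real.log L) (θ₀ := Real.arctan b₀) (θ₁ := π / 2) (M := M) hlt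
    (W := fun p => w (Ph p))
    (Ws := fun p => exp p.1 * Real.cos p.2.1 * pdW S 0 w (Ph p) + exp p.1 * Real.sin p.2.1 * pdW S 2 w (Ph p))
    (Wt := fun p => -(exp p.1 * Real.sin p.2.1) * pdW S 0 w (Ph p) + exp p.1 * Real.cos p.2.1 * pdW S 2 w (Ph p))
    (Wy := fun p => pdW S 1 w (Ph p))
    (Wss := fun p => exp p.1 * Real.cos p.2.1 * pdW S 0 w (Ph p) + exp p.1 * Real.sin p.2.1 * pdW S 2 w (Ph p) +
      exp p.1 * exp p.1 * (Real.cos p.2.1 * Real.cos p.2.1 * pdW S 0 (pdW S 0 w) (Ph p) +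
        Real.cos p.2.1 * Real.sin p.2.1 * (pdW S 2 (pdW S 0 w) (Ph p) + pdW S 0 (pdW S 2 w) (Ph p)) +
        Real.sin p.2.1 * Real.sin p.2.1 * pdW S 2 (pdW S 2 w) (Ph p)))
    (Wtt := fun p => -(exp p.1 * Real.cos p.2.1 * pdW S 0 w (Ph p) + exp p.1 * Real.sin p.2.1 * pdW S 2 w (Ph p)) +
      exp p.1 * exp p.1 * (Real.sin p.2.1 * Real.sin p.2.1 * pdW S 0 (pdW S 0 w) (Ph p) -
        Real.cos p.2.1 * Real.sin p.2.1 * (pdW S 2 (pdW S 0 w) (Ph p) + pdW S 0 (pdW S 2 w) (Ph p)) +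
        Real.cos p.2.1 * Real.cos p.2.1 * pdW S 2 (pdW S 2 w) (Ph p)))
    (Wyy := fun p => pdW S 1 (pdW S 1 w) (Ph p))
    k0
    (by have := k1 0; have := k1 2; fun_prop)
    (by have := k1 0; have := k1 2; fun_prop)
    (k1 1)
    (by have := k1 0; have := k1 2; have := k2 0 0; have := k2 2 0; have := k2 0 2; have := k2 2 2; fun_prop)
    (by have := k1 0; have := k1 2; have := k2 0 0; have := k2 2 0; have := k2 0 2; have := k2 2 2; fun_prop)
    (k2 1 1)
    (fun s hs θ hθ y => U_ds hb hL dw y hs hθ)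
    (fun s hs θ hθ y => by
      have h0 := U_ds hb hL (dP 0) y hs hθ
      have h2 := U_ds hb hL (dP 2) y hs hθ
      refine ((((hasDerivAt_exp s).mul_const (Real.cos θ)).mul h0).add (((hasDerivAt_exp s).mul_const (Real.sin θ)).mul h2)).congr_deriv ?_
      simp only [← hS]
      ring)
    (fun s hs θ hθ y => U_dt hb hL dw y hs hθ)
    (fun s hs θ hθ y => by
      have h0 := U_dt hb hL (dP 0) y hs hθ
      have h2 := U_dt hb hL (dP 2) y hs hθ
      refine ((((Real.hasDerivAt_sin θ).const_mul (exp s)).neg.mul h0).add (((Real.hasDerivAt_cos θ).const_mul (exp s)).mul h2)).congr_deriv ?_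
      simp only [← hS, Pi.neg_apply]
      ring)
    (fun s hs θ hθ y => U_dy hb hL dw y hs hθ)
    (fun s hs θ hθ y => U_dy hb hL (dP 1) y hs hθ)
    (fun s hs θ hθ y => by
      have h3 := pde (Ph (s, θ, y)) (Ph_mem_QL hb hθ.1 hθ.2 ((lt_log_iff_exp_lt hL).1 hs))
      rw [lapW, Fin.sum_univ_three] at h3
      have h4 := Real.sin_sq_add_cos_sq θ
      have h5 : exp (2 * s) = exp s * exp s := by rw [two_mul, exp_add]
      simp only [h5]
      linear_combination exp s * exp s * h3 + exp s * exp s * (pdW S 0 (pdW S 0 w) (Ph (s, θ, y)) + pdW S 2 (pdW S 2 w) (Ph (s, θ, y))) * h4)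
    (fun s hs y => by
      have hc := sin_sub_th0 b₀ (Real.arctan b₀)
      rw [sub_self, Real.sin_zero, zero_div] at hc
      have hc' : Real.sin (Real.arctan b₀) = b₀ * Real.cos (Real.arctan b₀) := by linarith
      have hs' := (lt_log_iff_exp_lt hL).1 hs
      have h3 := a0 (Ph (s, Real.arctan b₀, y)) (Ph_mem_SL hb ⟨le_rfl, hlt.le⟩ hs'.le) (by simp only [Ph_0, Ph_2, hc']; ring) (by rw [rx_Ph]; exact hs')
      simp only [hc']
      linear_combination -exp s * Real.cos (Real.arctan b₀) * h3)
    (fun s hs y => by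
      have hs' := (lt_log_iff_exp_lt hL).1 hs
      have h3 := a1 (Ph (s, π / 2, y)) (Ph_mem_SL hb ⟨hlt.le, le_rfl⟩ hs'.le) (by simp) (by rw [rx_Ph]; exact hs')
      simp [h3])
    (fun θ hθ y => by
      have h3 := ar (Ph (Real.log L, θ, y)) (Ph_mem_SL hb hθ (exp_log hL).le) (by rw [rx_Ph]; exact exp_log hL)
      have : cutoffConst b₀ L (fun _ => 0) = 0 := by simp [cutoffConst]
      rw [this] at h3
      simp only [Ph_0, Ph_2, exp_log hL] at h3 ⊢
      field_simp at h3
      linear_combination L * h3)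
    (fun s hs θ hθ => by simpa using perW s hs θ hθ 0)
    (fun s hs θ hθ => by
      have h1 := U_dy hb hL dw (0 + 2 * π) hs hθ
      have h2 := (U_dy hb hL dw 0 hs hθ)
      have h3 := h1.comp_add_const (x := 0) (a := 2 * π)
      have h4 : (fun y => w (Ph (s, θ, y + 2 * π))) = fun y => w (Ph (s, θ, y)) := funext fun y => perW s hs θ hθ y
      rw [h4] at h3
      have := h3.unique h2
      rw [zero_add] at this
      exact this)
    (fun s hs h0 θ hθ y => hM _ (Ph_mem_QL hb hθ.1 hθ.2 ((lt_log_iff_exp_lt hL).1 hs)) (by rw [rx_Ph]; simpa using h0))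
  intro x hx
  obtain ⟨hx2, hang⟩ := Ps_ang_strict hb hx.1
  have hxe := Ph_Ps hx2
  obtain ⟨s, θ, y, hsx⟩ : ∃ s θ y, Ps x = (s, θ, y) := ⟨_, _, _, rfl⟩
  rw [hsx] at hxe hang
  have hθ : θ ∈ Th b₀ := Ioo_subset_Icc_self hang
  have hs : s < Real.log L := by
    rw [lt_log_iff_exp_lt hL, ← rx_Ph (s, θ, y), hxe]; exact hx.2
  rw [← hxe]
  -- reduce to y ∈ [0, 2π]
  have pp : Function.Periodic (fun y => w (Ph (s, θ, y))) (2 * π) := fun y => perW s hs θ hθ y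
  obtain ⟨y', hy', hyy⟩ := pp.exists_mem_Ico₀ (by positivity) y
  rw [hyy]
  have hy'' : y' ∈ Icc 0 (2 * π) := Ico_subset_Icc_self hy'
  have e1 : w (Ph (s, θ, y')) = w (Ph (s, θ, 0)) := by
    refine constant_of_derivWithin_zero (f := fun y => w (Ph (s, θ, y))) (a := 0) (b := 2 * π) ?_ ?_ y' hy''
    · exact fun y _ => (U_dy hb hL dw y hs hθ).differentiableAt.differentiableWithinAt
    · intro y hy
      rw [(U_dy hb hL dw y hs hθ).hasDerivWithinAt.derivWithin (uniqueDiffOn_Icc (by positivity) y (Ico_subset_Icc_self hy))]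
      exact (main s hs θ hθ y (Ico_subset_Icc_self hy)).2
  have e2 : ∀ t ≤ s, w (Ph (t, θ, 0)) = w (Ph (s, θ, 0)) := by
    intro t ht
    rcases eq_or_lt_of_le ht with h | h
    · rw [h]
    refine (constant_of_derivWithin_zero (f := fun s => w (Ph (s, θ, 0))) (a := t) (b := s) ?_ ?_ s ⟨ht, le_rfl⟩).symm
    · exact fun r hr => (U_ds hb hL dw 0 (hr.2.trans_lt hs) hθ).differentiableAt.differentiableWithinAt
    · intro r hr
      rw [(U_ds hb hL dw 0 (hr.2.trans hs) hθ).hasDerivWithinAt.derivWithin (uniqueDiffOn_Icc h r (Ico_subset_Icc_self hr))]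
      exact (main r (hr.2.trans hs) θ hθ 0 ⟨le_rfl, by positivity⟩).1
  rw [e1]
  have tl : Tendsto (fun t => w (Ph (t, θ, 0))) atBot (𝓝 0) := by
    refine lim.comp (tendsto_nhdsWithin_iff.2 ⟨?_, ?_⟩)
    · have h1 : Tendsto (fun t : ℝ => (exp t * Real.cos θ) • ee 0 + ((0:ℝ) • ee 1 + (exp t * Real.sin θ) • ee 2)) atBot (𝓝 ((0 * Real.cos θ) • ee 0 + ((0:ℝ) • ee 1 + (0 * Real.sin θ) • ee 2))) :=
        ((tendsto_exp_atBot.mul_const _).smul_const _).add (tendsto_const_nhds.add ((tendsto_exp_atBot.mul_const _).smul_const _))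
      simp only [zero_mul, zero_smul, add_zero] at h1
      refine h1.congr fun t => ?_
      rw [Ph_eq]; simp
    · filter_upwards [eventually_le_atBot s] with t ht
      exact Ph_mem_SL hb hθ ((le_log_iff_exp_le hL).1 (ht.trans hs.le))
  refine tendsto_nhds_unique (tendsto_const_nhds.congr' ?_) tl
  filter_upwards [eventually_le_atBot s] with t ht using (e2 t ht).symm

lemma uniqueness (hb : 0 < b₀) (hL : 0 < L) {δ δ₀ : ℝ} (hδ : 0 < δ) {f v₁ v₂ : V3 → ℝ} {M₁ M₂ : ℝ} (h1 : IsCutoffSolution b₀ L f v₁) (h2 : IsCutoffSolution b₀ L f v₂)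
    (b1 : wsupLE (SL b₀ L) 0 (-1 - δ) (-δ₀) (wedgeQL b₀ L) v₁ M₁) (b2 : wsupLE (SL b₀ L) 0 (-1 - δ) (-δ₀) (wedgeQL b₀ L) v₂ M₂) :
    EqOn v₁ v₂ (SL b₀ L) := by
  have key : ∀ x ∈ wedgeQL b₀ L, v₁ x - v₂ x = 0 := by
    refine homog hb hL (M := M₁ + M₂) (sol_sub hb hL h1 h2) fun x hx hr => ?_
    have hpos : 0 < rx x := by
      rw [← exp_Ps (SL_param hb (wedgeQL_sub_SL hb hx)).1]; exact exp_pos _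
    have e1 := b1.1 0 le_rfl x hx hpos hr
    have e2 := b2.1 0 le_rfl x hx hpos hr
    have : max (-1 - δ + ((0:ℕ):ℝ)) 0 = 0 := max_eq_right (by push_cast; linarith)
    rw [this, rpow_zero, one_mul, norm_iteratedFDerivWithin_zero, Real.norm_eq_abs] at e1 e2
    exact (abs_sub _ _).trans (add_le_add e1 e2)
  exact EqOn.of_subset_closure (fun x hx => sub_eq_zero.1 (key x hx)) h1.1.continuousOn h2.1.continuousOn (wedgeQL_sub_SL hb) sdiff_subset
end



lemma construct (b₀ δ δ₀ : ℝ) (hb : 0 < b₀) (hδ0 : 0 < δ) (hδ1 : δ < 1) (hδ₀0 : 0 < δ₀) (hδ₀1 : δ₀ < 1) :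
    ∃ C : ℝ, 0 < C ∧ ∀ L : ℝ, 4 ≤ L → ∀ f : V3 → ℝ, ContDiffOn ℝ 4 f (SQ b₀) → Per2On (closure (wedgeQ b₀)) f →
      ∀ M : ℝ, 0 ≤ M → wsupLE (SQ b₀) 4 (1 - δ) (2 - δ₀) (wedgeQL b₀ L) f M →
      ∃ v : V3 → ℝ, IsCutoffSolution b₀ L f v ∧ wsupLE (SL b₀ L) 0 (-1 - δ) (-δ₀) (wedgeQL b₀ L) v (C * M) := by
  have hω : 0 < π / 2 - Real.arctan b₀ := by linarith [Real.arctan_lt_pi_div_two b₀]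
  obtain ⟨C, hC, H⟩ := polar_sol (kap b₀) (Real.arctan b₀) (1 + δ) δ₀ (kap_ge hb) (by linarith) (by linarith) hδ₀0 hδ₀1
  refine ⟨2 * (C * (72 / (π / 2 - Real.arctan b₀))), by positivity, fun L hL4 f hf hp M hM h => ?_⟩
  have hL : 0 < L := by linarith
  obtain ⟨K, kpde, kus, kut, kper, klim, kbd⟩ := H (Real.log L) (by rw [exp_log hL]; exact hL4) (72 / (π / 2 - Real.arctan b₀) * M) (by positivity)
    (Fco b₀ f) (Fco_cont hb hf.continuousOn)
    (fun n s hs => Fco_bound hb hf hp hδ0 hδ1 hδ₀1 hδ₀0 h n ((le_log_iff_exp_le hL).1 hs))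
  refine ⟨fun x => K.u (Ps x), sol_of_pk hb hL K f ?_ ?_ ?_ ?_ kper klim, ?_, ?_⟩
  · rintro ⟨s, θ, y⟩ hs hθ
    simp only at hs hθ
    obtain ⟨S, hS, e⟩ := kpde (s, θ, y) ((le_log_iff_exp_le hL).2 hs.le)
    rw [e, FF_inv hb hf hp hδ0 hδ1 hδ₀1 hδ₀0 h hs.le hθ y hS, Complex.ofReal_re, FF, clampT_eq hθ]
  · intro θ y
    rw [kus, cL hb hf hδ0 hδ1 hδ₀1 hδ₀0 hL h]
  · exact fun s y => kut s _ y fun j => by simp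
  · refine fun s y => kut s _ y fun j => ?_
    have : kap b₀ * j * (π / 2 - Real.arctan b₀) = j * π := by linear_combination (j : ℝ) * kap_mul b₀
    rw [this, Real.sin_int_mul_pi]
  · intro j hj x hx h0 h1
    obtain rfl : j = 0 := by omega
    have : max (-1 - δ + ((0:ℕ):ℝ)) 0 = 0 := max_eq_right (by push_cast; linarith)
    rw [this, rpow_zero, one_mul, norm_iteratedFDerivWithin_zero, Real.norm_eq_abs]
    obtain ⟨hx2, -, hl, -⟩ := SL_param hb (wedgeQL_sub_SL hb hx)
    have hb1 := kbd (Ps x) ((le_log_iff_exp_le hL).2 hl)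
    have e1 : exp (δ₀ * (Ps x).1) ≤ 1 := by
      rw [← exp_Ps hx2] at h1
      have : (Ps x).1 < 0 := by simpa using h1
      exact exp_le_one_iff.2 (by nlinarith)
    refine hb1.trans ?_
    have : 0 ≤ C * (72 / (π / 2 - Real.arctan b₀) * M) := by positivity
    nlinarith
  · intro j hj x hx h1
    obtain rfl : j = 0 := by omega
    rw [norm_iteratedFDerivWithin_zero, Real.norm_eq_abs]
    obtain ⟨hx2, -, hl, -⟩ := SL_param hb (wedgeQL_sub_SL hb hx)
    have hb1 := kbd (Ps x) ((le_log_iff_exp_le hL).2 hl)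
    have hB : 0 ≤ C * (72 / (π / 2 - Real.arctan b₀) * M) := by positivity
    rw [← exp_Ps hx2] at h1 ⊢
    have h2 : 0 < (Ps x).1 := by simpa using h1
    have e1 : 1 ≤ exp (δ₀ * (Ps x).1) := one_le_exp (by positivity)
    have e2 : exp (Ps x).1 ^ (-δ₀ + ((0:ℕ):ℝ)) = (exp (δ₀ * (Ps x).1))⁻¹ := by
      rw [← Real.exp_mul, ← Real.exp_neg]; congr 1; push_cast; ring
    rw [e2, inv_mul_le_iff₀ (by positivity)]
    refine hb1.trans ?_
    nlinarith



/-- Proposition 4.1: unique solvability of the cut-off problem (4.4) and the uniform estimate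
`‖v_L‖^{(−1−δ,−δ₀)}_{0,0;Q_L} ≤ C‖f_L‖^{(1−δ,2−δ₀)}_{4,α;Q_L}` with `C` independent of `L`. -/
theorem stmt12 (b₀ α δ δ₀ : ℝ) (hb₀ : 0 < b₀) (hα0 : 0 < α) (hα1 : α < 1)
    (hδ0 : 0 < δ) (hδ1 : δ < 1) (hδ₀0 : 0 < δ₀) (hδ₀1 : δ₀ < 1) :
    ∃ C : ℝ, 0 < C ∧
      ∀ L : ℝ, 4 ≤ L → ∀ f : V3 → ℝ,
        memH (SQ b₀) 4 α (1 - δ) (2 - δ₀) (wedgeQ b₀) f →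
        Per2On (closure (wedgeQ b₀)) f →
        (∃ v : V3 → ℝ, IsCutoffSolution b₀ L f v ∧
            ∃ M : ℝ, wsupLE (SL b₀ L) 0 (-1 - δ) (-δ₀) (wedgeQL b₀ L) v M) ∧
        (∀ v₁ v₂ : V3 → ℝ,
            IsCutoffSolution b₀ L f v₁ →
            (∃ M, wsupLE (SL b₀ L) 0 (-1 - δ) (-δ₀) (wedgeQL b₀ L) v₁ M) →
            IsCutoffSolution b₀ L f v₂ →
            (∃ M, wsupLE (SL b₀ L) 0 (-1 - δ) (-δ₀) (wedgeQL b₀ L) v₂ M) →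
            Set.EqOn v₁ v₂ (SL b₀ L)) ∧
        (∀ v : V3 → ℝ, IsCutoffSolution b₀ L f v →
            (∃ M, wsupLE (SL b₀ L) 0 (-1 - δ) (-δ₀) (wedgeQL b₀ L) v M) →
            ∀ M : ℝ, 0 ≤ M →
              wnormLE (SQ b₀) 4 α (1 - δ) (2 - δ₀) (wedgeQL b₀ L) f M →
              wsupLE (SL b₀ L) 0 (-1 - δ) (-δ₀) (wedgeQL b₀ L) v (C * M)) := by
  obtain ⟨C, hC, H⟩ := construct b₀ δ δ₀ hb₀ hδ0 hδ1 hδ₀0 hδ₀1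
  refine ⟨C, hC, fun L hL4 f hf hp => ?_⟩
  have hL : 0 < L := by linarith
  obtain ⟨hfc, M, hM, hn⟩ := hf
  refine ⟨?_, ?_, ?_⟩
  · obtain ⟨v, hv, hb⟩ := H L hL4 f hfc hp M hM
      ⟨fun j hj x hx => hn.1.1 j hj x hx.1, fun j hj x hx => hn.1.2 j hj x hx.1⟩
    exact ⟨v, hv, _, hb⟩
  · rintro v₁ v₂ h1 ⟨M₁, b1⟩ h2 ⟨M₂, b2⟩
    exact uniqueness hb₀ hL hδ0 h1 h2 b1 b2
  · rintro v hv ⟨M₁, b1⟩ M' hM' hn'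
    obtain ⟨u, hu, hb⟩ := H L hL4 f hfc hp M' hM' hn'.1
    have e := uniqueness hb₀ hL hδ0 hv hu b1 hb
    have e' : ∀ x ∈ wedgeQL b₀ L, ‖iteratedFDerivWithin ℝ 0 v (SL b₀ L) x‖ = ‖iteratedFDerivWithin ℝ 0 u (SL b₀ L) x‖ := by
      intro x hx
      rw [norm_iteratedFDerivWithin_zero, norm_iteratedFDerivWithin_zero, e (wedgeQL_sub_SL hb₀ hx)]
    refine ⟨fun j hj x hx h0 h1 => ?_, fun j hj x hx h1 => ?_⟩
    · obtain rfl : j = 0 := by omega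
      rw [e' x hx]; exact hb.1 0 le_rfl x hx h0 h1
    · obtain rfl : j = 0 := by omega
      rw [e' x hx]; exact hb.2 0 le_rfl x hx h1
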